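/- Let M be the local uncentered Hardy–Littlewood maximal operator with respect to an open set Ω ⊆ ℝ^d and let E ⊆ ℝ^d have locally finite perimeter. Then Var_Ω(M1_E) ≤ C_d · H^{d-1}(∂*E ∩ Ω), where C_d depends only on d. In particular, Var(M1_E) ≤ C_d · Var(1_E) on ℝ^d. -/

import Mathlib

open MeasureTheory Metric Set Filter
open scoped ENNReal

noncomputable def mClos {d : ℕ} (E : Set (EuclideanSpace ℝ (Fin d))) :
    Set (EuclideanSpace ℝ (Fin d)) :=
  {x | 0 < Filter.limsup
      (fun r : ℝ => volume (Metric.ball x r ∩ E) / ENNReal.ofReal (r ^ d))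
      (nhdsWithin 0 (Set.Ioi 0))}

noncomputable def mBdry {d : ℕ} (E : Set (EuclideanSpace ℝ (Fin d))) :
    Set (EuclideanSpace ℝ (Fin d)) :=
  mClos E ∩ mClos Eᶜ

noncomputable def divg {d : ℕ} (φ : EuclideanSpace ℝ (Fin d) → EuclideanSpace ℝ (Fin d))
    (x : EuclideanSpace ℝ (Fin d)) : ℝ :=
  ∑ i, fderiv ℝ φ x (EuclideanSpace.single i 1) i

noncomputable def var {d : ℕ} (Ω : Set (EuclideanSpace ℝ (Fin d)))
    (f : EuclideanSpace ℝ (Fin d) → ℝ) : ℝ≥0∞ :=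
  ⨆ (φ : EuclideanSpace ℝ (Fin d) → EuclideanSpace ℝ (Fin d)) (_ : ContDiff ℝ 1 φ)
    (_ : HasCompactSupport φ) (_ : tsupport φ ⊆ Ω) (_ : ∀ x, ‖φ x‖ ≤ 1),
    ENNReal.ofReal (∫ x in Ω, f x * divg φ x)

def HasLocFinitePerimeter {d : ℕ} (E : Set (EuclideanSpace ℝ (Fin d))) : Prop :=
  ∀ U : Set (EuclideanSpace ℝ (Fin d)), IsOpen U → Bornology.IsBounded U →
    var U (E.indicator fun _ => (1 : ℝ)) < ⊤

/-- Local uncentered Hardy–Littlewood maximal function of `1_E` with respect to `Ω`. -/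
noncomputable def uncMax {d : ℕ} (Ω E : Set (EuclideanSpace ℝ (Fin d)))
    (x : EuclideanSpace ℝ (Fin d)) : ℝ≥0∞ :=
  ⨆ (z : EuclideanSpace ℝ (Fin d)) (r : ℝ) (_ : x ∈ Metric.ball z r)
    (_ : Metric.ball z r ⊆ Ω),
    volume (E ∩ Metric.ball z r) / volume (Metric.ball z r)

abbrev Vd (d : ℕ) := EuclideanSpace ℝ (Fin d)

noncomputable abbrev Per {d : ℕ} (Ω E : Set (Vd d)) : ℝ≥0∞ :=
  var Ω (E.indicator fun _ => (1 : ℝ))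

structure IsTest {d : ℕ} (Ω : Set (Vd d)) (φ : Vd d → Vd d) : Prop where
  cd : ContDiff ℝ 1 φ
  cs : HasCompactSupport φ
  ts : tsupport φ ⊆ Ω
  le : ∀ x, ‖φ x‖ ≤ 1

theorem tsup_mono {X A B : Type*} [TopologicalSpace X] [Zero A] [Zero B] {f : X → A} {g : X → B}
    (h : ∀ x, g x = 0 → f x = 0) : tsupport f ⊆ tsupport g :=
  closure_mono fun x hx hg => hx (h x hg)

theorem divg_continuous {d : ℕ} {φ : Vd d → Vd d} (h : ContDiff ℝ 1 φ) :
    Continuous (divg φ) := by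
  have h1 : Continuous (fderiv ℝ φ) := h.continuous_fderiv one_ne_zero
  unfold divg
  refine continuous_finsetSum _ fun i _ => ?_
  have : Continuous fun x => (fderiv ℝ φ x) (EuclideanSpace.single i 1) :=
    h1.clm_apply continuous_const
  exact (EuclideanSpace.proj (𝕜 := ℝ) i).continuous.comp this

theorem divg_tsupport {d : ℕ} (φ : Vd d → Vd d) : tsupport (divg φ) ⊆ tsupport φ := by
  refine closure_minimal ?_ (isClosed_tsupport _)
  intro x hx
  by_contra hc
  apply hx
  have : fderiv ℝ φ x = 0 := by
    by_contra h0
    exact hc (support_fderiv_subset ℝ h0)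
  simp [divg, this]

theorem divg_zero_of {d : ℕ} {φ : Vd d → Vd d} {x : Vd d} (h : x ∉ tsupport φ) : divg φ x = 0 := by
  by_contra h0
  exact h (divg_tsupport φ (subset_tsupport _ h0))

theorem divg_cs {d : ℕ} {φ : Vd d → Vd d} (h : HasCompactSupport φ) :
    HasCompactSupport (divg φ) :=
  h.of_isClosed_subset (isClosed_tsupport _) (divg_tsupport φ)

theorem divg_integrable {d : ℕ} {φ : Vd d → Vd d} (h : ContDiff ℝ 1 φ) (hc : HasCompactSupport φ) :
    Integrable (divg φ) volume :=
  (divg_continuous h).integrable_of_hasCompactSupport (divg_cs hc)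

theorem divg_add {d : ℕ} {φ ψ : Vd d → Vd d} (h : ContDiff ℝ 1 φ) (h' : ContDiff ℝ 1 ψ) (x : Vd d) :
    divg (fun y => φ y + ψ y) x = divg φ x + divg ψ x := by
  simp only [divg, ← Finset.sum_add_distrib]
  rw [fderiv_fun_add (h.differentiable one_ne_zero x) (h'.differentiable one_ne_zero x)]
  simp

theorem divg_smul {d : ℕ} {φ : Vd d → Vd d} {g : Vd d → ℝ} (h : ContDiff ℝ 1 φ)
    (hg : ContDiff ℝ 1 g) (x : Vd d) :
    divg (fun y => g y • φ y) x = g x * divg φ x + fderiv ℝ g x (φ x) := by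
  simp only [divg]
  rw [fderiv_fun_smul (hg.differentiable one_ne_zero x) (h.differentiable one_ne_zero x)]
  simp only [_root_.add_apply, _root_.smul_apply,
    ContinuousLinearMap.smulRight_apply, PiLp.add_apply, PiLp.smul_apply, smul_eq_mul,
    Finset.sum_add_distrib, Finset.mul_sum]
  congr 1
  have : φ x = ∑ i, φ x i • EuclideanSpace.single i (1:ℝ) := by
    ext j
    simp [Finset.sum_apply, Pi.single_apply]
  conv_rhs => rw [this]
  simp [map_sum, mul_comm]

theorem divg_const_smul {d : ℕ} {φ : Vd d → Vd d} (c : ℝ) (h : ContDiff ℝ 1 φ) (x : Vd d) :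
    divg (fun y => c • φ y) x = c * divg φ x := by
  rw [divg_smul h contDiff_const]; simp

theorem divg_neg {d : ℕ} {φ : Vd d → Vd d} (h : ContDiff ℝ 1 φ) (x : Vd d) :
    divg (fun y => - φ y) x = - divg φ x := by
  have := divg_const_smul (-1) h x
  simpa using this

/-- divergence of a product of a scalar function with a constant vector. -/
theorem divg_smul_const {d : ℕ} {g : Vd d → ℝ} (hg : ContDiff ℝ 1 g) (v x : Vd d) :
    divg (fun y => g y • v) x = fderiv ℝ g x v := by
  rw [divg_smul (φ := fun _ => v) contDiff_const hg]
  simp [divg]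

theorem integral_divg {d : ℕ} {φ : Vd d → Vd d} (h : ContDiff ℝ 1 φ) (hc : HasCompactSupport φ) :
    ∫ x, divg φ x = 0 := by
  simp only [divg]
  have key : ∀ i : Fin d, Integrable (fun x => fderiv ℝ φ x (EuclideanSpace.single i 1) i) ∧
      ∫ x, fderiv ℝ φ x (EuclideanSpace.single i 1) i = 0 := by
    intro i
    set g : Vd d → ℝ := fun x => φ x i with hg
    have hgc : ContDiff ℝ 1 g := (EuclideanSpace.proj (𝕜 := ℝ) i).contDiff.comp h
    have hgs : HasCompactSupport g := hc.comp_left (g := fun v : Vd d => v i) rfl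
    have hfd : ∀ x, fderiv ℝ g x = (EuclideanSpace.proj (𝕜 := ℝ) i).comp (fderiv ℝ φ x) := by
      intro x
      exact ((EuclideanSpace.proj (𝕜 := ℝ) i).hasFDerivAt.comp x
        (h.differentiable one_ne_zero x).hasFDerivAt).fderiv
    have hI : Integrable (fun x => fderiv ℝ g x (EuclideanSpace.single i 1)) := by
      apply Continuous.integrable_of_hasCompactSupport
      · exact (hgc.continuous_fderiv one_ne_zero).clm_apply continuous_const
      · exact (hgs.fderiv ℝ).comp_left (g := fun L : Vd d →L[ℝ] ℝ => L (EuclideanSpace.single i 1)) rfl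
    have h0 := integral_mul_fderiv_eq_neg_fderiv_mul_of_integrable (μ := (volume : Measure (Vd d)))
      (f := fun _ => (1:ℝ)) (g := g) (v := EuclideanSpace.single i 1) (by simp)
      (by simpa using hI) (by simpa using hgc.continuous.integrable_of_hasCompactSupport hgs)
      (fun x _ => by fun_prop) (fun x _ => hgc.differentiable one_ne_zero x)
    simp [hfd] at h0 hI
    exact ⟨hI, h0⟩
  rw [integral_finsetSum _ (fun i _ => (key i).1)]
  exact Finset.sum_eq_zero fun i _ => (key i).2

theorem setIntegral_test {d : ℕ} {Ω : Set (Vd d)} {φ : Vd d → Vd d} (hφ : IsTest Ω φ)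
    (f : Vd d → ℝ) : ∫ x in Ω, f x * divg φ x = ∫ x, f x * divg φ x := by
  apply setIntegral_eq_integral_of_forall_compl_eq_zero
  intro x hx
  rw [divg_zero_of (fun h => hx (hφ.ts h)), mul_zero]

theorem le_var {d : ℕ} {Ω : Set (Vd d)} {φ : Vd d → Vd d} (hφ : IsTest Ω φ)
    (f : Vd d → ℝ) : ENNReal.ofReal (∫ x, f x * divg φ x) ≤ var Ω f := by
  rw [← setIntegral_test hφ]
  unfold var
  exact le_iSup_of_le φ (le_iSup_of_le hφ.cd (le_iSup_of_le hφ.cs (le_iSup_of_le hφ.ts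
    (le_iSup_of_le hφ.le le_rfl))))

theorem var_le {d : ℕ} {Ω : Set (Vd d)} {f : Vd d → ℝ} {C : ℝ≥0∞}
    (h : ∀ φ, IsTest Ω φ → ENNReal.ofReal (∫ x, f x * divg φ x) ≤ C) : var Ω f ≤ C := by
  unfold var
  refine iSup_le fun φ => iSup_le fun h1 => iSup_le fun h2 => iSup_le fun h3 => iSup_le fun h4 => ?_
  have hφ : IsTest Ω φ := ⟨h1, h2, h3, h4⟩
  rw [setIntegral_test hφ]
  exact h φ hφ

theorem ind_mul {d : ℕ} {E : Set (Vd d)} (hE : MeasurableSet E) (g : Vd d → ℝ) :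
    ∫ x, E.indicator (fun _ => (1:ℝ)) x * g x = ∫ x in E, g x := by
  rw [← integral_indicator hE]
  congr 1; ext x; by_cases hx : x ∈ E <;> simp [hx]

theorem le_Per {d : ℕ} {Ω E : Set (Vd d)} (hE : MeasurableSet E) {φ : Vd d → Vd d}
    (hφ : IsTest Ω φ) : ENNReal.ofReal (∫ x in E, divg φ x) ≤ Per Ω E := by
  rw [← ind_mul hE]; exact le_var hφ _

theorem Per_le {d : ℕ} {Ω E : Set (Vd d)} (hE : MeasurableSet E) {C : ℝ≥0∞}
    (h : ∀ φ, IsTest Ω φ → ENNReal.ofReal (∫ x in E, divg φ x) ≤ C) : Per Ω E ≤ C := by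
  refine var_le fun φ hφ => ?_
  rw [ind_mul hE]; exact h φ hφ

theorem le_Per_toReal {d : ℕ} {Ω E : Set (Vd d)} (hE : MeasurableSet E) {φ : Vd d → Vd d}
    (hφ : IsTest Ω φ) (hP : Per Ω E ≠ ⊤) : (∫ x in E, divg φ x) ≤ (Per Ω E).toReal :=
  (ENNReal.ofReal_le_iff_le_toReal hP).1 (le_Per hE hφ)

theorem le_Per_scaled {d : ℕ} {Ω E : Set (Vd d)} (hE : MeasurableSet E) {φ : Vd d → Vd d} {M : ℝ}
    (hM : 0 < M) (h1 : ContDiff ℝ 1 φ) (h2 : HasCompactSupport φ) (h3 : tsupport φ ⊆ Ω)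
    (h4 : ∀ x, ‖φ x‖ ≤ M) : ENNReal.ofReal (∫ x in E, divg φ x) ≤ ENNReal.ofReal M * Per Ω E := by
  have ht : IsTest Ω (fun y => M⁻¹ • φ y) := by
    refine ⟨h1.const_smul M⁻¹, h2.mono (fun x hx h => hx (by simp [h])), ?_, fun x => ?_⟩
    · exact (tsup_mono (fun x h => by simp [h])).trans h3
    · rw [norm_smul, Real.norm_eq_abs, abs_of_pos (inv_pos.2 hM)]
      have := mul_le_mul_of_nonneg_left (h4 x) (inv_pos.2 hM).le
      rwa [inv_mul_cancel₀ hM.ne'] at this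
  have := le_Per hE ht
  simp only [divg_const_smul _ h1] at this
  rw [integral_const_mul] at this
  calc ENNReal.ofReal (∫ x in E, divg φ x)
      = ENNReal.ofReal M * ENNReal.ofReal (M⁻¹ * ∫ x in E, divg φ x) := by
        rw [← ENNReal.ofReal_mul hM.le, mul_inv_cancel_left₀ hM.ne']
    _ ≤ _ := by gcongr

theorem IsTest.mono {d : ℕ} {Ω Ω' : Set (Vd d)} {φ : Vd d → Vd d} (h : IsTest Ω φ) (hs : Ω ⊆ Ω') :
    IsTest Ω' φ := ⟨h.cd, h.cs, h.ts.trans hs, h.le⟩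

theorem IsTest.neg {d : ℕ} {Ω : Set (Vd d)} {φ : Vd d → Vd d} (h : IsTest Ω φ) :
    IsTest Ω (fun y => - φ y) := by
  refine ⟨h.cd.neg, h.cs.comp_left (g := fun v : Vd d => -v) neg_zero, ?_, fun x => by simpa using h.le x⟩
  refine (closure_mono ?_).trans h.ts
  intro x hx; simpa using hx

theorem isTest_zero {d : ℕ} (Ω : Set (Vd d)) : IsTest Ω (fun _ => (0 : Vd d)) :=
  ⟨contDiff_const, HasCompactSupport.zero, by simp [tsupport], by simp⟩

theorem Per_mono {d : ℕ} {Ω Ω' E : Set (Vd d)} (hE : MeasurableSet E) (hs : Ω ⊆ Ω') :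
    Per Ω E ≤ Per Ω' E := Per_le hE fun _ hφ => le_Per hE (hφ.mono hs)

theorem Per_compl_le {d : ℕ} {Ω E : Set (Vd d)} (hE : MeasurableSet E) :
    Per Ω Eᶜ ≤ Per Ω E := by
  refine Per_le hE.compl fun φ hφ => ?_
  have h1 := integral_add_compl hE (divg_integrable hφ.cd hφ.cs)
  rw [integral_divg hφ.cd hφ.cs] at h1
  have h2 := le_Per hE hφ.neg
  simp only [divg_neg hφ.cd] at h2
  rw [integral_neg] at h2
  rwa [show (∫ x in Eᶜ, divg φ x) = -∫ x in E, divg φ x by linarith]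

theorem Per_compl {d : ℕ} {Ω E : Set (Vd d)} (hE : MeasurableSet E) :
    Per Ω Eᶜ = Per Ω E := by
  refine le_antisymm (Per_compl_le hE) ?_
  have := Per_compl_le (Ω := Ω) hE.compl
  rwa [compl_compl] at this

theorem Per_lt_exists {d : ℕ} {Ω E : Set (Vd d)} (hE : MeasurableSet E) {c : ℝ≥0∞}
    (h : c < Per Ω E) : ∃ φ, IsTest Ω φ ∧ c < ENNReal.ofReal (∫ x in E, divg φ x) := by
  by_contra hc
  push Not at hc
  exact absurd (Per_le hE hc) (not_le.2 h)

theorem Per_superadd {d : ℕ} {U V Ω E : Set (Vd d)} (hE : MeasurableSet E)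
    (hd : Disjoint U V) (hU : U ⊆ Ω) (hV : V ⊆ Ω) :
    Per U E + Per V E ≤ Per Ω E := by
  have key : ∀ φ, IsTest U φ → ∀ ψ, IsTest V ψ →
      ENNReal.ofReal (∫ x in E, divg φ x) + ENNReal.ofReal (∫ x in E, divg ψ x) ≤ Per Ω E := by
    intro φ hφ ψ hψ
    rcases le_total (∫ x in E, divg φ x) 0 with h1 | h1
    · rw [ENNReal.ofReal_of_nonpos h1, zero_add]; exact le_Per hE (hψ.mono hV)
    rcases le_total (∫ x in E, divg ψ x) 0 with h2 | h2
    · rw [ENNReal.ofReal_of_nonpos h2, add_zero]; exact le_Per hE (hφ.mono hU)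
    have ht : IsTest Ω (fun y => φ y + ψ y) := by
      refine ⟨hφ.cd.add hψ.cd, hφ.cs.add hψ.cs, ?_, fun x => ?_⟩
      · exact (tsupport_add φ ψ).trans (union_subset (hφ.ts.trans hU) (hψ.ts.trans hV))
      · by_cases hx : x ∈ tsupport φ
        · have : x ∉ tsupport ψ := fun h => disjoint_left.1 hd (hφ.ts hx) (hψ.ts h)
          rw [image_eq_zero_of_notMem_tsupport this, add_zero]; exact hφ.le x
        · rw [image_eq_zero_of_notMem_tsupport hx, zero_add]; exact hψ.le x
    rw [← ENNReal.ofReal_add h1 h2, ← integral_add (divg_integrable hφ.cd hφ.cs).integrableOn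
      (divg_integrable hψ.cd hψ.cs).integrableOn]
    have := le_Per hE ht
    simpa only [divg_add hφ.cd hψ.cd] using this
  by_contra hc
  push Not at hc
  obtain ⟨a, ha, b, hb, hab⟩ : ∃ a, a ≤ Per U E ∧ ∃ b, b ≤ Per V E ∧ False := by
    exfalso
    by_cases h1 : Per U E = 0
    · rw [h1, zero_add] at hc
      exact absurd (Per_mono hE hV) (not_le.2 hc)
    by_cases h2 : Per V E = 0
    · rw [h2, add_zero] at hc
      exact absurd (Per_mono hE hU) (not_le.2 hc)
    obtain ⟨a, ha, b, hb, hab⟩ := ENNReal.exists_lt_add_of_lt_add hc h1 h2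
    obtain ⟨φ, hφ, h3⟩ := Per_lt_exists hE ha
    obtain ⟨ψ, hψ, h4⟩ := Per_lt_exists hE hb
    have := key φ hφ ψ hψ
    exact absurd (hab.trans_le ((add_le_add h3.le h4.le).trans this)) (lt_irrefl _)
  exact hab

theorem Per_empty {d : ℕ} {E : Set (Vd d)} (hE : MeasurableSet E) : Per ∅ E = 0 := by
  refine le_antisymm (Per_le hE fun φ hφ => ?_) (zero_le)
  have : ∀ x, divg φ x = 0 := fun x => divg_zero_of (fun h => (hφ.ts h).elim)
  simp [this]

theorem Per_finset_superadd {d : ℕ} {ι : Type*} {T : ι → Set (Vd d)} {E : Set (Vd d)}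
    (hE : MeasurableSet E) (s : Finset ι) (hd : (s : Set ι).PairwiseDisjoint T) :
    ∑ i ∈ s, Per (T i) E ≤ Per (⋃ i ∈ s, T i) E := by
  classical
  induction s using Finset.induction_on with
  | empty => simp
  | insert a s ha ih =>
    rw [Finset.sum_insert ha]
    have h1 := ih (hd.subset (by simp))
    refine (add_le_add_right h1 _).trans (Per_superadd hE ?_ ?_ ?_)
    · rw [disjoint_iUnion₂_right]
      intro i hi
      exact hd (by simp) (by simp [hi]) (fun h => ha (h ▸ hi))
    · intro x hx; simp; left; exact hx
    · intro x hx; simp at hx ⊢; right; exact hx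

theorem Per_tsum_superadd {d : ℕ} {ι : Type*} {T : ι → Set (Vd d)} {Ω E : Set (Vd d)}
    (hE : MeasurableSet E) (hd : Pairwise (Function.onFun Disjoint T)) (hT : ∀ i, T i ⊆ Ω) :
    ∑' i, Per (T i) E ≤ Per Ω E := by
  rw [ENNReal.tsum_eq_iSup_sum]
  refine iSup_le fun s => (Per_finset_superadd hE s fun i _ j _ hij => hd hij).trans ?_
  exact Per_mono hE (iUnion₂_subset fun i _ => hT i)

/-- smooth cutoff -/
theorem exists_cutoff {d : ℕ} {K U : Set (Vd d)} (hK : IsCompact K) (hU : IsOpen U) (h : K ⊆ U) :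
    ∃ g : Vd d → ℝ, ContDiff ℝ 1 g ∧ HasCompactSupport g ∧ tsupport g ⊆ U ∧
      (∀ x, g x ∈ Icc (0:ℝ) 1) ∧ (∃ O, IsOpen O ∧ K ⊆ O ∧ ∀ x ∈ O, g x = 1) := by
  obtain ⟨L, hL, hKL, hLU⟩ := exists_compact_between hK hU h
  obtain ⟨f, h1, h2, h3⟩ := exists_contMDiffMap_one_nhds_of_subset_interior
    (modelWithCornersSelf ℝ (Vd d)) (n := 1) hK.isClosed hKL
  have hs : tsupport f ⊆ L := by
    refine closure_minimal ?_ hL.isClosed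
    intro x hx
    by_contra hc
    exact hx (h2 x hc)
  refine ⟨f, f.contMDiff.contDiff, hL.of_isClosed_subset (isClosed_tsupport _) hs,
    hs.trans hLU, h3, ?_⟩
  obtain ⟨O, hO, hKO, hf⟩ := eventually_nhdsSet_iff_exists.1 h1
  exact ⟨O, hO, hKO, hf⟩

theorem Per_union {d : ℕ} {U V E : Set (Vd d)} (hE : MeasurableSet E)
    (hU : IsOpen U) (hV : IsOpen V) : Per (U ∪ V) E ≤ Per U E + Per V E := by
  refine Per_le hE fun φ hφ => ?_
  have hK : IsCompact (tsupport φ \ V) := hφ.cs.isCompact.diff hV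
  obtain ⟨g, g1, g2, g3, g4, O, hO, hKO, hg⟩ := exists_cutoff hK hU (by
    intro x hx; exact (hφ.ts hx.1).resolve_right hx.2)
  have t1 : IsTest U (fun y => g y • φ y) := by
    refine ⟨ContDiff.smul g1 hφ.cd, HasCompactSupport.mono hφ.cs (fun x hx h => hx (by simp [h])), ?_, fun x => ?_⟩
    · exact (tsup_mono (fun x h => by simp [h])).trans g3
    · rw [norm_smul, Real.norm_eq_abs, abs_of_nonneg (g4 x).1]
      exact mul_le_one₀ (g4 x).2 (norm_nonneg _) (hφ.le x)
  have t2 : IsTest V (fun y => (1 - g y) • φ y) := by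
    refine ⟨ContDiff.smul (contDiff_const.sub g1) hφ.cd, HasCompactSupport.mono hφ.cs (fun x hx h => hx (by simp [h])), ?_, fun x => ?_⟩
    · have : tsupport (fun y => (1 - g y) • φ y) ⊆ tsupport φ \ O := by
        refine closure_minimal ?_ ((isClosed_tsupport _).sdiff hO)
        intro x hx
        refine ⟨subset_tsupport _ (fun h => hx (by simp [h])), fun h => hx (by simp [hg x h])⟩
      intro x hx
      have := this hx
      by_contra hc
      exact this.2 (hKO ⟨this.1, hc⟩)
    · have h1 : 0 ≤ 1 - g x := by linarith [(g4 x).2]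
      rw [norm_smul, Real.norm_eq_abs, abs_of_nonneg h1]
      exact mul_le_one₀ (by linarith [(g4 x).1]) (norm_nonneg _) (hφ.le x)
  have : ∀ x, divg φ x = divg (fun y => g y • φ y) x + divg (fun y => (1 - g y) • φ y) x := by
    intro x
    rw [← divg_add t1.cd t2.cd]
    congr 1; ext1 y; rw [← add_smul]; simp
  simp only [this]
  rw [integral_add (divg_integrable t1.cd t1.cs).integrableOn
      (divg_integrable t2.cd t2.cs).integrableOn]
  exact ENNReal.ofReal_add_le.trans (add_le_add (le_Per hE t1) (le_Per hE t2))

theorem Per_iUnion {d : ℕ} {U : ℕ → Set (Vd d)} {E : Set (Vd d)} (hE : MeasurableSet E)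
    (hU : ∀ i, IsOpen (U i)) : Per (⋃ i, U i) E ≤ ∑' i, Per (U i) E := by
  have fin : ∀ s : Finset ℕ, Per (⋃ i ∈ s, U i) E ≤ ∑ i ∈ s, Per (U i) E := by
    intro s
    induction s using Finset.induction_on with
    | empty => simp [Per_empty hE]
    | insert a s ha ih =>
      rw [Finset.sum_insert ha, Finset.set_biUnion_insert]
      exact (Per_union hE (hU a) (isOpen_biUnion fun i _ => hU i)).trans (add_le_add_right ih _)
  refine Per_le hE fun φ hφ => ?_
  obtain ⟨s, hs⟩ := hφ.cs.isCompact.elim_finite_subcover U hU hφ.ts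
  exact (le_Per hE (⟨hφ.cd, hφ.cs, hs, hφ.le⟩ : IsTest _ φ)).trans
    ((fin s).trans (ENNReal.sum_le_tsum s))

theorem shift_bound {d : ℕ} {T E : Set (Vd d)} (hE : MeasurableSet E) {v : Vd d} (hv : v ≠ 0)
    (hT : Convex ℝ T) (hP : Per T E ≠ ⊤) {ψ : Vd d → ℝ} (h1 : ContDiff ℝ 1 ψ)
    (h2 : HasCompactSupport ψ) (h3 : tsupport ψ ⊆ T) (h3' : ∀ x ∈ tsupport ψ, x + v ∈ T)
    (h4 : ∀ x, ψ x ∈ Icc (0:ℝ) 1) :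
    ∫ x in E, (ψ x - ψ (x - v)) ≤ ‖v‖ * (Per T E).toReal := by
  have hv0 : 0 < ‖v‖ := norm_pos_iff.2 hv
  set G : ℝ → ℝ := fun t => ∫ y in E, ψ (y - t • v) with hG
  have hcf : Continuous (fderiv ℝ ψ) := h1.continuous_fderiv one_ne_zero
  obtain ⟨C, hC⟩ := (h2.fderiv ℝ).exists_bound_of_continuous hcf
  obtain ⟨R, hR⟩ := h2.isCompact.isBounded.subset_closedBall (0 : Vd d)
  have hsh : ∀ t : ℝ, ContDiff ℝ 1 (fun y => ψ (y - t • v)) := fun t =>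
    h1.comp (contDiff_id.sub contDiff_const)
  have hfsh : ∀ (t : ℝ) (y : Vd d), fderiv ℝ (fun y => ψ (y - t • v)) y = fderiv ℝ ψ (y - t • v) := by
    intro t y
    exact fderiv_comp_sub (𝕜 := ℝ) (f := ψ) (t • v)
  have hcsh : ∀ t : ℝ, HasCompactSupport (fun y => ψ (y - t • v)) := fun t =>
    h2.comp_homeomorph (Homeomorph.subRight (t • v))
  have hder : ∀ t : ℝ, HasDerivAt G (∫ y in E, -(fderiv ℝ ψ (y - t • v) v)) t := by
    intro t
    have := hasDerivAt_integral_of_dominated_loc_of_deriv_le (μ := (volume : Measure (Vd d)).restrict E)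
      (F := fun t y => ψ (y - t • v)) (F' := fun t y => -(fderiv ℝ ψ (y - t • v) v)) (x₀ := t)
      (s := ball t 1) (ball_mem_nhds t one_pos)
      (bound := (closedBall (0 : Vd d) (R + (|t| + 1) * ‖v‖)).indicator fun _ => C * ‖v‖)
      ?_ ?_ ?_ ?_ ?_ ?_
    · exact this.2
    · exact Eventually.of_forall fun t => (hsh t).continuous.aestronglyMeasurable
    · exact ((hsh t).continuous.integrable_of_hasCompactSupport (hcsh t)).integrableOn
    · refine Continuous.aestronglyMeasurable ?_
      exact ((hcf.comp (by fun_prop)).clm_apply continuous_const).neg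
    · refine Eventually.of_forall fun y s hs => ?_
      by_cases hy : y - s • v ∈ tsupport ψ
      · have : y ∈ closedBall (0 : Vd d) (R + (|t| + 1) * ‖v‖) := by
          have h5 := hR hy
          rw [mem_closedBall_zero_iff] at h5 ⊢
          have h6 : |s| ≤ |t| + 1 := by
            rw [mem_ball, Real.dist_eq] at hs
            have := abs_sub_abs_le_abs_sub s t
            linarith
          calc ‖y‖ = ‖(y - s • v) + s • v‖ := by simp
            _ ≤ ‖y - s • v‖ + ‖s • v‖ := norm_add_le _ _
            _ ≤ _ := by
              rw [norm_smul, Real.norm_eq_abs]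
              gcongr
        rw [indicator_of_mem this, norm_neg]
        exact (ContinuousLinearMap.le_opNorm _ _).trans (by gcongr; exact hC _)
      · have h0 : fderiv ℝ ψ (y - s • v) = 0 := by
          by_contra h0
          exact hy (support_fderiv_subset ℝ h0)
        simp only [h0]
        simp only [_root_.zero_apply, neg_zero, norm_zero]
        refine indicator_nonneg (fun _ _ => ?_) _
        exact mul_nonneg ((norm_nonneg _).trans (hC 0)) (norm_nonneg _)
    · exact ((integrable_indicator_iff measurableSet_closedBall).2
        (integrableOn_const (measure_closedBall_lt_top.ne))).integrableOn
    · refine Eventually.of_forall fun y s hs => ?_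
      have e1 : HasDerivAt (fun s : ℝ => y - s • v) (-v) s := by
        have := ((hasDerivAt_id s).smul_const v).const_sub y
        simpa using this
      have := ((h1.differentiable one_ne_zero (y - s • v)).hasFDerivAt).comp_hasDerivAt s e1
      rw [map_neg] at this
      exact this
  have hb : ∀ t ∈ Icc (0:ℝ) 1, ‖∫ y in E, -(fderiv ℝ ψ (y - t • v) v)‖ ≤ ‖v‖ * (Per T E).toReal := by
    intro t ht
    have key : ∀ σ : ℝ, |σ| = 1 → σ * ∫ y in E, (fderiv ℝ ψ (y - t • v) v) ≤ ‖v‖ * (Per T E).toReal := by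
      intro σ hσ
      have := le_Per_scaled (Ω := T) hE (φ := fun y => ψ (y - t • v) • (σ • v)) (M := ‖v‖) hv0
        ((hsh t).smul contDiff_const) ((hcsh t).mono (fun x hx h => hx (by simp only [h, zero_smul]))) ?_ ?_
      · simp only [divg_smul_const (hsh t), hfsh, map_smul, smul_eq_mul] at this
        rw [integral_const_mul] at this
        rw [← ENNReal.ofReal_toReal hP, ← ENNReal.ofReal_mul hv0.le] at this
        exact (ENNReal.ofReal_le_ofReal_iff (by positivity)).1 this
      · intro y hy
        have hy' : y - t • v ∈ tsupport ψ := by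
          have := tsup_mono (f := fun y => ψ (y - t • v) • (σ • v)) (g := fun y => ψ (y - t • v))
            (fun x hx => by simp only [hx, zero_smul]) hy
          have h7 : tsupport (fun y => ψ (y - t • v)) ⊆ (fun y => y - t • v) ⁻¹' tsupport ψ := by
            refine closure_minimal (fun z hz => subset_tsupport _ hz) ?_
            exact (isClosed_tsupport _).preimage (by fun_prop)
          exact h7 this
        have := hT (h3 hy') (h3' _ hy') (sub_nonneg.2 ht.2) ht.1 (by ring)
        convert this using 1
        module
      · intro y
        rw [norm_smul, norm_smul, Real.norm_eq_abs, Real.norm_eq_abs, hσ, one_mul,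
          abs_of_nonneg (h4 _).1]
        exact mul_le_of_le_one_left hv0.le (h4 _).2
    rw [integral_neg, norm_neg, Real.norm_eq_abs]
    refine abs_le.2 ⟨?_, ?_⟩
    · have := key (-1) (by simp); linarith
    · have := key 1 (by simp); linarith
  have := (convex_Icc (0:ℝ) 1).norm_image_sub_le_of_norm_hasDerivWithin_le
    (fun t _ => (hder t).hasDerivWithinAt) hb (x := 1) (y := 0) (by simp) (by simp)
  have e : ∫ x in E, (ψ x - ψ (x - v)) = G 0 - G 1 := by
    rw [hG]
    simp only [zero_smul, sub_zero, one_smul]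
    rw [integral_sub]
    · exact (h1.continuous.integrable_of_hasCompactSupport h2).integrableOn
    · have h8 := ((hsh 1).continuous.integrable_of_hasCompactSupport (μ := volume) (hcsh 1)).integrableOn (s := E)
      simpa [IntegrableOn] using h8
  rw [e]
  simp only [zero_sub, norm_neg, norm_one, mul_one] at this
  exact (le_abs_self _).trans this

theorem shift_measure {d : ℕ} {T E : Set (Vd d)} (hE : MeasurableSet E) (v : Vd d)
    (hT : Convex ℝ T) (hTo : IsOpen T) (hTb : Bornology.IsBounded T) :
    volume {x | x ∈ T ∩ E ∧ x + v ∈ T \ E} ≤ ENNReal.ofReal ‖v‖ * Per T E := by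
  by_cases hv : v = 0
  · have : {x | x ∈ T ∩ E ∧ x + v ∈ T \ E} = ∅ := by
      ext x; simp [hv]
    rw [this]; simp
  have hv0 : 0 < ‖v‖ := norm_pos_iff.2 hv
  by_cases hP : Per T E = ⊤
  · rw [hP, ENNReal.mul_top (by simpa using hv)]; exact le_top
  set A := {x | x ∈ T ∩ E ∧ x + v ∈ T \ E} with hA
  have hAm : MeasurableSet A := (hTo.measurableSet.inter hE).inter
    ((measurable_id.add_const v) (hTo.measurableSet.diff hE))
  have hAf : volume A ≠ ⊤ := ((measure_mono (fun x hx => hx.1.1 : A ⊆ T)).trans_lt hTb.measure_lt_top).ne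
  refine ENNReal.le_of_forall_pos_le_add fun ε hε _ => ?_
  have hKf : ∀ K : Set (Vd d), IsCompact K → volume K + ((ε / 2 : NNReal) : ℝ≥0∞) ≠ ⊤ := fun K hK =>
    ENNReal.add_ne_top.2 ⟨hK.measure_lt_top.ne, ENNReal.coe_ne_top⟩
  have hε2 : ((ε / 2 : NNReal) : ℝ≥0∞) ≠ 0 := by simpa using hε.ne'
  obtain ⟨K, hKA, hK, hK2⟩ := hAm.exists_isCompact_lt_add hAf hε2
  obtain ⟨O, hKO, hO, hO2⟩ := hK.exists_isOpen_lt_add (μ := volume) hε2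
  set D := T ∩ (fun x => x + v) ⁻¹' T
  have hD : IsOpen D := hTo.inter (hTo.preimage (by fun_prop))
  obtain ⟨ψ, g1, g2, g3, g4, O', hO', hKO', hg⟩ := exists_cutoff hK (hO.inter hD) (fun x hx =>
    ⟨hKO hx, (hKA hx).1.1, (hKA hx).2.1⟩)
  have main := shift_bound hE hv hT hP g1 g2 (fun x hx => (g3 hx).2.1) (fun x hx => (g3 hx).2.2) g4
  have hi : Integrable ψ := g1.continuous.integrable_of_hasCompactSupport g2
  have e1 : ∫ x in E, (ψ x - ψ (x - v)) = ∫ x, ψ x * (E.indicator (fun _ => (1:ℝ)) x -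
      E.indicator (fun _ => (1:ℝ)) (x + v)) := by
    rw [integral_sub hi.integrableOn (hi.comp_sub_right v).integrableOn]
    rw [← integral_indicator hE, ← integral_indicator hE]
    have : ∫ x, E.indicator (fun x => ψ (x - v)) x = ∫ x, E.indicator (fun x => ψ (x - v)) (x + v) :=
      (integral_add_right_eq_self _ v).symm
    rw [this, ← integral_sub]
    · congr 1; ext x
      by_cases h : x ∈ E <;> by_cases h' : x + v ∈ E <;> simp [h, h']
    · exact hi.indicator hE
    · exact ((hi.comp_sub_right v).indicator hE).comp_add_right v
  have hOf : volume O ≠ ⊤ := (hO2.trans (hKf K hK).lt_top).ne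
  have e2 : 2 * (volume K).toReal - (volume O).toReal ≤ ∫ x in E, (ψ x - ψ (x - v)) := by
    rw [e1]
    have : 2 * (volume K).toReal - (volume O).toReal =
        ∫ x, (2 * K.indicator (fun _ => (1:ℝ)) x - O.indicator (fun _ => (1:ℝ)) x) := by
      rw [integral_sub, integral_const_mul, integral_indicator hK.measurableSet,
        integral_indicator hO.measurableSet]
      · simp [Measure.real]
      · exact ((integrable_indicator_iff hK.measurableSet).2
          (integrableOn_const hK.measure_lt_top.ne)).const_mul 2
      · exact (integrable_indicator_iff hO.measurableSet).2 (integrableOn_const hOf)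
    rw [this]
    refine integral_mono ?_ ?_ ?_
    · exact (((integrable_indicator_iff hK.measurableSet).2
          (integrableOn_const hK.measure_lt_top.ne)).const_mul 2).sub
        ((integrable_indicator_iff hO.measurableSet).2 (integrableOn_const hOf))
    · have i1 := hi.indicator hE
      have i2 := hi.indicator (measurable_id.add_const v hE)
      refine (i1.sub i2).congr (Eventually.of_forall fun x => ?_)
      by_cases h : x ∈ E <;> by_cases h' : x + v ∈ E <;> simp [h, h', indicator]
    · intro x
      by_cases hxK : x ∈ K
      · have h5 := hKA hxK
        simp [hxK, hKO hxK, h5.1.2, h5.2.2, hg x (hKO' hxK)]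
        norm_num
      · by_cases hxO : x ∈ O
        · have := g4 x
          simp only [hxK, hxO, not_false_eq_true, indicator_of_notMem, indicator_of_mem, mul_zero, zero_sub]
          by_cases h : x ∈ E <;> by_cases h' : x + v ∈ E <;> simp [h, h'] <;> linarith [this.1, this.2]
        · have : ψ x = 0 := by
            by_contra h0
            exact hxO (g3 (subset_tsupport _ h0)).1
          simp [hxK, hxO, this]
  have e3 : (volume A).toReal ≤ ‖v‖ * (Per T E).toReal + ε := by
    have a1 : (volume A).toReal ≤ (volume K).toReal + ε / 2 := by
      have := ENNReal.toReal_mono (hKf K hK) hK2.le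
      rwa [ENNReal.toReal_add hK.measure_lt_top.ne ENNReal.coe_ne_top] at this
    have a2 : (volume O).toReal ≤ (volume K).toReal + ε / 2 := by
      have := ENNReal.toReal_mono (hKf K hK) hO2.le
      rwa [ENNReal.toReal_add hK.measure_lt_top.ne ENNReal.coe_ne_top] at this
    linarith
  rw [← ENNReal.ofReal_toReal hAf, ← ENNReal.ofReal_toReal hP, ← ENNReal.ofReal_mul hv0.le]
  refine (ENNReal.ofReal_le_ofReal e3).trans ?_
  rw [ENNReal.ofReal_add (by positivity) (by positivity)]
  simp

theorem poincare {d : ℕ} {E : Set (Vd d)} (hE : MeasurableSet E) (c : Vd d) (τ : ℝ) :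
    volume (E ∩ ball c τ) * volume (ball c τ \ E) ≤
      volume (ball (0 : Vd d) (2 * τ)) * (ENNReal.ofReal (2 * τ) * Per (ball c τ) E) := by
  set T := ball c τ
  have hT : MeasurableSet T := measurableSet_ball
  set X := T ∩ E
  set Y := T \ E
  have hX : MeasurableSet X := hT.inter hE
  have hY : MeasurableSet Y := hT.diff hE
  have e1 : ∀ v : Vd d, ∫⁻ x, X.indicator 1 x * Y.indicator 1 (x + v) = volume {x | x ∈ T ∩ E ∧ x + v ∈ T \ E} := by
    intro v
    rw [← lintegral_indicator_one (μ := volume) (s := {x | x ∈ T ∩ E ∧ x + v ∈ T \ E})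
      (hX.inter (measurable_id.add_const v hY))]
    congr 1; ext x
    by_cases h : x ∈ X <;> by_cases h' : x + v ∈ Y <;> simp [h, h', indicator]
    all_goals (intros; simp_all [X, Y])
  have hm : Measurable (fun p : Vd d × Vd d => X.indicator (1 : Vd d → ℝ≥0∞) p.2 * Y.indicator (1 : Vd d → ℝ≥0∞) (p.2 + p.1)) :=
    ((measurable_one.indicator hX).comp measurable_snd).mul
      ((measurable_one.indicator hY).comp (measurable_snd.add measurable_fst))
  have e2 : ∫⁻ v, ∫⁻ x, X.indicator (1 : Vd d → ℝ≥0∞) x * Y.indicator (1 : Vd d → ℝ≥0∞) (x + v) = volume X * volume Y := by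
    rw [lintegral_lintegral_swap hm.aemeasurable]
    have : ∀ x : Vd d, ∫⁻ v, X.indicator (1 : Vd d → ℝ≥0∞) x * Y.indicator (1 : Vd d → ℝ≥0∞) (x + v) = X.indicator 1 x * volume Y := by
      intro x
      have hmm : Measurable fun v => Y.indicator (1 : Vd d → ℝ≥0∞) (x + v) :=
        (measurable_one.indicator hY).comp (measurable_const_add x)
      rw [lintegral_const_mul _ hmm,
        lintegral_add_left_eq_self (fun y => Y.indicator (1 : Vd d → ℝ≥0∞) y) x, lintegral_indicator_one hY]
    simp only [this]
    rw [lintegral_mul_const _ (measurable_one.indicator hX), lintegral_indicator_one hX]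
  rw [inter_comm E T, ← e2]
  simp only [e1]
  calc ∫⁻ v, volume {x | x ∈ T ∩ E ∧ x + v ∈ T \ E}
      ≤ ∫⁻ v, (ball (0 : Vd d) (2 * τ)).indicator (fun _ => ENNReal.ofReal (2 * τ) * Per T E) v := by
        refine lintegral_mono fun v => ?_
        by_cases hv : v ∈ ball (0 : Vd d) (2 * τ)
        · rw [indicator_of_mem hv]
          refine (shift_measure hE v (convex_ball c τ) isOpen_ball isBounded_ball).trans ?_
          rw [mem_ball_zero_iff] at hv
          gcongr
        · rw [indicator_of_notMem hv]
          have : {x | x ∈ T ∩ E ∧ x + v ∈ T \ E} = ∅ := by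
            ext x
            simp only [mem_ofPred_eq, mem_empty_iff_false, iff_false]
            rintro ⟨h1, h2⟩
            apply hv
            rw [mem_ball_zero_iff]
            have h3 : dist x c < τ := h1.1
            have h4 : dist (x + v) c < τ := h2.1
            have : ‖v‖ = dist (x + v) x := by simp
            rw [this]
            linarith [dist_triangle_right (x + v) x c]
          rw [this]; simp
    _ = _ := by
        rw [lintegral_indicator measurableSet_ball, setLIntegral_const, mul_comm]

noncomputable def om (d : ℕ) : ℝ := volume.real (ball (0 : Vd d) 1)

theorem om_pos (d : ℕ) : 0 < om d :=
  ENNReal.toReal_pos (measure_ball_pos _ _ one_pos).ne' measure_ball_lt_top.ne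

theorem ofReal_om (d : ℕ) : ENNReal.ofReal (om d) = volume (ball (0 : Vd d) 1) :=
  ENNReal.ofReal_toReal measure_ball_lt_top.ne

theorem vol_ball {d : ℕ} (x : Vd d) {r : ℝ} (hr : 0 < r) :
    volume (ball x r) = ENNReal.ofReal (r ^ d * om d) := by
  rw [Measure.addHaar_ball_of_pos _ _ hr, finrank_euclideanSpace_fin,
    ENNReal.ofReal_mul (by positivity), ofReal_om]

theorem vol_closedBall {d : ℕ} (x : Vd d) {r : ℝ} (hr : 0 ≤ r) :
    volume (closedBall x r) = ENNReal.ofReal (r ^ d * om d) := by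
  rw [Measure.addHaar_closedBall _ _ hr, finrank_euclideanSpace_fin,
    ENNReal.ofReal_mul (by positivity), ofReal_om]

theorem rvol_ball {d : ℕ} (x : Vd d) {r : ℝ} (hr : 0 < r) :
    volume.real (ball x r) = r ^ d * om d := by
  rw [Measure.real, vol_ball x hr, ENNReal.toReal_ofReal]
  have := om_pos d; positivity

theorem ball_inter_ne_top {d : ℕ} (A : Set (Vd d)) (c : Vd d) (r : ℝ) : volume (A ∩ ball c r) ≠ ⊤ :=
  ((measure_mono inter_subset_right).trans_lt measure_ball_lt_top).ne

theorem rvol_mono_ball {d : ℕ} {A B : Set (Vd d)} {c : Vd d} {r : ℝ} (h : A ⊆ B ∩ ball c r) :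
    volume.real A ≤ volume.real (B ∩ ball c r) :=
  measureReal_mono h (ball_inter_ne_top _ _ _)

theorem rvol_compl_ball {d : ℕ} {A : Set (Vd d)} (hA : MeasurableSet A) (c : Vd d) {r : ℝ} (hr : 0 < r) :
    volume.real (Aᶜ ∩ ball c r) = r ^ d * om d - volume.real (A ∩ ball c r) := by
  rw [← rvol_ball c hr, inter_comm, inter_comm A, ← measureReal_inter_add_sdiff (s := ball c r) hA
    (measure_ball_lt_top.ne), sdiff_eq]
  ring

theorem cont_vol {d : ℕ} {A : Set (Vd d)} (hA : MeasurableSet A) (x z : Vd d) {r : ℝ} (hr : 0 < r)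
    {t : ℝ} (ht : 0 < t) :
    ContinuousAt (fun t : ℝ => volume.real (A ∩ ball (x + t • (z - x)) (t * r))) t := by
  have hfin : volume (A ∩ ball (x + t • (z - x)) (t * r)) ≠ ⊤ := ball_inter_ne_top _ _ _
  refine (ENNReal.tendsto_toReal hfin).comp ?_
  refine tendsto_measure_of_ae_tendsto_indicator (nhds t) (hA.inter measurableSet_ball)
    (fun i => hA.inter measurableSet_ball)
    (B := closedBall x ((|t| + 1) * (‖z - x‖ + r))) measurableSet_closedBall measure_closedBall_lt_top.ne ?_ ?_
  · filter_upwards [ball_mem_nhds t one_pos] with s hs y hy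
    have hs' : |s| ≤ |t| + 1 := by
      rw [mem_ball, Real.dist_eq] at hs
      have := abs_sub_abs_le_abs_sub s t
      linarith
    have h1 : dist y (x + s • (z - x)) < s * r := hy.2
    have h2 : dist (x + s • (z - x)) x = |s| * ‖z - x‖ := by
      rw [dist_eq_norm]; simp [norm_smul]
    rw [mem_closedBall]
    have h3 : s * r ≤ |s| * r := by gcongr; exact le_abs_self s
    calc dist y x ≤ dist y (x + s • (z - x)) + dist (x + s • (z - x)) x := dist_triangle _ _ _
      _ ≤ |s| * (‖z - x‖ + r) := by rw [h2]; linarith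
      _ ≤ _ := by gcongr
  · have hs : volume (sphere (x + t • (z - x)) (t * r)) = 0 :=
      Measure.addHaar_sphere_of_ne_zero _ _ (by positivity)
    have := measure_eq_zero_iff_ae_notMem.1 hs
    filter_upwards [this] with y hy
    have hc : Continuous fun s : ℝ => dist y (x + s • (z - x)) - s * r := by fun_prop
    rw [mem_sphere] at hy
    rcases lt_or_gt_of_ne hy with h | h
    · have h' : dist y (x + t • (z - x)) - t * r < 0 := by linarith
      filter_upwards [hc.continuousAt.eventually (gt_mem_nhds h')] with s hs
      simp only [mem_inter_iff, mem_ball]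
      have : dist y (x + s • (z - x)) < s * r := by linarith
      simp [this, h]
    · have h' : 0 < dist y (x + t • (z - x)) - t * r := by linarith
      filter_upwards [hc.continuousAt.eventually (lt_mem_nhds h')] with s hs
      simp only [mem_inter_iff, mem_ball]
      have h1 : ¬ dist y (x + s • (z - x)) < s * r := by linarith
      have h2 : ¬ dist y (x + t • (z - x)) < t * r := by linarith
      simp [h1, h2]

theorem path {d : ℕ} {A : Set (Vd d)} (hA : MeasurableSet A) :
    ∀ᵐ x : Vd d, x ∈ A → ∀ (z : Vd d) (r α : ℝ), 0 < r → dist x z ≤ 4 * r → α < 1 →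
      volume.real (A ∩ ball z r) ≤ α * (r ^ d * om d) →
      ∃ t ∈ Ioc (0:ℝ) 1, volume.real (A ∩ ball (x + t • (z - x)) (t * r)) = α * ((t * r) ^ d * om d) := by
  have h0 := IsUnifLocDoublingMeasure.ae_tendsto_measure_inter_div (volume : Measure (Vd d)) A 4
  rw [ae_restrict_iff' hA] at h0
  filter_upwards [h0] with x hx hxA z r α hr hxz hα hle
  have hom := om_pos d
  set f : ℝ → ℝ := fun t => volume.real (A ∩ ball (x + t • (z - x)) (t * r)) - α * ((t * r) ^ d * om d) with hf
  have hfc : ∀ t, 0 < t → ContinuousAt f t := fun t ht =>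
    (cont_vol hA x z hr ht).sub (by fun_prop)
  have hlim := hx hxA (l := nhdsWithin 0 (Ioi 0)) (fun t : ℝ => x + t • (z - x)) (fun t : ℝ => t * r) ?_ ?_
  rotate_left
  · rw [tendsto_nhdsWithin_iff]
    constructor
    · have : Tendsto (fun t : ℝ => t * r) (nhds 0) (nhds (0 * r)) := (continuous_mul_const r).tendsto 0
      rw [zero_mul] at this
      exact this.mono_left nhdsWithin_le_nhds
    · filter_upwards [self_mem_nhdsWithin] with t ht
      exact mul_pos ht hr
  · filter_upwards [self_mem_nhdsWithin] with t ht
    have ht' : 0 < t := ht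
    rw [mem_closedBall, dist_comm, dist_eq_norm, add_sub_cancel_left, norm_smul, Real.norm_eq_abs,
      abs_of_pos ht', ← dist_eq_norm, dist_comm]
    nlinarith
  obtain ⟨t, ht, ht1, htf⟩ : ∃ t, 0 < t ∧ t < 1 ∧ 0 < f t := by
    have hα' : ENNReal.ofReal α < 1 := by
      rw [← ENNReal.ofReal_one]; exact (ENNReal.ofReal_lt_ofReal_iff one_pos).2 hα
    have e1 := hlim.eventually (lt_mem_nhds hα')
    have e2 : ∀ᶠ t : ℝ in nhdsWithin 0 (Ioi 0), t < 1 := nhdsWithin_le_nhds (gt_mem_nhds one_pos)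
    obtain ⟨t, ⟨h1, h2⟩, h3⟩ := ((e1.and e2).and self_mem_nhdsWithin).exists
    have ht : 0 < t := h3
    refine ⟨t, ht, h2, ?_⟩
    have htr : 0 < t * r := mul_pos ht hr
    have hpos : 0 < (t * r) ^ d * om d := by positivity
    have hb : volume (A ∩ closedBall (x + t • (z - x)) (t * r)) = volume (A ∩ ball (x + t • (z - x)) (t * r)) := by
      refine le_antisymm ?_ (measure_mono (inter_subset_inter_right _ ball_subset_closedBall))
      rw [← ball_union_sphere, inter_union_distrib_left]
      refine (measure_union_le _ _).trans ?_
      have : volume (A ∩ sphere (x + t • (z - x)) (t * r)) = 0 :=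
        measure_mono_null inter_subset_right (Measure.addHaar_sphere_of_ne_zero _ _ htr.ne')
      rw [this, add_zero]
    rw [hb, vol_closedBall _ htr.le, ENNReal.lt_div_iff_mul_lt (by left; simpa using hpos) (by left; simp)] at h1
    simp only [hf, sub_pos]
    by_cases hα0 : α < 0
    · exact lt_of_lt_of_le (mul_neg_of_neg_of_pos hα0 hpos) measureReal_nonneg
    push Not at hα0
    rw [← ENNReal.ofReal_mul hα0] at h1
    exact (ENNReal.ofReal_lt_iff_lt_toReal (by positivity) (ball_inter_ne_top _ _ _)).1 h1
  have hf1 : f 1 ≤ 0 := by simp only [hf, one_smul, one_mul, add_sub_cancel]; linarith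
  have := intermediate_value_Icc' ht1.le (f := f) (fun s hs => (hfc s (ht.trans_le hs.1)).continuousWithinAt)
    ⟨hf1, htf.le⟩
  obtain ⟨s, hs, hs0⟩ := this
  exact ⟨s, ⟨ht.trans_le hs.1, hs.2⟩, by simp only [hf] at hs0; linarith⟩

theorem vitali {d : ℕ} (F : Set (Vd d × ℝ)) (hpos : ∀ p ∈ F, 0 < p.2) (R : ℝ) (hR : ∀ p ∈ F, p.2 ≤ R) :
    ∃ u ⊆ F, u.Countable ∧ u.PairwiseDisjoint (fun p => ball p.1 p.2) ∧
      ∀ p ∈ F, ∃ q ∈ u, dist p.1 q.1 < p.2 + q.2 ∧ p.2 ≤ 2 * q.2 := by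
  obtain ⟨u, hu, hd, hc⟩ := Vitali.exists_disjoint_subfamily_covering_enlargement
    (fun p : Vd d × ℝ => ball p.1 p.2) F (fun p => p.2) 2 one_lt_two (fun p hp => (hpos p hp).le) R hR
    (fun p hp => nonempty_ball.2 (hpos p hp))
  refine ⟨u, hu, hd.countable_of_isOpen (fun _ _ => isOpen_ball)
    (fun p hp => nonempty_ball.2 (hpos p (hu hp))), hd, fun p hp => ?_⟩
  obtain ⟨q, hq, ⟨y, hy1, hy2⟩, h⟩ := hc p hp
  refine ⟨q, hq, ?_, h⟩
  rw [mem_ball] at hy1 hy2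
  linarith [dist_triangle_left p.1 q.1 y]

/-- Poincaré with density `α` -/
theorem poin_dens {d : ℕ} (hd : 1 ≤ d) {A : Set (Vd d)} (hA : MeasurableSet A) (c : Vd d) {τ α : ℝ}
    (hτ : 0 < τ) (hα : volume.real (A ∩ ball c τ) = α * (τ ^ d * om d)) (h0 : 0 ≤ α) (h1 : α ≤ 1) :
    ENNReal.ofReal (α * (1 - α) * om d * τ ^ (d - 1)) ≤ 2 ^ (d + 1) * Per (ball c τ) A := by
  have hom := om_pos d
  have h := poincare hA c τ
  have e1 : volume (A ∩ ball c τ) = ENNReal.ofReal (α * (τ ^ d * om d)) := by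
    rw [← hα, ofReal_measureReal (ball_inter_ne_top _ _ _)]
  have e2 : volume (ball c τ \ A) = ENNReal.ofReal ((1 - α) * (τ ^ d * om d)) := by
    rw [sdiff_eq, inter_comm, ← ofReal_measureReal (ball_inter_ne_top _ _ _), rvol_compl_ball hA c hτ, hα]
    congr 1; ring
  rw [e1, e2, vol_ball _ (by positivity), ← ENNReal.ofReal_mul (by positivity), ← mul_assoc (ENNReal.ofReal ((2 * τ) ^ d * om d)),
    ← ENNReal.ofReal_mul (by positivity)] at h
  have hd' : τ ^ d = τ ^ (d - 1) * τ := by rw [← pow_succ]; congr 1; omega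
  have hpos : 0 < τ ^ d * om d * τ := by positivity
  have e3 : α * (τ ^ d * om d) * ((1 - α) * (τ ^ d * om d)) =
      (τ ^ d * om d * τ) * (α * (1 - α) * om d * τ ^ (d - 1)) := by rw [hd']; ring
  have e4 : (2 * τ) ^ d * om d * (2 * τ) = (τ ^ d * om d * τ) * 2 ^ (d + 1) := by ring
  rw [e3, e4, ENNReal.ofReal_mul hpos.le, ENNReal.ofReal_mul hpos.le, mul_assoc (ENNReal.ofReal _)] at h
  rw [ENNReal.mul_le_mul_iff_right (by simpa using hpos) (by simp)] at h
  rwa [ENNReal.ofReal_pow (by norm_num), ENNReal.ofReal_ofNat] at h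

/-- covering lemma -/
theorem cover_a {d : ℕ} (hd : 1 ≤ d) {A D W : Set (Vd d)} (hA : MeasurableSet A) {τm : ℝ} 
    (h : ∀ᵐ e : Vd d, e ∈ A ∩ D → ∃ (c : Vd d) (τ : ℝ), 0 < τ ∧ τ ≤ τm ∧ ball c τ ⊆ W ∧
      dist e c ≤ 4 * τ ∧ volume.real (A ∩ ball c τ) = (1/2) * (τ ^ d * om d)) :
    volume (A ∩ D) ≤ 11 ^ d * 2 ^ (d + 3) * ENNReal.ofReal τm * Per W A := by
  have hom := om_pos d
  set F : Set (Vd d × ℝ) := {p | 0 < p.2 ∧ p.2 ≤ τm ∧ ball p.1 p.2 ⊆ W ∧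
    volume.real (A ∩ ball p.1 p.2) = (1/2) * (p.2 ^ d * om d)} with hF
  obtain ⟨u, huF, huc, hud, hcov⟩ := vitali F (fun p hp => hp.1) τm (fun p hp => hp.2.1)
  have hcount : Countable u := huc.to_subtype
  have h1 : volume (A ∩ D) ≤ volume (⋃ q : u, closedBall q.1.1 (11 * q.1.2)) := by
    refine measure_mono_ae ?_
    filter_upwards [h] with e he heD
    obtain ⟨c, τ, h1, h2, h3, h4, h5⟩ := he heD
    obtain ⟨q, hq, hq1, hq2⟩ := hcov (c, τ) ⟨h1, h2, h3, h5⟩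
    refine mem_iUnion.2 ⟨⟨q, hq⟩, ?_⟩
    rw [mem_closedBall]
    simp only at hq1 hq2 ⊢
    linarith [dist_triangle e c q.1]
  have hpt : ∀ q : u, volume (closedBall q.1.1 (11 * q.1.2)) ≤
      11 ^ d * 2 ^ (d + 3) * ENNReal.ofReal τm * Per (ball q.1.1 q.1.2) A := by
    rintro ⟨⟨c, τ⟩, hq⟩
    obtain ⟨q1, q2, q3, q4⟩ := huF hq
    simp only at q1 q2 q3 q4 ⊢
    have hτm : 0 < τm := q1.trans_le q2
    rw [vol_closedBall _ (by positivity)]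
    have hp := poin_dens hd hA c q1 q4 (by norm_num) (by norm_num)
    have hd' : τ ^ d = τ ^ (d - 1) * τ := by rw [← pow_succ]; congr 1; omega
    calc ENNReal.ofReal ((11 * τ) ^ d * om d)
        ≤ ENNReal.ofReal ((11 ^ d * 4 * τm) * ((1/2) * (1 - 1/2) * om d * τ ^ (d - 1))) := by
          apply ENNReal.ofReal_le_ofReal
          rw [mul_pow, hd']
          have : 11 ^ d * (τ ^ (d - 1) * τ) * om d ≤ 11 ^ d * (τ ^ (d - 1) * τm) * om d := by gcongr
          linarith
      _ = ENNReal.ofReal (11 ^ d * 4 * τm) * ENNReal.ofReal ((1/2) * (1 - 1/2) * om d * τ ^ (d - 1)) := by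
          rw [ENNReal.ofReal_mul (by positivity)]
      _ ≤ ENNReal.ofReal (11 ^ d * 4 * τm) * (2 ^ (d + 1) * Per (ball c τ) A) := by gcongr
      _ = _ := by
          rw [ENNReal.ofReal_mul (by positivity), ENNReal.ofReal_mul (by positivity),
            ENNReal.ofReal_pow (by norm_num)]
          simp only [ENNReal.ofReal_ofNat]
          rw [show (4 : ℝ≥0∞) = 2 ^ 2 by norm_num]
          ring
  calc volume (A ∩ D) ≤ _ := h1
    _ ≤ ∑' q : u, volume (closedBall q.1.1 (11 * q.1.2)) := measure_iUnion_le _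
    _ ≤ ∑' q : u, 11 ^ d * 2 ^ (d + 3) * ENNReal.ofReal τm * Per (ball q.1.1 q.1.2) A :=
        ENNReal.tsum_le_tsum hpt
    _ = 11 ^ d * 2 ^ (d + 3) * ENNReal.ofReal τm * ∑' q : u, Per (ball q.1.1 q.1.2) A := ENNReal.tsum_mul_left
    _ ≤ _ := by
        gcongr
        refine Per_tsum_superadd hA (T := fun q : u => ball q.1.1 q.1.2) ?_ (fun q => (huF q.2).2.2.1)
        intro p q hpq
        exact hud p.2 q.2 (fun h => hpq (Subtype.ext h))

theorem ball_sub_ball_path {d : ℕ} {x z : Vd d} {t r : ℝ} (ht : t ∈ Ioc (0:ℝ) 1) (hx : dist x z ≤ r) :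
    ball (x + t • (z - x)) (t * r) ⊆ ball z r := by
  apply ball_subset_ball'
  have : dist (x + t • (z - x)) z = (1 - t) * dist x z := by
    rw [dist_eq_norm, dist_eq_norm, show x + t • (z - x) - z = (1 - t) • (x - z) by module, norm_smul,
      Real.norm_eq_abs, abs_of_nonneg (by linarith [ht.2])]
  rw [this]
  nlinarith [ht.1, ht.2, mul_le_mul_of_nonneg_left hx (by linarith [ht.2] : 0 ≤ 1 - t)]

theorem dist_path {d : ℕ} {x z : Vd d} {t : ℝ} (ht : 0 ≤ t) :
    dist x (x + t • (z - x)) = t * dist x z := by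
  rw [dist_eq_norm, dist_comm, dist_eq_norm, show x - (x + t • (z - x)) = -(t • (z - x)) by module, norm_neg,
    norm_smul, Real.norm_eq_abs, abs_of_nonneg ht]

/-- relative isoperimetric inequality -/
theorem RI {d : ℕ} (hd : 1 ≤ d) {A : Set (Vd d)} (hA : MeasurableSet A) (c : Vd d) {τ ε : ℝ}
    (hτ : 0 < τ) (hε : volume.real (A ∩ ball c τ) = ε * (τ ^ d * om d)) (h0 : 0 < ε) (h1 : ε ≤ 1/2) :
    ENNReal.ofReal (om d * (ε ^ (1 - 1 / (d:ℝ)) * τ ^ (d - 1))) ≤ 11 ^ d * 2 ^ (d + 4) * Per (ball c τ) A := by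
  have hom := om_pos d
  have hdpos : (0:ℝ) < d := by exact_mod_cast hd
  set τm : ℝ := (2 * ε) ^ (1 / (d:ℝ)) * τ with hτm
  have hτm0 : 0 < τm := by positivity
  have key := cover_a hd (A := A) (D := ball c τ) (W := ball c τ) hA (τm := τm) (by
    filter_upwards [path hA] with e he heA
    have hed : dist e c < τ := heA.2
    obtain ⟨t, ht, hte⟩ := he heA.1 c τ (1/2) hτ (by linarith) (by norm_num) (by rw [hε]; gcongr)
    have ht0 := ht.1
    have hsub := ball_sub_ball_path ht hed.le
    refine ⟨_, t * τ, by positivity, ?_, hsub, ?_, hte⟩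
    · have := rvol_mono_ball (A := A ∩ ball (e + t • (c - e)) (t * τ)) (B := A) (inter_subset_inter_right A hsub)
      rw [hte, hε] at this
      rw [hτm]
      gcongr
      have h2 : t ^ d ≤ 2 * ε := by
        have : t ^ d * (τ ^ d * om d) ≤ (2 * ε) * (τ ^ d * om d) := by
          rw [mul_pow] at this; linarith
        exact le_of_mul_le_mul_right this (by positivity)
      calc t = (t ^ d) ^ (1 / (d:ℝ)) := by
            rw [← Real.rpow_natCast, ← Real.rpow_mul ht0.le, mul_one_div_cancel hdpos.ne', Real.rpow_one]
        _ ≤ _ := by gcongr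
    · rw [dist_path ht0.le]
      nlinarith)
  rw [← ofReal_measureReal (ball_inter_ne_top _ _ _), hε] at key
  have hd' : τ ^ d = τ ^ (d - 1) * τ := by rw [← pow_succ]; congr 1; omega
  have e1 : ε * (τ ^ d * om d) = (ε ^ (1 / (d:ℝ)) * τ) * (om d * (ε ^ (1 - 1 / (d:ℝ)) * τ ^ (d - 1))) := by
    have : ε = ε ^ (1 / (d:ℝ)) * ε ^ (1 - 1 / (d:ℝ)) := by
      rw [← Real.rpow_add h0]; simp
    calc _ = (ε ^ (1 / (d:ℝ)) * ε ^ (1 - 1 / (d:ℝ))) * (τ ^ d * om d) := by rw [← this]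
      _ = _ := by rw [hd']; ring
  have e2 : τm ≤ 2 * (ε ^ (1 / (d:ℝ)) * τ) := by
    rw [hτm, Real.mul_rpow (by norm_num) h0.le, mul_assoc]
    gcongr
    calc (2:ℝ) ^ (1 / (d:ℝ)) ≤ 2 ^ (1:ℝ) := by
          apply Real.rpow_le_rpow_of_exponent_le (by norm_num)
          rw [div_le_one hdpos]; exact_mod_cast hd
      _ = 2 := Real.rpow_one 2
  have hpos : 0 < ε ^ (1 / (d:ℝ)) * τ := by positivity
  rw [e1, ENNReal.ofReal_mul hpos.le] at key
  have k2 : ENNReal.ofReal (ε ^ (1 / (d:ℝ)) * τ) * ENNReal.ofReal (om d * (ε ^ (1 - 1 / (d:ℝ)) * τ ^ (d - 1))) ≤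
      ENNReal.ofReal (ε ^ (1 / (d:ℝ)) * τ) * (11 ^ d * 2 ^ (d + 4) * Per (ball c τ) A) := by
    refine key.trans ?_
    calc _ ≤ 11 ^ d * 2 ^ (d + 3) * ENNReal.ofReal (2 * (ε ^ (1 / (d:ℝ)) * τ)) * Per (ball c τ) A := by gcongr
      _ = _ := by rw [ENNReal.ofReal_mul (by norm_num), ENNReal.ofReal_ofNat]; ring
  exact (ENNReal.mul_le_mul_iff_right (by simpa using hpos) (by simp)).1 k2

theorem lip_cutoff {d : ℕ} (U : Set (Vd d)) {h : ℝ} (hh : 0 < h) :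
    ∃ η : Vd d → ℝ, ContDiff ℝ 1 η ∧ (∀ x, η x ∈ Icc (0:ℝ) 1) ∧ (∀ x ∈ U, η x = 1) ∧
      (∀ x, x ∉ thickening h U → η x = 0) ∧ ∀ x, ‖fderiv ℝ η x‖ ≤ 3 / h := by
  rcases U.eq_empty_or_nonempty with rfl | hne
  · refine ⟨fun _ => 0, contDiff_const, by simp, by simp, by simp, ?_⟩
    intro x; simp; positivity
  set S := thickening (h / 3) U with hS
  have hSne : S.Nonempty := hne.mono (self_subset_thickening (by positivity) U)
  set f : Vd d → ℝ := fun x => max 0 (1 - (3 / h) * infDist x S) with hf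
  have hf01 : ∀ x, f x ∈ Icc (0:ℝ) 1 := fun x => by
    refine ⟨le_max_left _ _, max_le zero_le_one ?_⟩
    have : 0 ≤ (3 / h) * infDist x S := mul_nonneg (by positivity) infDist_nonneg
    linarith
  have hflip : ∀ x y, |f x - f y| ≤ 3 / h * dist x y := by
    intro x y
    have h1 : |infDist x S - infDist y S| ≤ dist x y := by
      have := (lipschitz_infDist_pt S).dist_le_mul x y
      rwa [NNReal.coe_one, one_mul, Real.dist_eq] at this
    calc |f x - f y| ≤ |(1 - (3 / h) * infDist x S) - (1 - (3 / h) * infDist y S)| := by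
          simp only [hf]
          have := abs_max_sub_max_le_abs (1 - (3 / h) * infDist x S) (1 - (3 / h) * infDist y S) 0
          rwa [max_comm _ 0, max_comm _ 0] at this
      _ = 3 / h * |infDist x S - infDist y S| := by
          rw [← abs_of_pos (show (0:ℝ) < 3 / h by positivity), ← abs_mul, abs_of_pos (show (0:ℝ) < 3 / h by positivity),
            ← abs_neg]
          congr 1; ring
      _ ≤ _ := by gcongr
  have hfc : Continuous f := by
    have : Continuous fun x => infDist x S := continuous_infDist_pt S
    simp only [hf]; fun_prop
  have hf1 : ∀ x ∈ S, f x = 1 := by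
    intro x hx
    simp [hf, infDist_zero_of_mem hx]
  let ρ : ContDiffBump (0 : Vd d) := ⟨h / 6, h / 3, by positivity, by linarith⟩
  set η : Vd d → ℝ := convolution (ρ.normed volume) f (ContinuousLinearMap.lsmul ℝ ℝ) volume with hη
  have hηd : ∀ x, η x = ∫ t, ρ.normed volume t * f (x - t) := by
    intro x; simp [hη, convolution_def]
  have hint : ∀ x, Integrable (fun t => ρ.normed volume t * f (x - t)) := by
    intro x
    apply Continuous.integrable_of_hasCompactSupport
    · exact ρ.continuous_normed.mul (by fun_prop)
    · exact (ρ.hasCompactSupport_normed (μ := volume)).mono (fun t ht h0 => ht (by simp [h0]))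
  have hρi : ∫ t, ρ.normed volume t = 1 := ρ.integral_normed
  have hρint : Integrable (ρ.normed (volume : Measure (Vd d))) := ρ.integrable_normed
  have hηcd : ContDiff ℝ 1 η := by
    apply HasCompactSupport.contDiff_convolution_left
    · exact ρ.hasCompactSupport_normed
    · exact ρ.contDiff_normed
    · exact hfc.locallyIntegrable
  have hdist : ∀ x y, |η x - η y| ≤ 3 / h * dist x y := by
    intro x y
    rw [hηd, hηd, ← integral_sub (hint x) (hint y), ← Real.norm_eq_abs]
    calc ‖∫ t, (ρ.normed volume t * f (x - t) - ρ.normed volume t * f (y - t))‖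
        ≤ ∫ t, (3 / h * dist x y) * ρ.normed volume t := by
          apply norm_integral_le_of_norm_le (hρint.const_mul _)
          refine Eventually.of_forall fun t => ?_
          rw [← mul_sub, norm_mul, Real.norm_eq_abs, Real.norm_eq_abs, abs_of_nonneg (ρ.nonneg_normed t), mul_comm]
          have := hflip (x - t) (y - t)
          rw [dist_sub_right] at this
          exact mul_le_mul_of_nonneg_right this (ρ.nonneg_normed t)
      _ = _ := by rw [integral_const_mul, hρi, mul_one]
  refine ⟨η, hηcd, ?_, ?_, ?_, ?_⟩
  · intro x
    rw [hηd]
    constructor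
    · exact integral_nonneg fun t => mul_nonneg (ρ.nonneg_normed t) (hf01 _).1
    · rw [← hρi]
      exact integral_mono (hint x) hρint fun t =>
        mul_le_of_le_one_right (ρ.nonneg_normed t) (hf01 _).2
  · intro x hx
    have hx' : x ∈ S := self_subset_thickening (by positivity) U hx
    rw [← hf1 x hx']
    apply ρ.normed_convolution_eq_right
    intro y hy
    rw [hf1 x hx', hf1 y]
    exact mem_thickening_iff.2 ⟨x, hx, hy⟩
  · intro x hx
    have h0 : ∀ y, dist y x < h / 3 → f y = 0 := by
      intro y hy
      simp only [hf]
      apply max_eq_left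
      have : h / 3 ≤ infDist y S := by
        rw [le_infDist hSne]
        intro z hz
        obtain ⟨u, hu, hzu⟩ := mem_thickening_iff.1 hz
        by_contra hc
        push Not at hc
        apply hx
        refine mem_thickening_iff.2 ⟨u, hu, ?_⟩
        linarith [dist_triangle4 x y z u, dist_comm x y]
      have h1 : 3 / h * (h / 3) ≤ 3 / h * infDist y S := by gcongr
      have h2 : 3 / h * (h / 3) = 1 := by field_simp
      linarith
    have hx0 : f x = 0 := h0 x (by simp; positivity)
    rw [← hx0]
    apply ρ.normed_convolution_eq_right
    intro y hy
    rw [hx0, h0 y hy]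
  · intro x
    have hl : LipschitzWith (Real.toNNReal (3 / h)) η := by
      refine LipschitzWith.of_dist_le_mul fun x y => ?_
      rw [Real.coe_toNNReal _ (by positivity), Real.dist_eq]
      exact hdist x y
    have := norm_fderiv_le_of_lipschitz ℝ (x₀ := x) hl
    rwa [Real.coe_toNNReal _ (by positivity)] at this

theorem LU {d : ℕ} {E U O Ω : Set (Vd d)} (hE : MeasurableSet E) (hU : IsOpen U) {h : ℝ} (hh : 0 < h)
    {φ : Vd d → Vd d} (hφ : IsTest Ω φ) (hO : tsupport φ \ U ⊆ O) :
    ∃ w : Vd d → ℝ, Measurable w ∧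
      (∀ x, |w x - (E ∪ U).indicator (fun _ => (1:ℝ)) x| ≤
        (Eᶜ ∩ (thickening h U \ U)).indicator (fun _ => (1:ℝ)) x) ∧
      ENNReal.ofReal (∫ x, w x * divg φ x) ≤ Per O E +
        ENNReal.ofReal (3 / h) * volume (tsupport φ ∩ (Eᶜ ∩ (thickening h U \ U))) := by
  obtain ⟨η, h1, h2, h3, h4, h5⟩ := lip_cutoff U hh
  set Z := Eᶜ ∩ (thickening h U \ U) with hZ
  have hZm : MeasurableSet Z := hE.compl.inter (isOpen_thickening.measurableSet.diff hU.measurableSet)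
  set w : Vd d → ℝ := fun x => E.indicator (fun _ => (1:ℝ)) x + Eᶜ.indicator η x with hw
  refine ⟨w, (measurable_const.indicator hE).add (h1.continuous.measurable.indicator hE.compl), ?_, ?_⟩
  · intro x
    by_cases hxE : x ∈ E
    · simp [hw, hxE, hZ]
    by_cases hxU : x ∈ U
    · simp [hw, hxE, hxU, h3 x hxU, hZ]
    by_cases hxh : x ∈ thickening h U
    · simp only [hw, hxE, hxU, hxh, hZ]
      simp [hxE, hxU, hxh, abs_le]
      constructor <;> linarith [(h2 x).1, (h2 x).2]
    · simp [hw, hxE, hxU, hxh, hZ, h4 x hxh]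
  · have t1 : IsTest O (fun y => (1 - η y) • φ y) := by
      refine ⟨ContDiff.smul (contDiff_const.sub h1) hφ.cd,
        HasCompactSupport.mono hφ.cs (fun x hx h => hx (by simp [h])), ?_, fun x => ?_⟩
      · have : tsupport (fun y => (1 - η y) • φ y) ⊆ tsupport φ \ U := by
          refine closure_minimal ?_ ((isClosed_tsupport _).sdiff hU)
          intro x hx
          refine ⟨subset_tsupport _ (fun h => hx (by simp [h])), fun h => hx (by simp [h3 x h])⟩
        exact this.trans hO
      · have h1 : 0 ≤ 1 - η x := by linarith [(h2 x).2]
        rw [norm_smul, Real.norm_eq_abs, abs_of_nonneg h1]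
        exact mul_le_one₀ (by linarith [(h2 x).1]) (norm_nonneg _) (hφ.le x)
    have c2 : ContDiff ℝ 1 (fun y => η y • φ y) := ContDiff.smul h1 hφ.cd
    have s2 : HasCompactSupport (fun y => η y • φ y) :=
      HasCompactSupport.mono hφ.cs (fun x hx h => hx (by simp [h]))
    set g : Vd d → ℝ := fun x => fderiv ℝ η x (φ x) with hg
    have hgc : Continuous g := (h1.continuous_fderiv one_ne_zero).clm_apply hφ.cd.continuous
    have hgs : HasCompactSupport g := hφ.cs.mono (fun x hx h => hx (by simp [hg, h]))
    have hgi : Integrable g := hgc.integrable_of_hasCompactSupport hgs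
    have d1 : ∀ x, divg (fun y => (1 - η y) • φ y) x = (1 - η x) * divg φ x - g x := by
      intro x
      rw [divg_smul hφ.cd (contDiff_const.sub h1)]
      simp only [hg]
      rw [fderiv_const_sub]
      simp [sub_eq_add_neg]
    have d2 : ∀ x, divg (fun y => η y • φ y) x = η x * divg φ x + g x := by
      intro x
      rw [divg_smul hφ.cd h1]
    have i1 := divg_integrable t1.cd t1.cs
    have i2 := divg_integrable c2 s2
    have e1 : ∀ x, w x * divg φ x = E.indicator (divg (fun y => (1 - η y) • φ y)) x
        + divg (fun y => η y • φ y) x - Eᶜ.indicator g x := by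
      intro x
      by_cases hxE : x ∈ E
      · simp [hw, hxE, d1, d2]; ring
      · simp [hw, hxE, d2]
    have e2 : ∫ x, w x * divg φ x = (∫ x in E, divg (fun y => (1 - η y) • φ y) x) - ∫ x in Eᶜ, g x := by
      simp only [e1]
      have i3 : Integrable (fun x => E.indicator (divg (fun y => (1 - η y) • φ y)) x
        + divg (fun y => η y • φ y) x) := (i1.indicator hE).add i2
      rw [integral_sub i3 (hgi.indicator hE.compl),
        integral_add (i1.indicator hE) i2, integral_indicator hE, integral_indicator hE.compl,
        integral_divg c2 s2, add_zero]
    have hg0 : ∀ x, x ∉ thickening h U \ U → g x = 0 := by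
      intro x hx
      have : fderiv ℝ η x = 0 := by
        by_cases hxU : x ∈ U
        · have : η =ᶠ[nhds x] fun _ => 1 := by
            filter_upwards [hU.mem_nhds hxU] with y hy using h3 y hy
          rw [this.fderiv_eq]; simp
        · have hx' : η x = 0 := h4 x (fun hc => hx ⟨hc, hxU⟩)
          apply IsLocalMin.fderiv_eq_zero
          exact Eventually.of_forall fun y => by rw [hx']; exact (h2 y).1
      simp [hg, this]
    have hb : ∀ x, ‖Eᶜ.indicator g x‖ ≤ (tsupport φ ∩ Z).indicator (fun _ => 3 / h) x := by
      intro x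
      by_cases hx : x ∈ tsupport φ ∩ Z
      · rw [indicator_of_mem hx, indicator_of_mem (show x ∈ Eᶜ from hx.2.1)]
        calc ‖g x‖ ≤ ‖fderiv ℝ η x‖ * ‖φ x‖ := ContinuousLinearMap.le_opNorm _ _
          _ ≤ (3 / h) * 1 := mul_le_mul (h5 x) (hφ.le x) (norm_nonneg _) (by positivity)
          _ = _ := mul_one _
      · rw [indicator_of_notMem hx]
        have : Eᶜ.indicator g x = 0 := by
          by_cases hxE : x ∈ Eᶜ
          · rw [indicator_of_mem hxE]
            by_cases hxt : x ∈ tsupport φ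
            · exact hg0 x fun hc => hx ⟨hxt, hxE, hc⟩
            · simp [hg, image_eq_zero_of_notMem_tsupport hxt]
          · rw [indicator_of_notMem hxE]
        rw [this]; simp
    have hfin : volume (tsupport φ ∩ Z) ≠ ⊤ :=
      ((measure_mono inter_subset_left).trans_lt hφ.cs.isCompact.measure_lt_top).ne
    have hmm : MeasurableSet (tsupport φ ∩ Z) := (isClosed_tsupport _).measurableSet.inter hZm
    have e3 : -∫ x in Eᶜ, g x ≤ (3 / h) * volume.real (tsupport φ ∩ Z) := by
      rw [← integral_indicator hE.compl]
      refine (neg_le_abs _).trans ?_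
      rw [← Real.norm_eq_abs]
      have := norm_integral_le_of_norm_le ((integrable_indicator_iff hmm).2 (integrableOn_const hfin))
        (Eventually.of_forall hb)
      rw [integral_indicator hmm] at this
      simpa [mul_comm] using this
    rw [e2, sub_eq_add_neg]
    refine ENNReal.ofReal_add_le.trans (add_le_add (le_Per hE t1) ?_)
    refine (ENNReal.ofReal_le_ofReal e3).trans ?_
    rw [ENNReal.ofReal_mul (by positivity), ofReal_measureReal hfin]

theorem exists_coord {d : ℕ} (v : Vd d) (hv : v ≠ 0) : ∃ i : Fin d, ∃ σ : ℝ, (σ = 1 ∨ σ = -1) ∧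
    ‖v‖ / (2 * d) < σ * v i := by
  have hv0 : 0 < ‖v‖ := norm_pos_iff.2 hv
  by_contra hc
  push Not at hc
  have h1 : ∀ i, |v i| ≤ ‖v‖ / (2 * d) := by
    intro i
    have a := hc i 1 (Or.inl rfl)
    have b := hc i (-1) (Or.inr rfl)
    exact abs_le.2 ⟨by linarith, by linarith⟩
  have h2 : ‖v‖ ≤ ∑ i, |v i| := by
    have : v = ∑ i, v i • EuclideanSpace.single i (1:ℝ) := by
      ext j
      simp [Finset.sum_apply, Pi.single_apply]
    conv_lhs => rw [this]
    refine (norm_sum_le _ _).trans ?_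
    gcongr with i
    simp [norm_smul]
  have h3 : ∑ i, |v i| ≤ ∑ _i : Fin d, ‖v‖ / (2 * d) := Finset.sum_le_sum fun i _ => h1 i
  rw [Finset.sum_const, Finset.card_univ, Fintype.card_fin, nsmul_eq_mul] at h3
  by_cases hd : d = 0
  · subst hd
    simp at h3 h2
    exact hv h2
  · have : (d:ℝ) * (‖v‖ / (2 * d)) = ‖v‖ / 2 := by
      have : (d:ℝ) ≠ 0 := by exact_mod_cast hd
      field_simp
    linarith

theorem move_in {d : ℕ} (hd : 1 ≤ d) {x z : Vd d} {r h ρ σ : ℝ} {i : Fin d} (hr : 0 < r)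
    (hxr : r ≤ dist x z) (hxh : dist x z < r + h) (hσ : σ = 1 ∨ σ = -1)
    (hi : ‖z - x‖ / (2 * d) < σ * (z - x) i) (h1 : 4 * d * h ≤ ρ) (h2 : ρ ≤ r / (2 * d)) (h0 : 0 < ρ) :
    dist (x + ρ • EuclideanSpace.single i σ) z < r := by
  have hd0 : (0:ℝ) < d := by exact_mod_cast hd
  set q := ‖z - x‖ with hq
  have hq' : dist x z = q := by rw [dist_comm, dist_eq_norm]
  rw [hq'] at hxr hxh
  have e : ‖x + ρ • EuclideanSpace.single i σ - z‖ ^ 2 = q ^ 2 - 2 * ρ * (σ * (z - x) i) + ρ ^ 2 := by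
    rw [show x + ρ • EuclideanSpace.single i σ - z = ρ • EuclideanSpace.single i σ - (z - x) by abel,
      norm_sub_sq_real, norm_smul, real_inner_smul_left, EuclideanSpace.inner_single_left]
    have : ‖EuclideanSpace.single i σ‖ = 1 := by
      rw [EuclideanSpace.norm_single]
      rcases hσ with rfl | rfl <;> simp
    rw [this, Real.norm_eq_abs, mul_one, sq_abs]
    simp
    ring
  rw [dist_eq_norm]
  refine lt_of_pow_lt_pow_left₀ 2 hr.le ?_
  rw [e]
  have hq0 : 0 < q := hr.trans_le hxr
  have h3 : ρ ≤ q / (2 * d) := h2.trans (by gcongr)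
  have h4 : ρ * (q / (2 * d)) < ρ * (σ * (z - x) i) := by gcongr
  have h5 : ρ * ρ ≤ ρ * (q / (2 * d)) := by gcongr
  have h6 : 2 * h * q ≤ ρ * (q / (2 * d)) := by
    calc 2 * h * q = (4 * d * h) * (q / (2 * d)) := by field_simp; ring
      _ ≤ _ := by gcongr
  have h7 : q ^ 2 - r ^ 2 ≤ 2 * h * q := by nlinarith
  nlinarith

theorem Sprime {d : ℕ} (hd : 1 ≤ d) (B : Set (Vd d × ℝ)) {s h : ℝ} (hs : 0 < s) (hh : 0 < h)
    (hB : ∀ p ∈ B, s ≤ p.2) {D : Set (Vd d)} (hD : MeasurableSet D) :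
    volume (D ∩ ((⋃ p ∈ B, ball p.1 (p.2 + h)) \ ⋃ p ∈ B, ball p.1 p.2)) ≤
      ENNReal.ofReal (32 * d ^ 3 * (h / s)) * volume (thickening s D) := by
  have hd1 : (1:ℝ) ≤ d := by exact_mod_cast hd
  have hd0 : (0:ℝ) < d := by linarith
  set V := ⋃ p ∈ B, ball p.1 p.2 with hV
  have hVo : IsOpen V := isOpen_biUnion fun _ _ => isOpen_ball
  have hDs : volume D ≤ volume (thickening s D) := measure_mono (self_subset_thickening hs D)
  by_cases hsm : s < 8 * d ^ 2 * h
  · calc _ ≤ volume D := measure_mono inter_subset_left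
      _ ≤ volume (thickening s D) := hDs
      _ = ENNReal.ofReal 1 * volume (thickening s D) := by simp
      _ ≤ _ := by
        gcongr
        rw [← mul_div_assoc, le_div_iff₀ hs]
        have : (d:ℝ) ^ 2 ≤ d ^ 3 := pow_le_pow_right₀ hd1 (by norm_num)
        nlinarith
  push Not at hsm
  set A : Fin d × Bool → Set (Vd d) := fun e => (D \ V) ∩ ⋃ p ∈ B, {x | dist x p.1 < p.2 + h ∧
    ‖p.1 - x‖ / (2 * d) < (if e.2 then 1 else -1) * (p.1 - x) e.1} with hA
  have hAm : ∀ e, MeasurableSet (A e) := by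
    intro e
    refine (hD.diff hVo.measurableSet).inter (IsOpen.measurableSet ?_)
    refine isOpen_biUnion fun p _ => ?_
    have o1 : IsOpen {x : Vd d | dist x p.1 < p.2 + h} := isOpen_lt (by fun_prop) (by fun_prop)
    have o2 : IsOpen {x : Vd d | ‖p.1 - x‖ / (2 * d) < (if e.2 then 1 else -1) * (p.1 - x) e.1} := by
      refine isOpen_lt (by fun_prop) ?_
      exact continuous_const.mul ((EuclideanSpace.proj (𝕜 := ℝ) e.1).continuous.comp
        (by fun_prop : Continuous fun x : Vd d => p.1 - x))
    exact o1.inter o2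
  have hcov : D ∩ ((⋃ p ∈ B, ball p.1 (p.2 + h)) \ V) ⊆ ⋃ e, A e := by
    rintro x ⟨hxD, hx1, hx2⟩
    simp only [mem_iUnion, exists_prop] at hx1
    obtain ⟨p, hp, hxp⟩ := hx1
    have hne : p.1 - x ≠ 0 := by
      intro h0
      apply hx2
      simp only [hV, mem_iUnion, exists_prop]
      refine ⟨p, hp, ?_⟩
      rw [sub_eq_zero] at h0
      rw [h0]; exact mem_ball_self (hs.trans_le (hB p hp))
    obtain ⟨i, σ, hσ, hi⟩ := exists_coord _ hne
    rcases hσ with rfl | rfl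
    · refine mem_iUnion.2 ⟨(i, true), ⟨hxD, hx2⟩, ?_⟩
      simp only [mem_iUnion, exists_prop]
      exact ⟨p, hp, hxp, by simpa using hi⟩
    · refine mem_iUnion.2 ⟨(i, false), ⟨hxD, hx2⟩, ?_⟩
      simp only [mem_iUnion, exists_prop]
      exact ⟨p, hp, hxp, by simpa using hi⟩
  have hone : ∀ e, volume (A e) ≤ ENNReal.ofReal (16 * d ^ 2 * (h / s)) * volume (thickening s D) := by
    intro e
    set σ : ℝ := if e.2 then 1 else -1 with hσd
    have hσ : σ = 1 ∨ σ = -1 := by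
      rw [hσd]; cases e.2 <;> simp
    set u : Vd d := EuclideanSpace.single e.1 σ with hu
    have hun : ‖u‖ = 1 := by
      rw [hu, EuclideanSpace.norm_single]
      rcases hσ with h | h <;> simp [h]
    set τ : ℝ := 4 * d * h with hτ
    have hτ0 : 0 < τ := by positivity
    set N : ℕ := ⌊s / (8 * d ^ 2 * h)⌋₊ with hN
    have hNle : (N:ℝ) ≤ s / (8 * d ^ 2 * h) := Nat.floor_le (by positivity)
    have hNτ : (N:ℝ) * τ ≤ s / (2 * d) := by
      calc (N:ℝ) * τ ≤ s / (8 * d ^ 2 * h) * τ := by gcongr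
        _ = _ := by rw [hτ]; field_simp; ring
    have hNge : s / (16 * d ^ 2 * h) ≤ N := by
      have h1 : 1 ≤ s / (8 * d ^ 2 * h) := by rw [le_div_iff₀ (by positivity)]; linarith
      have h2 : s / (8 * d ^ 2 * h) < N + 1 := Nat.lt_floor_add_one _
      have h3 : 1 ≤ N := Nat.le_floor (by exact_mod_cast h1)
      have h4 : (1:ℝ) ≤ N := by exact_mod_cast h3
      have h5 : s / (16 * d ^ 2 * h) = s / (8 * d ^ 2 * h) / 2 := by field_simp; norm_num
      linarith
    set S : ℕ → Set (Vd d) := fun k => (fun x => x - (k * τ) • u) ⁻¹' (A e) with hS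
    have hSm : ∀ k, MeasurableSet (S k) := fun k => (measurable_id.sub_const _) (hAm e)
    have hSv : ∀ k, volume (S k) = volume (A e) := fun k => by
      simp only [hS, sub_eq_add_neg]
      exact measure_preimage_add_right volume _ _
    have hmv : ∀ x ∈ A e, ∀ k : ℕ, 1 ≤ k → k < N → x + (k * τ) • u ∈ V := by
      intro x hx k hk1 hkN
      obtain ⟨⟨hxD, hxV⟩, hx2⟩ := hx
      simp only [mem_iUnion, exists_prop] at hx2
      obtain ⟨p, hp, hp1, hp2⟩ := hx2
      have hpr : 0 < p.2 := hs.trans_le (hB p hp)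
      have hk1' : (1:ℝ) ≤ k := by exact_mod_cast hk1
      have hkN' : (k:ℝ) ≤ N := by exact_mod_cast hkN.le
      have : dist (x + (k * τ) • u) p.1 < p.2 := by
        refine move_in hd (h := h) hpr ?_ hp1 hσ hp2 ?_ ?_ (by positivity)
        · by_contra hc
          push Not at hc
          exact hxV (by simp only [hV, mem_iUnion, exists_prop]; exact ⟨p, hp, hc⟩)
        · rw [← hτ]; nlinarith
        · calc (k:ℝ) * τ ≤ N * τ := by gcongr
            _ ≤ s / (2 * d) := hNτ
            _ ≤ _ := by gcongr; exact hB p hp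
      simp only [hV, mem_iUnion, exists_prop]
      exact ⟨p, hp, this⟩
    have hlt : ∀ j k : ℕ, j < k → k < N → Disjoint (S j) (S k) := by
      intro j k hjk hk
      rw [disjoint_left]
      intro y hyj hyk
      have h1 := hmv _ hyk (k - j) (by omega) (by omega)
      have : y - (k * τ) • u + (((k - j : ℕ) : ℝ) * τ) • u = y - (j * τ) • u := by
        rw [Nat.cast_sub hjk.le]; module
      rw [this] at h1
      exact hyj.1.2 h1
    have hdis : ((Finset.range N : Finset ℕ) : Set ℕ).PairwiseDisjoint S := by
      intro j hj k hk hjk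
      simp only [Finset.coe_range, mem_Iio] at hj hk
      rcases lt_or_gt_of_ne hjk with h | h
      · exact hlt j k h hk
      · exact (hlt k j h hj).symm
    have hsum := measure_biUnion_finset (μ := volume) hdis (fun k _ => hSm k)
    have hsub : (⋃ k ∈ Finset.range N, S k) ⊆ thickening s D := by
      refine iUnion₂_subset fun k hk y hy => ?_
      refine mem_thickening_iff.2 ⟨_, hy.1.1, ?_⟩
      rw [dist_eq_norm, sub_sub_cancel, norm_smul, hun, mul_one, Real.norm_eq_abs, abs_of_nonneg (by positivity)]
      have hkN' : (k:ℝ) ≤ N := by exact_mod_cast (Finset.mem_range.1 hk).le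
      calc (k:ℝ) * τ ≤ N * τ := by gcongr
        _ ≤ s / (2 * d) := hNτ
        _ < s := by
          rw [div_lt_iff₀ (by positivity)]; nlinarith
    have h1 : (N : ℝ≥0∞) * volume (A e) ≤ volume (thickening s D) := by
      have := measure_mono (μ := volume) hsub
      rw [hsum] at this
      simpa [hSv] using this
    have h2 : ENNReal.ofReal (s / (16 * d ^ 2 * h)) ≤ N := by
      refine (ENNReal.ofReal_le_ofReal hNge).trans ?_
      simp
    have h3 : ENNReal.ofReal (s / (16 * d ^ 2 * h)) * volume (A e) ≤ volume (thickening s D) :=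
      le_trans (by gcongr) h1
    calc volume (A e) = ENNReal.ofReal (16 * d ^ 2 * (h / s)) * (ENNReal.ofReal (s / (16 * d ^ 2 * h)) * volume (A e)) := by
          rw [← mul_assoc, ← ENNReal.ofReal_mul (by positivity)]
          have : 16 * (d:ℝ) ^ 2 * (h / s) * (s / (16 * d ^ 2 * h)) = 1 := by field_simp
          rw [this]; simp
      _ ≤ _ := by gcongr
  calc _ ≤ volume (⋃ e, A e) := measure_mono hcov
    _ ≤ ∑ e, volume (A e) := measure_iUnion_fintype_le _ _
    _ ≤ ∑ _e : Fin d × Bool, ENNReal.ofReal (16 * d ^ 2 * (h / s)) * volume (thickening s D) :=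
      Finset.sum_le_sum fun e _ => hone e
    _ = _ := by
      rw [Finset.sum_const, Finset.card_univ, Fintype.card_prod, Fintype.card_fin, Fintype.card_bool,
        nsmul_eq_mul, ← mul_assoc]
      congr 1
      rw [← ENNReal.ofReal_natCast, ← ENNReal.ofReal_mul (by positivity)]
      congr 1
      push_cast; ring

noncomputable def geoC (q : ℝ) : ℝ := 1 / (1 - 2 ^ (-q))

theorem geo_aux {q : ℝ} (hq : 0 < q) : (0:ℝ) < 2 ^ (-q) ∧ (2:ℝ) ^ (-q) < 1 :=
  ⟨by positivity, Real.rpow_lt_one_of_one_lt_of_neg (by norm_num) (by linarith)⟩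

theorem geoC_pos {q : ℝ} (hq : 0 < q) : 0 < geoC q := by
  have := geo_aux hq
  unfold geoC
  apply one_div_pos.2; linarith [this.2]

theorem geo {q X : ℝ} (hq : 0 < q) (hX : 0 < X) :
    ∑' m : ℤ, (if X ≤ 2 ^ m then ENNReal.ofReal ((X / 2 ^ m) ^ q) else 0) ≤ ENNReal.ofReal (geoC q) := by
  set m0 : ℤ := Int.clog 2 X with hm0
  have hi : Function.Injective (fun k : ℕ => m0 + (k:ℤ)) := by
    intro a b h; simpa using h
  have hsup : Function.support (fun m : ℤ => (if X ≤ 2 ^ m then ENNReal.ofReal ((X / 2 ^ m) ^ q) else 0)) ⊆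
      range (fun k : ℕ => m0 + (k:ℤ)) := by
    intro m hm
    have h1 : X ≤ 2 ^ m := by
      by_contra hc
      exact hm (by simp [hc])
    have h2 : m0 ≤ m := (Int.le_zpow_iff_clog_le (b := 2) (by norm_num) hX).1 (by exact_mod_cast h1)
    exact ⟨(m - m0).toNat, by simp only; omega⟩
  rw [← hi.tsum_eq hsup]
  have hm : X ≤ 2 ^ m0 := by
    have := Int.self_le_zpow_clog (b := 2) (by norm_num) X
    exact_mod_cast this
  obtain ⟨hb0, hb1⟩ := geo_aux hq
  calc _ ≤ ∑' k : ℕ, ENNReal.ofReal ((2:ℝ) ^ (-q)) ^ k := by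
        refine ENNReal.tsum_le_tsum fun k => ?_
        split_ifs
        · rw [← ENNReal.ofReal_pow hb0.le]
          apply ENNReal.ofReal_le_ofReal
          have e : ((2:ℝ) ^ (-q)) ^ k = (((2:ℝ) ^ k)⁻¹) ^ q := by
            rw [← Real.rpow_natCast (2 ^ (-q)) k, ← Real.rpow_mul (by norm_num), Real.inv_rpow (by positivity),
              ← Real.rpow_neg (by positivity), ← Real.rpow_natCast 2 k, ← Real.rpow_mul (by norm_num)]
            congr 1; ring
          rw [e, zpow_add₀ (by norm_num), zpow_natCast]
          apply Real.rpow_le_rpow (by positivity) _ hq.le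
          rw [div_le_iff₀ (by positivity)]
          calc X ≤ 2 ^ m0 := hm
            _ = _ := by field_simp
        · simp
    _ = ENNReal.ofReal (geoC q) := by
        rw [ENNReal.tsum_geometric, geoC, one_div, ENNReal.ofReal_inv_of_pos (by linarith),
          ENNReal.ofReal_sub _ hb0.le, ENNReal.ofReal_one]

theorem geo' {q X : ℝ} (hq : 0 < q) (hX : 0 < X) :
    ∑' m : ℤ, (if 2 ^ m ≤ X then ENNReal.ofReal ((2 ^ m / X) ^ q) else 0) ≤ ENNReal.ofReal (geoC q) := by
  rw [← (Equiv.neg ℤ).tsum_eq]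
  refine le_trans (le_of_eq ?_) (geo hq (inv_pos.2 hX))
  refine tsum_congr fun m => ?_
  simp only [Equiv.neg_apply, zpow_neg]
  have h2 : (0:ℝ) < 2 ^ m := by positivity
  have : ((2:ℝ) ^ m)⁻¹ ≤ X ↔ X⁻¹ ≤ 2 ^ m := inv_le_comm₀ h2 hX
  simp only [this]
  congr 3
  field_simp

theorem pow_dich {d : ℕ} (hd : 1 ≤ d) {ι : Type*} (P : ι → Prop) [DecidablePred P] (a : ι → ℝ)
    (ha : ∀ i, 0 ≤ a i) {k : ℝ} (hk : 0 < k)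
    (h : ENNReal.ofReal k ≤ ∑' i, if P i then ENNReal.ofReal (a i ^ d) else 0) :
    ENNReal.ofReal (k ^ (1 - 1 / (2 * d : ℝ))) ≤
      ∑' i, if P i then ENNReal.ofReal (a i ^ (d - 1) * a i ^ (1 / 2 : ℝ)) else 0 := by
  have hd0 : (0:ℝ) < d := by exact_mod_cast hd
  set q := k ^ (1 / (2 * d : ℝ)) with hq
  have hq0 : 0 < q := by positivity
  by_cases hc : ∃ i, P i ∧ q ≤ a i ^ (1 / 2 : ℝ)
  · obtain ⟨i, hi, hqi⟩ := hc
    refine le_trans ?_ (ENNReal.le_tsum i)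
    rw [if_pos hi]
    apply ENNReal.ofReal_le_ofReal
    set b := a i ^ (1 / 2 : ℝ) with hb
    have hab : a i = b ^ 2 := by
      rw [hb, ← Real.rpow_natCast, ← Real.rpow_mul (ha i)]; simp
    calc k ^ (1 - 1 / (2 * d : ℝ)) = q ^ (2 * (d - 1) + 1) := by
          rw [hq, ← Real.rpow_natCast, ← Real.rpow_mul hk.le]
          congr 1
          push_cast [Nat.cast_sub hd]
          field_simp; ring
      _ ≤ b ^ (2 * (d - 1) + 1) := by gcongr
      _ = _ := by rw [hab]; ring
  · push Not at hc
    have h1 : ENNReal.ofReal k ≤ ENNReal.ofReal q *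
        ∑' i, if P i then ENNReal.ofReal (a i ^ (d - 1) * a i ^ (1 / 2 : ℝ)) else 0 := by
      refine h.trans ?_
      rw [← ENNReal.tsum_mul_left]
      refine ENNReal.tsum_le_tsum fun i => ?_
      split_ifs with hi
      · rw [← ENNReal.ofReal_mul hq0.le]
        apply ENNReal.ofReal_le_ofReal
        have e : a i = a i ^ (1 / 2 : ℝ) * a i ^ (1 / 2 : ℝ) := by
          rw [← Real.rpow_add_of_nonneg (ha i) (by norm_num) (by norm_num)]; norm_num
        calc a i ^ d = a i ^ (d - 1) * a i := by rw [← pow_succ, Nat.sub_add_cancel hd]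
          _ = a i ^ (d - 1) * (a i ^ (1 / 2 : ℝ) * a i ^ (1 / 2 : ℝ)) := by rw [← e]
          _ = a i ^ (1 / 2 : ℝ) * (a i ^ (d - 1) * a i ^ (1 / 2 : ℝ)) := by ring
          _ ≤ _ := by
            have := ha i
            gcongr
            exact (hc i hi).le
      · simp
    have h2 : ENNReal.ofReal k = ENNReal.ofReal q * ENNReal.ofReal (k ^ (1 - 1 / (2 * d : ℝ))) := by
      rw [← ENNReal.ofReal_mul hq0.le, hq, ← Real.rpow_add hk]
      simp
    rw [h2] at h1
    exact (ENNReal.mul_le_mul_iff_right (by simpa using hq0) ENNReal.ofReal_ne_top).1 h1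

def Ann {d : ℕ} (B : Set (Vd d × ℝ)) (h : ℝ) : Set (Vd d) :=
  (⋃ p ∈ B, ball p.1 (p.2 + h)) \ ⋃ p ∈ B, ball p.1 p.2

theorem Ann_meas {d : ℕ} (B : Set (Vd d × ℝ)) (h : ℝ) : MeasurableSet (Ann B h) :=
  (isOpen_biUnion fun _ _ => isOpen_ball).measurableSet.diff (isOpen_biUnion fun _ _ => isOpen_ball).measurableSet

theorem Ann_mem {d : ℕ} {B : Set (Vd d × ℝ)} {h s : ℝ} {x : Vd d} (hx : x ∉ ⋃ p ∈ B, ball p.1 p.2)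
    {p : Vd d × ℝ} (hp : p ∈ B) (hxp : x ∈ ball p.1 (p.2 + h)) (hs : s ≤ p.2) :
    x ∈ Ann {p ∈ B | s ≤ p.2} h := by
  constructor
  · exact mem_biUnion (show p ∈ {p ∈ B | s ≤ p.2} from ⟨hp, hs⟩) hxp
  · intro hc
    apply hx
    simp only [mem_iUnion, exists_prop] at hc ⊢
    obtain ⟨q, hq, hxq⟩ := hc
    exact ⟨q, hq.1, hxq⟩

theorem Ann_ball {d : ℕ} (hd : 1 ≤ d) (B : Set (Vd d × ℝ)) {s h : ℝ} (hs : 0 < s) (hh : 0 < h) (c : Vd d) (k : ℕ) :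
    volume (closedBall c (k * s) ∩ Ann {p ∈ B | s ≤ p.2} h) ≤
      ENNReal.ofReal (32 * d ^ 3 * (1 + k) ^ d * om d * (h * s ^ (d - 1))) := by
  have := Sprime hd {p ∈ B | s ≤ p.2} hs hh (fun p hp => hp.2) (D := closedBall c (k * s)) isClosed_closedBall.measurableSet
  refine this.trans ?_
  rw [thickening_closedBall hs (by positivity), vol_ball _ (by positivity), ← ENNReal.ofReal_mul (by positivity)]
  apply le_of_eq
  congr 1
  have : s ^ d = s ^ (d - 1) * s := by rw [← pow_succ, Nat.sub_add_cancel hd]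
  rw [show s + k * s = (1 + k) * s by ring, mul_pow, this]
  field_simp

theorem K1 {d : ℕ} (hd : 1 ≤ d) (B u : Set (Vd d × ℝ)) (hu : u.Countable) (hup : ∀ p ∈ u, 0 < p.2)
    {h k : ℝ} (hh : 0 < h) (hk : 0 < k) (N : Set (Vd d))
    (hN : ∀ x ∈ N, x ∉ (⋃ p ∈ B, ball p.1 p.2) ∧ ∃ p ∈ B, x ∈ ball p.1 (p.2 + h) ∧ ∃ ρ, 0 < ρ ∧ ρ ≤ p.2 ∧
      ENNReal.ofReal k ≤ ∑' q : u, (open Classical in if dist x q.1.1 ≤ 5 * ρ ∧ q.1.2 ≤ ρ then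
        ENNReal.ofReal ((q.1.2 / ρ) ^ d) else 0)) :
    ENNReal.ofReal (k ^ (1 - 1 / (2 * d : ℝ))) * volume N ≤
      ENNReal.ofReal (32 * d ^ 3 * 11 ^ d * om d * 2 * geoC (1 / 2) * h) * ∑' q : u, ENNReal.ofReal (q.1.2 ^ (d - 1)) := by
  classical
  haveI := hu.to_subtype
  have hom := om_pos d
  have hgc := geoC_pos (q := 1 / 2) (by norm_num)
  set W : ℤ → Set (Vd d) := fun m => Ann {p ∈ B | (2:ℝ) ^ m ≤ p.2} h with hW
  set co : ℤ → u → ℝ≥0∞ := fun m q => if q.1.2 ≤ 2 * 2 ^ m then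
    ENNReal.ofReal ((q.1.2 / 2 ^ m) ^ (d - 1) * (q.1.2 / 2 ^ m) ^ (1 / 2 : ℝ)) else 0 with hco
  set g : ℤ → Vd d → ℝ≥0∞ := fun m x => ∑' q : u, (closedBall q.1.1 ((10:ℕ) * 2 ^ m)).indicator (fun _ => co m q) x with hg
  have hgm : ∀ m, Measurable (g m) := fun m => Measurable.ennreal_tsum fun q =>
    measurable_const.indicator isClosed_closedBall.measurableSet
  set κ := ENNReal.ofReal (k ^ (1 - 1 / (2 * d : ℝ))) with hκ
  have hcov : N ⊆ ⋃ m : ℤ, {x | κ ≤ g m x} ∩ W m := by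
    intro x hx
    obtain ⟨hxU, p, hp, hxp, ρ, hρ, hρp, hsum⟩ := hN x hx
    obtain ⟨m, hm1, hm2⟩ := exists_mem_Ico_zpow hρ (by norm_num : (1:ℝ) < 2)
    have hm2' : ρ < 2 * 2 ^ m := by rwa [zpow_add_one₀ (by norm_num), mul_comm] at hm2
    have h2m : (0:ℝ) < 2 ^ m := by positivity
    refine mem_iUnion.2 ⟨m, ?_, Ann_mem hxU hp hxp (hm1.trans hρp)⟩
    have := pow_dich hd _ (fun q : u => q.1.2 / ρ) (fun q => div_nonneg (hup _ q.2).le hρ.le) hk hsum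
    refine this.trans (ENNReal.tsum_le_tsum fun q => ?_)
    have hq0 := hup _ q.2
    split_ifs with hc
    · rw [indicator_of_mem]
      · simp only [hco]
        rw [if_pos (by linarith [hc.2])]
        apply ENNReal.ofReal_le_ofReal
        have : q.1.2 / ρ ≤ q.1.2 / 2 ^ m := by gcongr
        gcongr
      · rw [mem_closedBall]; push_cast; linarith [hc.1]
    · simp
  have hm : ∀ m, κ * volume ({x | κ ≤ g m x} ∩ W m) ≤ ∑' q : u,
      ENNReal.ofReal (32 * d ^ 3 * 11 ^ d * om d * 2 * h) * (ENNReal.ofReal (q.1.2 ^ (d - 1)) *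
        (if q.1.2 / 2 ≤ 2 ^ m then ENNReal.ofReal ((q.1.2 / 2 / 2 ^ m) ^ (1 / 2 : ℝ)) else 0)) := by
    intro m
    have h2m : (0:ℝ) < 2 ^ m := by positivity
    have h1 := mul_meas_ge_le_lintegral (μ := volume.restrict (W m)) (hgm m) κ
    rw [Measure.restrict_apply (measurableSet_le measurable_const (hgm m))] at h1
    refine h1.trans ?_
    rw [lintegral_tsum fun q => (measurable_const.indicator isClosed_closedBall.measurableSet).aemeasurable]
    refine ENNReal.tsum_le_tsum fun q => ?_
    have hq0 := hup _ q.2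
    rw [lintegral_indicator_const isClosed_closedBall.measurableSet, Measure.restrict_apply isClosed_closedBall.measurableSet]
    by_cases hc : q.1.2 / 2 ≤ 2 ^ m
    · have hc' : q.1.2 ≤ 2 * 2 ^ m := by linarith
      simp only [hco]
      rw [if_pos hc, if_pos hc']
      refine (mul_le_mul_right (Ann_ball hd B h2m hh q.1.1 10) _).trans ?_
      rw [← ENNReal.ofReal_mul (by positivity), ← ENNReal.ofReal_mul (by positivity), ← ENNReal.ofReal_mul (by positivity)]
      apply ENNReal.ofReal_le_ofReal
      have e1 : (q.1.2 / 2 ^ m) ^ (1 / 2 : ℝ) ≤ 2 * (q.1.2 / 2 / 2 ^ m) ^ (1 / 2 : ℝ) := by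
        have : q.1.2 / 2 ^ m = 2 * (q.1.2 / 2 / 2 ^ m) := by field_simp
        rw [this, Real.mul_rpow (by norm_num) (by positivity)]
        gcongr
        calc (2:ℝ) ^ (1 / 2 : ℝ) ≤ 2 ^ (1:ℝ) := Real.rpow_le_rpow_of_exponent_le (by norm_num) (by norm_num)
          _ = 2 := by simp
      calc _ ≤ (q.1.2 / 2 ^ m) ^ (d - 1) * (2 * (q.1.2 / 2 / 2 ^ m) ^ (1 / 2 : ℝ)) * (32 * d ^ 3 * (1 + (10:ℕ)) ^ d * om d * (h * (2 ^ m) ^ (d - 1))) := by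
            gcongr
        _ = _ := by
            rw [div_pow]; push_cast; field_simp; norm_num
    · have hc' : ¬ q.1.2 ≤ 2 * 2 ^ m := by intro hh; exact hc (by linarith)
      simp only [hco]
      rw [if_neg hc']; simp
  calc κ * volume N ≤ κ * ∑' m : ℤ, volume ({x | κ ≤ g m x} ∩ W m) := by
        gcongr
        exact (measure_mono hcov).trans (measure_iUnion_le _)
    _ = ∑' m : ℤ, κ * volume ({x | κ ≤ g m x} ∩ W m) := ENNReal.tsum_mul_left.symm
    _ ≤ _ := ENNReal.tsum_le_tsum hm
    _ = _ := ENNReal.tsum_comm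
    _ ≤ ∑' q : u, ENNReal.ofReal (32 * d ^ 3 * 11 ^ d * om d * 2 * h) * (ENNReal.ofReal (q.1.2 ^ (d - 1)) * ENNReal.ofReal (geoC (1 / 2))) := by
        refine ENNReal.tsum_le_tsum fun q => ?_
        rw [ENNReal.tsum_mul_left, ENNReal.tsum_mul_left]
        gcongr
        have := hup _ q.2
        exact geo (by norm_num) (by positivity)
    _ = _ := by
        rw [← ENNReal.tsum_mul_left]
        refine tsum_congr fun q => ?_
        have := hup _ q.2
        rw [← ENNReal.ofReal_mul (by positivity), ← ENNReal.ofReal_mul (by positivity), ← ENNReal.ofReal_mul (by positivity)]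
        congr 1; ring

theorem K2 {d : ℕ} (hd : 1 ≤ d) (B u : Set (Vd d × ℝ)) (hu : u.Countable) (hup : ∀ p ∈ u, 0 < p.2)
    {h : ℝ} (hh : 0 < h) (N : Set (Vd d))
    (hN : ∀ x ∈ N, x ∉ (⋃ p ∈ B, ball p.1 p.2) ∧ ∃ p ∈ B, x ∈ ball p.1 (p.2 + h) ∧ 
      ∃ q ∈ u, q.2 ≤ p.2 ∧ dist x q.1 ≤ 5 * q.2) :
    volume N ≤ ENNReal.ofReal (32 * d ^ 3 * 6 ^ d * om d * h) * ∑' q : u, ENNReal.ofReal (q.1.2 ^ (d - 1)) := by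
  have hom := om_pos d
  have hcov : N ⊆ ⋃ q ∈ u, closedBall q.1 ((5:ℕ) * q.2) ∩ Ann {p ∈ B | q.2 ≤ p.2} h := by
    intro x hx
    obtain ⟨hxU, p, hp, hxp, q, hq, hqp, hxq⟩ := hN x hx
    exact mem_biUnion hq ⟨by rw [mem_closedBall]; exact_mod_cast hxq, Ann_mem hxU hp hxp hqp⟩
  refine (measure_mono hcov).trans ((measure_biUnion_le _ hu _).trans ?_)
  rw [← ENNReal.tsum_mul_left]
  refine ENNReal.tsum_le_tsum fun q => ?_
  refine (Ann_ball hd B (hup _ q.2) hh q.1.1 5).trans ?_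
  rw [← ENNReal.ofReal_mul (by positivity)]
  apply le_of_eq
  congr 1; push_cast; ring

theorem Ann_shell {d : ℕ} (hd : 1 ≤ d) (B : Set (Vd d × ℝ)) {s h τ : ℝ} (hs : 0 < s) (hh : 0 < h) (c : Vd d) (hsτ : s ≤ τ) :
    volume (closedBall c (τ + 8 * s) \ ball c τ ∩ Ann {p ∈ B | s ≤ p.2} h) ≤
      ENNReal.ofReal (320 * d ^ 4 * 10 ^ (d - 1) * om d * (h * τ ^ (d - 1))) := by
  have hom := om_pos d
  have hτ : 0 < τ := hs.trans_le hsτ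
  have := Sprime hd {p ∈ B | s ≤ p.2} hs hh (fun p hp => hp.2) (D := closedBall c (τ + 8 * s) \ ball c τ) 
    (isClosed_closedBall.measurableSet.diff isOpen_ball.measurableSet)
  refine this.trans ?_
  have hsub : thickening s (closedBall c (τ + 8 * s) \ ball c τ) ⊆ closedBall c (τ + 9 * s) \ closedBall c (τ - s) := by
    intro y hy
    obtain ⟨z, ⟨hz1, hz2⟩, hyz⟩ := mem_thickening_iff.1 hy
    rw [mem_closedBall] at hz1
    rw [mem_ball, not_lt] at hz2
    refine ⟨?_, ?_⟩
    · rw [mem_closedBall]; linarith [dist_triangle y z c]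
    · rw [mem_closedBall, not_le]; linarith [dist_triangle z y c, dist_comm z y]
  have hv : volume (thickening s (closedBall c (τ + 8 * s) \ ball c τ)) ≤ ENNReal.ofReal (10 * s * d * (10 * τ) ^ (d - 1) * om d) := by
    refine (measure_mono hsub).trans ?_
    rw [measure_diff (closedBall_subset_closedBall (by linarith)) isClosed_closedBall.measurableSet.nullMeasurableSet
      measure_closedBall_lt_top.ne, vol_closedBall _ (by positivity), vol_closedBall _ (by linarith),
      ← ENNReal.ofReal_sub _ (by have : 0 ≤ τ - s := by linarith
                                 positivity)]
    apply ENNReal.ofReal_le_ofReal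
    rw [← sub_mul]
    gcongr
    refine (le_abs_self _).trans ((abs_pow_sub_pow_le _ _ d).trans ?_)
    have a1 : |τ + 9 * s - (τ - s)| = 10 * s := by rw [abs_of_nonneg (by linarith)]; ring
    have a2 : max |τ + 9 * s| |τ - s| ≤ 10 * τ := by
      rw [abs_of_nonneg (by linarith), abs_of_nonneg (by linarith)]
      exact max_le (by linarith) (by linarith)
    rw [a1]
    gcongr
  calc _ ≤ ENNReal.ofReal (32 * d ^ 3 * (h / s)) * ENNReal.ofReal (10 * s * d * (10 * τ) ^ (d - 1) * om d) := by gcongr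
    _ = _ := by
      rw [← ENNReal.ofReal_mul (by positivity), mul_pow]
      congr 1; field_simp; ring

theorem K3 {d : ℕ} (hd : 1 ≤ d) (B u : Set (Vd d × ℝ)) (hu : u.Countable) (hup : ∀ p ∈ u, 0 < p.2)
    {h δ : ℝ} (hh : 0 < h) (hδ : 0 < δ) (N : Set (Vd d))
    (hN : ∀ x ∈ N, x ∉ (⋃ p ∈ B, ball p.1 p.2) ∧ ∃ p ∈ B, 0 < p.2 ∧ x ∈ ball p.1 (p.2 + h) ∧ 
      ∃ q ∈ u, p.2 ≤ q.2 ∧ dist x q.1 ≤ q.2 + 4 * p.2 ∧ q.2 ≤ dist x q.1 ∧ δ * q.2 ≤ 4 * p.2) :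
    volume N ≤ ENNReal.ofReal (320 * d ^ 4 * 10 ^ (d - 1) * om d * geoC (1 / (2 * d)) * (8 / δ) ^ (1 / (2 * d : ℝ)) * h) * 
      ∑' q : u, ENNReal.ofReal (q.1.2 ^ (d - 1)) := by
  classical
  have hom := om_pos d
  have hd0 : (0:ℝ) < d := by exact_mod_cast hd
  have hgc := geoC_pos (q := 1 / (2 * d)) (by positivity)
  have hcov : N ⊆ ⋃ q ∈ u, ⋃ m : ℤ, if (2:ℝ) ^ m ≤ q.2 ∧ δ * q.2 ≤ 8 * 2 ^ m then
      closedBall q.1 (q.2 + 8 * 2 ^ m) \ ball q.1 q.2 ∩ Ann {p ∈ B | (2:ℝ) ^ m ≤ p.2} h else ∅ := by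
    intro x hx
    obtain ⟨hxU, p, hp, hp0, hxp, q, hq, hpq, hx1, hx2, hδq⟩ := hN x hx
    obtain ⟨m, hm1, hm2⟩ := exists_mem_Ico_zpow hp0 (by norm_num : (1:ℝ) < 2)
    have hm2' : p.2 < 2 * 2 ^ m := by rwa [zpow_add_one₀ (by norm_num), mul_comm] at hm2
    refine mem_biUnion hq (mem_iUnion.2 ⟨m, ?_⟩)
    rw [if_pos ⟨by linarith, by linarith⟩]
    exact ⟨⟨by rw [mem_closedBall]; linarith, by rw [mem_ball]; linarith⟩, Ann_mem hxU hp hxp hm1⟩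
  refine (measure_mono hcov).trans ((measure_biUnion_le _ hu _).trans ?_)
  rw [← ENNReal.tsum_mul_left]
  refine ENNReal.tsum_le_tsum fun q => ?_
  have hq0 := hup _ q.2
  refine (measure_iUnion_le _).trans ?_
  calc _ ≤ ∑' m : ℤ, ENNReal.ofReal (320 * d ^ 4 * 10 ^ (d - 1) * om d * (h * q.1.2 ^ (d - 1)) * (8 / δ) ^ (1 / (2 * d : ℝ))) * 
        (if (2:ℝ) ^ m ≤ q.1.2 then ENNReal.ofReal ((2 ^ m / q.1.2) ^ (1 / (2 * d : ℝ))) else 0) := by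
        refine ENNReal.tsum_le_tsum fun m => ?_
        split_ifs with h1 h2 h2
        · refine (Ann_shell hd B (by positivity) hh _ h1.1).trans ?_
          rw [← ENNReal.ofReal_mul (by positivity)]
          apply ENNReal.ofReal_le_ofReal
          rw [mul_assoc _ ((8 / δ) ^ (1 / (2 * d : ℝ)))]
          refine le_mul_of_one_le_right (by positivity) ?_
          rw [← Real.mul_rpow (by positivity) (by positivity)]
          apply Real.one_le_rpow _ (by positivity)
          rw [div_mul_div_comm, le_div_iff₀ (by positivity)]
          linarith [h1.2]
        · exact absurd h1.1 h2
        · simp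
        · simp
    _ ≤ _ := by
        rw [ENNReal.tsum_mul_left]
        refine (mul_le_mul_right (geo' (by positivity) hq0) _).trans ?_
        rw [← ENNReal.ofReal_mul (by positivity), ← ENNReal.ofReal_mul (by positivity)]
        apply le_of_eq
        congr 1; ring

theorem num1 {d : ℕ} (hd : 1 ≤ d) {ε : ℝ} (h0 : 0 < ε) (h1 : ε ≤ 1) : (1 + ε / (4 * d)) ^ d ≤ 1 + ε / 3 := by
  have hd0 : (0:ℝ) < d := by exact_mod_cast hd
  have a : (1 + ε / (4 * d)) ^ d ≤ Real.exp (ε / 4) := by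
    calc (1 + ε / (4 * d)) ^ d ≤ (Real.exp (ε / (4 * d))) ^ d := by
          gcongr
          linarith [Real.add_one_le_exp (ε / (4 * d))]
      _ = Real.exp (ε / 4) := by rw [← Real.exp_nat_mul]; congr 1; field_simp
  have b : (1 - ε / 4) * Real.exp (ε / 4) ≤ 1 := by
    have := Real.add_one_le_exp (-(ε / 4))
    calc (1 - ε / 4) * Real.exp (ε / 4) ≤ Real.exp (-(ε / 4)) * Real.exp (ε / 4) := by gcongr; linarith
      _ = 1 := by rw [← Real.exp_add]; simp
  have c : Real.exp (ε / 4) > 0 := Real.exp_pos _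
  refine a.trans ?_
  have h2 : (1:ℝ) ≤ (1 - ε / 4) * (1 + ε / 3) := by nlinarith
  have h3 : 0 < 1 - ε / 4 := by linarith
  exact le_of_mul_le_mul_left (b.trans h2) h3

theorem num2 {d : ℕ} (hd : 1 ≤ d) {l : ℝ} (h0 : 0 < l) (h1 : l < 1) : 1 - l / 4 ≤ (1 - l / (4 * d)) ^ d := by
  have hd0 : (1:ℝ) ≤ d := by exact_mod_cast hd
  have e : l / (4 * d) ≤ 1 := by rw [div_le_one (by positivity)]; linarith
  have := one_add_mul_le_pow (a := -(l / (4 * d))) (by linarith) d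
  calc 1 - l / 4 = 1 + d * (-(l / (4 * d))) := by field_simp; ring
    _ ≤ _ := this
    _ = _ := by rw [sub_eq_add_neg]

theorem ptQ {d : ℕ} (hd : 1 ≤ d) {E Ω : Set (Vd d)} (hE : MeasurableSet E) {x : Vd d}
    (hx : ∀ z r α, 0 < r → dist x z ≤ 4 * r → α < 1 → volume.real (Eᶜ ∩ ball z r) ≤ α * (r ^ d * om d) →
      ∃ t ∈ Ioc (0:ℝ) 1, volume.real (Eᶜ ∩ ball (x + t • (z - x)) (t * r)) = α * ((t * r) ^ d * om d))
    {l r h η : ℝ} {z : Vd d} (h0 : 0 < l) (h1 : l < 1) (hr : 0 < r) (hz : ball z r ⊆ Ω)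
    (hdens : l * (r ^ d * om d) < volume.real (E ∩ ball z r)) (hhr : h ≤ r) (hxz : dist x z < r + h)
    (hη : ball x η ⊆ Ω) (hh : h ≤ η * l / (12 * d)) :
    ∃ c ρ, 0 < ρ ∧ ρ ≤ r ∧ ball c ρ ⊆ Ω ∧ dist x c ≤ 3 * ρ ∧
      volume.real (E ∩ ball c ρ) = l / 2 * (ρ ^ d * om d) := by
  have hom := om_pos d
  have hd1 : (1:ℝ) ≤ d := by exact_mod_cast hd
  set θ := 1 - l / (4 * d) with hθ
  have hl4 : l / (4 * d) ≤ 1 / 4 := by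
    rw [div_le_div_iff₀ (by positivity) (by norm_num)]; nlinarith
  have hl0 : 0 < l / (4 * d) := by positivity
  have hθ1 : 3 / 4 ≤ θ := by linarith
  have hθ2 : θ < 1 := by linarith
  have hθd := num2 hd h0 h1
  rw [← hθ] at hθd
  have hθr : 0 < θ * r := by positivity
  have hF : volume.real (Eᶜ ∩ ball z (θ * r)) ≤ (1 - l / 2) * ((θ * r) ^ d * om d) := by
    have a1 : volume.real (Eᶜ ∩ ball z (θ * r)) ≤ volume.real (Eᶜ ∩ ball z r) :=
      rvol_mono_ball (inter_subset_inter_right _ (ball_subset_ball (by nlinarith)))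
    rw [rvol_compl_ball hE z hr] at a1
    rw [mul_pow]
    have hrd : 0 < r ^ d * om d := by positivity
    have : 1 - l ≤ (1 - l / 2) * θ ^ d := by nlinarith
    nlinarith
  obtain ⟨t, ht, hQ⟩ := hx z (θ * r) (1 - l / 2) hθr (by nlinarith) (by linarith) hF
  have hρ : 0 < t * (θ * r) := mul_pos ht.1 hθr
  have hdx : dist x (x + t • (z - x)) = t * dist x z := dist_path ht.1.le
  refine ⟨x + t • (z - x), t * (θ * r), hρ, ?_, ?_, ?_, ?_⟩
  · have : t * (θ * r) ≤ 1 * (1 * r) := by gcongr; exact ht.2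
    linarith
  · by_cases hc : 3 * t * r ≤ η
    · refine Subset.trans ?_ hη
      intro y hy
      rw [mem_ball] at hy ⊢
      have := dist_triangle y (x + t • (z - x)) x
      rw [dist_comm (x + t • (z - x)) x, hdx] at this
      have q1 : t * dist x z ≤ t * (2 * r) := mul_le_mul_of_nonneg_left (by linarith) ht.1.le
      have q2 : t * (θ * r) ≤ t * r := by have := ht.1; gcongr; nlinarith
      nlinarith
    · push Not at hc
      refine Subset.trans ?_ hz
      intro y hy
      rw [mem_ball] at hy ⊢
      have e : dist (x + t • (z - x)) z = (1 - t) * dist x z := by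
        rw [dist_eq_norm, dist_eq_norm, show x + t • (z - x) - z = (1 - t) • (x - z) by module, norm_smul,
          Real.norm_eq_abs, abs_of_nonneg (by linarith [ht.2])]
      have := dist_triangle y (x + t • (z - x)) z
      rw [e] at this
      have q1 : (1 - t) * dist x z ≤ (1 - t) * (r + h) := mul_le_mul_of_nonneg_left hxz.le (by linarith [ht.2])
      have q2 : h ≤ t * r * (l / (4 * d)) := by
        calc h ≤ η * l / (12 * d) := hh
          _ = η / 3 * (l / (4 * d)) := by field_simp; ring
          _ ≤ t * r * (l / (4 * d)) := by gcongr; linarith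
      have q3 : t * (θ * r) = t * r - t * r * (l / (4 * d)) := by rw [hθ]; ring
      by_cases hh0 : 0 ≤ h
      · nlinarith [mul_nonneg ht.1.le hh0]
      · push Not at hh0
        have : (1 - t) * h ≤ 0 := by nlinarith [ht.2]
        have : 0 < t * r * (l / (4 * d)) := by have := ht.1; positivity
        nlinarith
  · rw [hdx]
    have : t * dist x z ≤ t * (2 * r) := mul_le_mul_of_nonneg_left (by linarith) ht.1.le
    have h3 : 2 * r ≤ 3 * (θ * r) := by nlinarith
    have := mul_le_mul_of_nonneg_left h3 ht.1.le
    linarith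
  · have := rvol_compl_ball hE (x + t • (z - x)) hρ
    linarith

theorem ptT {d : ℕ} (hd : 1 ≤ d) {E : Set (Vd d)} {x : Vd d}
    (hx : ∀ z r α, 0 < r → dist x z ≤ 4 * r → α < 1 → volume.real (E ∩ ball z r) ≤ α * (r ^ d * om d) →
      ∃ t ∈ Ioc (0:ℝ) 1, volume.real (E ∩ ball (x + t • (z - x)) (t * r)) = α * ((t * r) ^ d * om d))
    {l ρ δ : ℝ} {c : Vd d} (h0 : 0 < l) (h1 : l < 1) (hρ : 0 < ρ) (hδ : δ = (1 - l) / (4 * d))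
    (hdens : volume.real (E ∩ ball c ρ) = l / 2 * (ρ ^ d * om d)) (hxc : dist x c < ρ) :
    ∃ c' τ, 0 < τ ∧ (1 + δ) * τ ≤ ρ ∧ ball c' ((1 + δ) * τ) ⊆ ball c ρ ∧ dist x c' ≤ 2 * τ ∧
      dist c c' + τ ≤ ρ ∧ volume.real (E ∩ ball c' τ) = (1 + l) / 2 * (τ ^ d * om d) := by
  have hom := om_pos d
  have hd1 : (1:ℝ) ≤ d := by exact_mod_cast hd
  have hn := num1 hd (sub_pos.2 h1) (by linarith)
  rw [← hδ] at hn
  have hδ0 : 0 < δ := by rw [hδ]; have := sub_pos.2 h1; positivity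
  have hδ1 : δ ≤ 1 / 4 := by
    rw [hδ, div_le_div_iff₀ (by positivity) (by norm_num)]; nlinarith
  have hr : 0 < ρ / (1 + δ) := by positivity
  have hr1 : ρ / (1 + δ) * (1 + δ) = ρ := by field_simp
  set r := ρ / (1 + δ) with hrd
  have hF : volume.real (E ∩ ball c r) ≤ (1 + l) / 2 * (r ^ d * om d) := by
    have a1 : volume.real (E ∩ ball c r) ≤ volume.real (E ∩ ball c ρ) :=
      rvol_mono_ball (inter_subset_inter_right _ (ball_subset_ball (by nlinarith)))
    rw [hdens, ← hr1, mul_pow] at a1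
    refine a1.trans ?_
    have hrd : 0 < r ^ d * om d := by positivity
    have : l / 2 * (1 + δ) ^ d ≤ (1 + l) / 2 := by nlinarith
    nlinarith
  obtain ⟨t, ht, hQ⟩ := hx c r ((1 + l) / 2) hr (by nlinarith) (by linarith) hF
  have ht0 := ht.1
  have e1 : (1 + δ) * (t * r) = t * ρ := by rw [← hr1]; ring
  have hdx : dist x (x + t • (c - x)) = t * dist x c := dist_path ht.1.le
  refine ⟨x + t • (c - x), t * r, by positivity, ?_, ?_, ?_, ?_, hQ⟩
  · rw [e1]; nlinarith [ht.2]
  · rw [e1]; exact ball_sub_ball_path ht hxc.le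
  · rw [hdx]
    have : t * dist x c ≤ t * ρ := by gcongr
    have := mul_pos ht0 hr
    nlinarith
  · have e : dist c (x + t • (c - x)) = (1 - t) * dist x c := by
      rw [dist_comm, dist_eq_norm, dist_eq_norm, show x + t • (c - x) - c = (1 - t) • (x - c) by module, norm_smul,
          Real.norm_eq_abs, abs_of_nonneg (by linarith [ht.2])]
    rw [e]
    have : (1 - t) * dist x c ≤ (1 - t) * ρ := mul_le_mul_of_nonneg_left hxc.le (by linarith [ht.2])
    have : t * r ≤ t * ρ := by gcongr; nlinarith
    linarith

theorem sumT {d : ℕ} (hd : 1 ≤ d) {Ω E : Set (Vd d)} (hE : MeasurableSet E) {l : ℝ} (h0 : 0 < l) (h1 : l < 1)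
    (u : Set (Vd d × ℝ)) (hup : ∀ p ∈ u, 0 < p.2) (huΩ : ∀ p ∈ u, ball p.1 p.2 ⊆ Ω)
    (hud : u.PairwiseDisjoint (fun p => ball p.1 p.2))
    (hdens : ∀ p ∈ u, volume.real (E ∩ ball p.1 p.2) = (1 + l) / 2 * (p.2 ^ d * om d)) :
    ENNReal.ofReal (om d * ((1 - l) / 2) ^ (1 - 1 / (d:ℝ))) * ∑' q : u, ENNReal.ofReal (q.1.2 ^ (d - 1)) ≤
      11 ^ d * 2 ^ (d + 4) * Per Ω E := by
  have hom := om_pos d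
  have hl : 0 < (1 - l) / 2 := by linarith
  rw [← Per_compl hE, ← ENNReal.tsum_mul_left]
  have hs := Per_tsum_superadd (E := Eᶜ) (Ω := Ω) (T := fun q : u => ball q.1.1 q.1.2) hE.compl ?_ ?_
  · refine le_trans ?_ (mul_le_mul_right hs _)
    rw [← ENNReal.tsum_mul_left]
    refine ENNReal.tsum_le_tsum fun q => ?_
    have hq := hup _ q.2
    refine le_trans (le_of_eq ?_) (RI hd hE.compl q.1.1 hq (ε := (1 - l) / 2) ?_ hl (by linarith))
    · rw [← ENNReal.ofReal_mul (by positivity)]; congr 1; ring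
    · rw [rvol_compl_ball hE _ hq, hdens _ q.2]; ring
  · intro p q hpq
    exact hud p.2 q.2 (fun h => hpq (Subtype.ext h))
  · exact fun q => huΩ _ q.2

theorem inv_help {a : ℝ} {S X : ℝ≥0∞} (ha : 0 < a) (h : ENNReal.ofReal a * S ≤ X) : S ≤ ENNReal.ofReal a⁻¹ * X := by
  calc S = ENNReal.ofReal a⁻¹ * (ENNReal.ofReal a * S) := by
        rw [← mul_assoc, ← ENNReal.ofReal_mul (by positivity), inv_mul_cancel₀ ha.ne']; simp
    _ ≤ _ := by gcongr

theorem ofReal3 {a b c : ℝ} (ha : 0 ≤ a) (hb : 0 ≤ b) :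
    ENNReal.ofReal (a * b * c) = ENNReal.ofReal a * ENNReal.ofReal b * ENNReal.ofReal c := by
  rw [ENNReal.ofReal_mul (mul_nonneg ha hb), ENNReal.ofReal_mul ha]

/-- good balls -/
def Fam {d : ℕ} (Ω E : Set (Vd d)) (l s R : ℝ) : Set (Vd d × ℝ) :=
  {p | s ≤ p.2 ∧ p.2 ≤ R ∧ ball p.1 p.2 ⊆ Ω ∧ l * (p.2 ^ d * om d) < volume.real (E ∩ ball p.1 p.2)}

noncomputable def C1 (d : ℕ) : ℝ := 32 * d ^ 3 * 11 ^ d * om d * 2 * geoC (1 / 2)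
noncomputable def C2 (d : ℕ) : ℝ := 32 * d ^ 3 * 6 ^ d * om d
noncomputable def C3 (d : ℕ) : ℝ := 320 * d ^ 4 * 10 ^ (d - 1) * om d * geoC (1 / (2 * d))
noncomputable def Ck (d : ℕ) : ℝ := (C1 d * (2 * 7 ^ d) + C2 d + C3 d * (32 * d)) * (2 / om d) * (11 ^ d * 2 ^ (d + 4))

theorem key_geom {d : ℕ} (hd : 1 ≤ d) {Ω E K : Set (Vd d)} (hE : MeasurableSet E) {l s R η h δ : ℝ}
    (h0 : 0 < l) (h1 : l < 1) (hs : 0 < s) (hK : ∀ x ∈ K, ball x η ⊆ Ω) (hhs : h ≤ s)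
    (hhη : h ≤ η * l / (12 * d)) (hδ : δ = (1 - l) / (4 * d)) :
    ∃ u : Set (Vd d × ℝ), u.Countable ∧ (∀ p ∈ u, 0 < p.2) ∧ (∀ p ∈ u, ball p.1 p.2 ⊆ Ω) ∧
      u.PairwiseDisjoint (fun p => ball p.1 p.2) ∧
      (∀ p ∈ u, volume.real (E ∩ ball p.1 p.2) = (1 + l) / 2 * (p.2 ^ d * om d)) ∧
      ∀ᵐ x, x ∈ K ∩ (Eᶜ ∩ Ann (Fam Ω E l s R) h) → x ∉ (⋃ p ∈ Fam Ω E l s R, ball p.1 p.2) ∧ 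
        ∃ p ∈ Fam Ω E l s R, 0 < p.2 ∧ x ∈ ball p.1 (p.2 + h) ∧
        ((∃ ρ, 0 < ρ ∧ ρ ≤ p.2 ∧ ENNReal.ofReal (l / 2 / 7 ^ d) ≤ ∑' q : u, (open Classical in if dist x q.1.1 ≤ 5 * ρ ∧ q.1.2 ≤ ρ then
        ENNReal.ofReal ((q.1.2 / ρ) ^ d) else 0)) ∨
        (∃ q ∈ u, q.2 ≤ p.2 ∧ dist x q.1 ≤ 5 * q.2) ∨
        (∃ q ∈ u, p.2 ≤ q.2 ∧ dist x q.1 ≤ q.2 + 4 * p.2 ∧ q.2 ≤ dist x q.1 ∧ δ * q.2 ≤ 4 * p.2)) := by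
  classical
  have hom := om_pos d
  have hd1 : (1:ℝ) ≤ d := by exact_mod_cast hd
  have hδ0 : 0 < δ := by rw [hδ]; have := sub_pos.2 h1; positivity
  set T : Set (Vd d × ℝ) := {p | 0 < p.2 ∧ (1 + δ) * p.2 ≤ R ∧ ball p.1 ((1 + δ) * p.2) ⊆ Ω ∧
    volume.real (E ∩ ball p.1 p.2) = (1 + l) / 2 * (p.2 ^ d * om d)} with hT
  obtain ⟨u, huT, huc, hud, huv⟩ := vitali T (fun p hp => hp.1) R (fun p hp => by nlinarith [hp.1, hp.2.1])
  refine ⟨u, huc, fun p hp => (huT hp).1, fun p hp => (ball_subset_ball (by nlinarith [(huT hp).1])).trans (huT hp).2.2.1, 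
    hud, fun p hp => (huT hp).2.2.2, ?_⟩
  filter_upwards [path hE.compl] with x hx hxN
  obtain ⟨hxK, hxF, hxA, hxU⟩ := hxN
  refine ⟨hxU, ?_⟩
  simp only [mem_iUnion, exists_prop] at hxA
  obtain ⟨p, hp, hxp⟩ := hxA
  have hp0 : 0 < p.2 := hs.trans_le hp.1
  refine ⟨p, hp, hp0, hxp, ?_⟩
  obtain ⟨c, ρ, hρ, hρp, hcΩ, hxc, hQ⟩ := ptQ hd hE (hx hxF) h0 h1 hp0 hp.2.2.1 hp.2.2.2 (hhs.trans hp.1) hxp (hK x hxK) hhη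
  by_cases hcase : ∀ q ∈ u, dist c q.1 < ρ + q.2 → q.2 ≤ ρ
  · left
    refine ⟨ρ, hρ, hρp, ?_⟩
    have hcov : ∀ᵐ e, e ∈ E ∩ ball c ρ → e ∈ ⋃ q ∈ u, if dist x q.1 ≤ 5 * ρ ∧ q.2 ≤ ρ then closedBall q.1 (7 * q.2) else ∅ := by
      filter_upwards [path hE] with e he heQ
      obtain ⟨c', τ, hτ, hτρ, hsub, hec', hcc', hd'⟩ := ptT hd (he heQ.1) h0 h1 hρ hδ hQ heQ.2
      have hTm : ((c', τ) : Vd d × ℝ) ∈ T := ⟨hτ, hτρ.trans (hρp.trans hp.2.1), hsub.trans hcΩ, hd'⟩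
      obtain ⟨q, hq, hq1, hq2⟩ := huv _ hTm
      simp only at hq1 hq2
      have hcq : dist c q.1 < ρ + q.2 := by linarith [dist_triangle c c' q.1]
      have hqρ := hcase q hq hcq
      refine mem_biUnion hq ?_
      rw [if_pos ⟨by linarith [dist_triangle x c q.1], hqρ⟩, mem_closedBall]
      linarith [dist_triangle e c' q.1]
    have hm : volume (E ∩ ball c ρ) ≤ ∑' q : u, volume (if dist x q.1.1 ≤ 5 * ρ ∧ q.1.2 ≤ ρ then closedBall q.1.1 (7 * q.1.2) else ∅) :=
      (measure_mono_ae hcov).trans (measure_biUnion_le _ huc _)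
    rw [← ofReal_measureReal (ball_inter_ne_top E c ρ), hQ] at hm
    have e : l / 2 * (ρ ^ d * om d) = (7 ^ d * ρ ^ d * om d) * (l / 2 / 7 ^ d) := by field_simp
    rw [e, ENNReal.ofReal_mul (by positivity)] at hm
    have hpos : 0 < 7 ^ d * ρ ^ d * om d := by positivity
    refine (ENNReal.mul_le_mul_iff_right (by simpa using hpos) ENNReal.ofReal_ne_top).1 (hm.trans ?_)
    rw [← ENNReal.tsum_mul_left]
    refine ENNReal.tsum_le_tsum fun q => ?_
    have hq0 := (huT q.2).1
    split_ifs
    · rw [vol_closedBall _ (by positivity), ← ENNReal.ofReal_mul (by positivity)]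
      apply le_of_eq
      congr 1; rw [div_pow, mul_pow]; field_simp
    · simp
  · right
    push Not at hcase
    obtain ⟨q, hq, hcq, hqρ⟩ := hcase
    by_cases hqp : q.2 ≤ p.2
    · left
      exact ⟨q, hq, hqp, by linarith [dist_triangle x c q.1]⟩
    · right
      push Not at hqp
      have hqT := huT hq
      have hq0 := hqT.1
      have hmem : ((q.1, (1 + δ) * q.2) : Vd d × ℝ) ∈ Fam Ω E l s R := by
        refine ⟨?_, hqT.2.1, hqT.2.2.1, ?_⟩
        · have := hp.1
          simp only
          nlinarith
        · have a1 : volume.real (E ∩ ball q.1 q.2) ≤ volume.real (E ∩ ball q.1 ((1 + δ) * q.2)) :=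
            rvol_mono_ball (inter_subset_inter_right _ (ball_subset_ball (by nlinarith)))
          rw [hqT.2.2.2] at a1
          refine lt_of_lt_of_le ?_ a1
          have hn := num1 hd (sub_pos.2 h1) (by linarith)
          rw [← hδ] at hn
          simp only [mul_pow]
          have hpos : 0 < q.2 ^ d * om d := by positivity
          have : l * (1 + δ) ^ d < (1 + l) / 2 := by nlinarith
          nlinarith
      have hfar : (1 + δ) * q.2 ≤ dist x q.1 := by
        by_contra hc
        push Not at hc
        exact hxU (mem_biUnion hmem hc)
      have hxq : dist x q.1 ≤ q.2 + 4 * p.2 := by linarith [dist_triangle x c q.1]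
      exact ⟨q, hq, hqp.le, hxq, by nlinarith, by nlinarith⟩

theorem key {d : ℕ} (hd : 1 ≤ d) {Ω E K : Set (Vd d)} (hE : MeasurableSet E) {l s R η h : ℝ}
    (h0 : 0 < l) (h1 : l < 1) (hs : 0 < s) (hK : ∀ x ∈ K, ball x η ⊆ Ω) (hh : 0 < h) (hhs : h ≤ s)
    (hhη : h ≤ η * l / (12 * d)) :
    volume (K ∩ (Eᶜ ∩ Ann (Fam Ω E l s R) h)) ≤ 
      ENNReal.ofReal (Ck d * (l ^ (-(1 - 1 / (2 * d : ℝ))) * (1 - l) ^ (-(1 - 1 / (2 * d : ℝ)))) * h) * Per Ω E := by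
  have hom := om_pos d
  have hd1 : (1:ℝ) ≤ d := by exact_mod_cast hd
  have hl1 : 0 < 1 - l := by linarith
  have hg1 := geoC_pos (q := 1 / 2) (by norm_num)
  have hg2 := geoC_pos (q := 1 / (2 * d)) (by positivity)
  set δ := (1 - l) / (4 * d) with hδ
  have hδ0 : 0 < δ := by positivity
  obtain ⟨u, huc, hup, huΩ, hud, hdens, hae⟩ := key_geom (R := R) hd hE h0 h1 hs hK hhs hhη hδ
  set B := Fam Ω E l s R with hB
  set S := ∑' q : u, ENNReal.ofReal (q.1.2 ^ (d - 1)) with hS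
  have hSb := inv_help (by positivity) (sumT hd hE h0 h1 u hup huΩ hud hdens)
  set N1 := {x | x ∉ (⋃ p ∈ B, ball p.1 p.2) ∧ ∃ p ∈ B, x ∈ ball p.1 (p.2 + h) ∧ ∃ ρ, 0 < ρ ∧ ρ ≤ p.2 ∧
      ENNReal.ofReal (l / 2 / 7 ^ d) ≤ ∑' q : u, (open Classical in if dist x q.1.1 ≤ 5 * ρ ∧ q.1.2 ≤ ρ then
        ENNReal.ofReal ((q.1.2 / ρ) ^ d) else 0)} with hN1
  set N2 := {x | x ∉ (⋃ p ∈ B, ball p.1 p.2) ∧ ∃ p ∈ B, x ∈ ball p.1 (p.2 + h) ∧ 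
      ∃ q ∈ u, q.2 ≤ p.2 ∧ dist x q.1 ≤ 5 * q.2} with hN2
  set N3 := {x | x ∉ (⋃ p ∈ B, ball p.1 p.2) ∧ ∃ p ∈ B, 0 < p.2 ∧ x ∈ ball p.1 (p.2 + h) ∧ 
      ∃ q ∈ u, p.2 ≤ q.2 ∧ dist x q.1 ≤ q.2 + 4 * p.2 ∧ q.2 ≤ dist x q.1 ∧ δ * q.2 ≤ 4 * p.2} with hN3
  have hk : 0 < l / 2 / 7 ^ d := by positivity
  have b1 : volume N1 ≤ ENNReal.ofReal ((l / 2 / 7 ^ d) ^ (1 - 1 / (2 * d : ℝ)))⁻¹ * (ENNReal.ofReal (C1 d * h) * S) :=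
    inv_help (by positivity) (K1 hd B u huc hup hh hk N1 (fun x hx => hx))
  have b2 : volume N2 ≤ ENNReal.ofReal (C2 d * h) * S := K2 hd B u huc hup hh N2 (fun x hx => hx)
  have b3 : volume N3 ≤ ENNReal.ofReal (C3 d * (8 / δ) ^ (1 / (2 * d : ℝ)) * h) * S := K3 hd B u huc hup hh hδ0 N3 (fun x hx => hx)
  have hC1 : 0 < C1 d := by unfold C1; positivity
  have hC2 : 0 < C2 d := by unfold C2; positivity
  have hC3 : 0 < C3 d := by unfold C3; positivity
  have hsub : volume (K ∩ (Eᶜ ∩ Ann B h)) ≤ volume (N1 ∪ N2 ∪ N3) := by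
    refine measure_mono_ae ?_
    filter_upwards [hae] with x hx hxN
    obtain ⟨hxU, p, hp, hp0, hxp, h | h | h⟩ := hx hxN
    · exact Or.inl (Or.inl ⟨hxU, p, hp, hxp, h⟩)
    · exact Or.inl (Or.inr ⟨hxU, p, hp, hxp, h⟩)
    · exact Or.inr ⟨hxU, p, hp, hp0, hxp, h⟩
  set A := l ^ (-(1 - 1 / (2 * d : ℝ))) with hA
  set Bq := (1 - l) ^ (-(1 / (2 * d : ℝ))) with hBq
  set Bs := (1 - l) ^ (-(1 - 1 / (d : ℝ))) with hBs
  have hBB : Bq * Bs = (1 - l) ^ (-(1 - 1 / (2 * d : ℝ))) := by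
    rw [hBq, hBs, ← Real.rpow_add hl1]; congr 1; field_simp; ring
  have hd2 : 1 / (2 * d : ℝ) ≤ 1 := by rw [div_le_one (by positivity)]; linarith
  have hd3 : 1 / (d : ℝ) ≤ 1 := by rw [div_le_one (by positivity)]; linarith
  have hA1 : 1 ≤ A := Real.one_le_rpow_of_pos_of_le_one_of_nonpos h0 h1.le (by linarith)
  have hBq1 : 1 ≤ Bq := Real.one_le_rpow_of_pos_of_le_one_of_nonpos hl1 (by linarith) (by
    have : 0 ≤ 1 / (2 * d : ℝ) := by positivity
    linarith)
  have hBs0 : 0 < Bs := by positivity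
  have up : ∀ {a q : ℝ}, 1 ≤ a → 0 ≤ q → q ≤ 1 → a ^ q ≤ a := fun {a q} ha hq hq1 => by
    calc a ^ q ≤ a ^ (1:ℝ) := Real.rpow_le_rpow_of_exponent_le ha hq1
      _ = a := by simp
  have r1 : ((l / 2 / 7 ^ d) ^ (1 - 1 / (2 * d : ℝ)))⁻¹ ≤ (2 * 7 ^ d) * A := by
    have e : l / 2 / 7 ^ d = l * (2 * 7 ^ d)⁻¹ := by field_simp
    rw [e, ← Real.rpow_neg (by positivity), Real.mul_rpow h0.le (by positivity), ← hA, mul_comm,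
      Real.inv_rpow (by positivity), ← Real.rpow_neg (by positivity), neg_neg]
    gcongr
    refine up ?_ (by linarith) ?_
    · have : (1:ℝ) ≤ 7 ^ d := one_le_pow₀ (by norm_num)
      linarith
    · have : 0 ≤ 1 / (2 * d : ℝ) := by positivity
      linarith
  have r3 : (8 / δ) ^ (1 / (2 * d : ℝ)) ≤ (32 * d) * Bq := by
    have e : 8 / δ = (32 * d) * (1 - l)⁻¹ := by rw [hδ]; field_simp; norm_num
    rw [e, Real.mul_rpow (by positivity) (by positivity), Real.inv_rpow hl1.le, ← Real.rpow_neg hl1.le]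
    gcongr
    exact up (by linarith) (by positivity) hd2
  have rs : (om d * ((1 - l) / 2) ^ (1 - 1 / (d:ℝ)))⁻¹ ≤ 2 / om d * Bs := by
    rw [mul_inv, div_eq_mul_inv (1 - l), Real.mul_rpow hl1.le (by positivity), mul_inv, ← Real.rpow_neg hl1.le, ← hBs,
      Real.inv_rpow (by positivity), inv_inv]
    have : (2:ℝ) ^ (1 - 1 / (d:ℝ)) ≤ 2 := up (by norm_num) (by linarith) (by
      have : 0 ≤ 1 / (d : ℝ) := by positivity
      linarith)
    calc (om d)⁻¹ * (Bs * 2 ^ (1 - 1 / (d:ℝ))) ≤ (om d)⁻¹ * (Bs * 2) := by gcongr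
      _ = _ := by field_simp
  calc volume (K ∩ (Eᶜ ∩ Ann B h)) ≤ volume (N1 ∪ N2 ∪ N3) := hsub
    _ ≤ volume N1 + volume N2 + volume N3 := (measure_union_le _ _).trans (add_le_add (measure_union_le _ _) le_rfl)
    _ ≤ ENNReal.ofReal ((2 * 7 ^ d) * A) * (ENNReal.ofReal (C1 d * h) * S) + ENNReal.ofReal (C2 d * h) * S
        + ENNReal.ofReal (C3 d * ((32 * d) * Bq) * h) * S := by
      refine add_le_add (add_le_add (b1.trans ?_) b2) (b3.trans ?_)
      · gcongr
      · gcongr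
    _ = ENNReal.ofReal (((2 * 7 ^ d) * A * C1 d + C2 d + C3 d * ((32 * d) * Bq)) * h) * S := by
      rw [← mul_assoc, ← ENNReal.ofReal_mul (by positivity), ← add_mul, ← add_mul, ← ENNReal.ofReal_add (by positivity) (by positivity),
        ← ENNReal.ofReal_add (by positivity) (by positivity)]
      congr 2; ring
    _ ≤ ENNReal.ofReal (((2 * 7 ^ d) * A * C1 d + C2 d + C3 d * ((32 * d) * Bq)) * h) * (ENNReal.ofReal (2 / om d * Bs) * 
          (11 ^ d * 2 ^ (d + 4) * Per Ω E)) := by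
      gcongr
      refine hSb.trans ?_
      gcongr
    _ = ENNReal.ofReal ((((2 * 7 ^ d) * A * C1 d + C2 d + C3 d * ((32 * d) * Bq)) * h) * (2 / om d * Bs) * (11 ^ d * 2 ^ (d + 4))) * Per Ω E := by
      rw [ofReal3 (by positivity) (by positivity)]
      have : ENNReal.ofReal (11 ^ d * 2 ^ (d + 4)) = 11 ^ d * 2 ^ (d + 4) := by
        rw [ENNReal.ofReal_mul (by positivity), ENNReal.ofReal_pow (by norm_num), ENNReal.ofReal_pow (by norm_num)]
        norm_num
      rw [this]; ring
    _ ≤ _ := by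
      refine mul_le_mul' (ENNReal.ofReal_le_ofReal ?_) le_rfl
      rw [← hBB]
      have e : ((2 * 7 ^ d) * A * C1 d + C2 d + C3 d * ((32 * d) * Bq)) ≤ (C1 d * (2 * 7 ^ d) + C2 d + C3 d * (32 * d)) * (A * Bq) := by
        have q1 : A ≤ A * Bq := le_mul_of_one_le_right (by linarith) hBq1
        have q2 : Bq ≤ A * Bq := le_mul_of_one_le_left (by linarith) hA1
        have q3 : 1 ≤ A * Bq := by nlinarith
        have := mul_le_mul_of_nonneg_left q1 (by positivity : 0 ≤ C1 d * (2 * 7 ^ d))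
        have := mul_le_mul_of_nonneg_left q2 (by positivity : 0 ≤ C3 d * (32 * d))
        have := mul_le_mul_of_nonneg_left q3 hC2.le
        nlinarith
      calc _ ≤ (C1 d * (2 * 7 ^ d) + C2 d + C3 d * (32 * d)) * (A * Bq) * h * (2 / om d * Bs) * (11 ^ d * 2 ^ (d + 4)) := by
            gcongr
        _ = _ := by unfold Ck; ring

theorem divg_bdd {d : ℕ} {Ω : Set (Vd d)} {φ : Vd d → Vd d} (hφ : IsTest Ω φ) : ∃ M, 0 ≤ M ∧ ∀ x, |divg φ x| ≤ M := by
  obtain ⟨C, hC⟩ := (divg_cs hφ.cs).exists_bound_of_continuous (divg_continuous hφ.cd)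
  exact ⟨C, (norm_nonneg _).trans (hC 0), hC⟩

theorem LU' {d : ℕ} {E U O Ω : Set (Vd d)} (hE : MeasurableSet E) (hU : IsOpen U) {h : ℝ} (hh : 0 < h)
    {φ : Vd d → Vd d} (hφ : IsTest Ω φ) (hO : tsupport φ \ U ⊆ O) {M : ℝ} (hM0 : 0 ≤ M) (hM : ∀ x, |divg φ x| ≤ M) :
    ENNReal.ofReal (∫ x in E ∪ U, divg φ x) ≤ Per O E +
      ENNReal.ofReal (3 / h + M) * volume (tsupport φ ∩ (Eᶜ ∩ (thickening h U \ U))) := by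
  obtain ⟨w, hwm, hw, hle⟩ := LU hE hU hh hφ hO
  set D := Eᶜ ∩ (thickening h U \ U) with hD
  have hDm : MeasurableSet D := hE.compl.inter (isOpen_thickening.measurableSet.diff hU.measurableSet)
  have hKm : MeasurableSet (tsupport φ) := (isClosed_tsupport φ).measurableSet
  have hfin : volume (tsupport φ ∩ D) ≠ ⊤ :=
    ((measure_mono inter_subset_left).trans_lt hφ.cs.isCompact.measure_lt_top).ne
  have hEU : MeasurableSet (E ∪ U) := hE.union hU.measurableSet
  have hdi := divg_integrable hφ.cd hφ.cs
  have i1 : Integrable (fun x => (E ∪ U).indicator (fun _ => (1:ℝ)) x * divg φ x) := by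
    refine hdi.bdd_mul (c := 1) (measurable_const.indicator hEU).aestronglyMeasurable (ae_of_all _ fun x => ?_)
    by_cases hx : x ∈ E ∪ U <;> simp [hx]
  have hg : Integrable ((tsupport φ ∩ D).indicator (fun _ => M)) :=
    (integrable_indicator_iff (hKm.inter hDm)).2 (integrableOn_const hfin)
  have hpt : ∀ x, ‖(w x - (E ∪ U).indicator (fun _ => (1:ℝ)) x) * divg φ x‖ ≤ (tsupport φ ∩ D).indicator (fun _ => M) x := by
    intro x
    rw [norm_mul, Real.norm_eq_abs, Real.norm_eq_abs]
    by_cases hx : x ∈ tsupport φ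
    · have := hw x
      by_cases hxD : x ∈ D
      · rw [indicator_of_mem (show x ∈ tsupport φ ∩ D from ⟨hx, hxD⟩)]
        rw [indicator_of_mem hxD] at this
        calc _ ≤ 1 * M := by gcongr; exact hM x
          _ = M := one_mul _
      · rw [indicator_of_notMem hxD] at this
        rw [indicator_of_notMem (show x ∉ tsupport φ ∩ D from fun h => hxD h.2), le_antisymm this (abs_nonneg _), zero_mul]
    · rw [divg_zero_of hx, abs_zero, mul_zero]
      exact indicator_nonneg (fun _ _ => hM0) x
  have i2 : Integrable (fun x => (w x - (E ∪ U).indicator (fun _ => (1:ℝ)) x) * divg φ x) := by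
    refine hg.mono' ?_ (ae_of_all _ hpt)
    exact ((hwm.sub (measurable_const.indicator hEU)).mul (divg_continuous hφ.cd).measurable).aestronglyMeasurable
  have hb := norm_integral_le_of_norm_le hg (ae_of_all _ hpt)
  rw [integral_indicator (hKm.inter hDm), setIntegral_const, smul_eq_mul] at hb
  have hsum : ∫ x, w x * divg φ x = (∫ x in E ∪ U, divg φ x) + ∫ x, (w x - (E ∪ U).indicator (fun _ => (1:ℝ)) x) * divg φ x := by
    rw [← ind_mul hEU, ← integral_add i1 i2]
    congr 1; ext x; ring
  have h1 : ∫ x in E ∪ U, divg φ x ≤ (∫ x, w x * divg φ x) + M * volume.real (tsupport φ ∩ D) := by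
    have := (abs_le.1 hb).1
    linarith
  calc _ ≤ ENNReal.ofReal ((∫ x, w x * divg φ x) + M * volume.real (tsupport φ ∩ D)) := ENNReal.ofReal_le_ofReal h1
    _ ≤ ENNReal.ofReal (∫ x, w x * divg φ x) + ENNReal.ofReal (M * volume.real (tsupport φ ∩ D)) := ENNReal.ofReal_add_le
    _ ≤ (Per O E + ENNReal.ofReal (3 / h) * volume (tsupport φ ∩ D)) + ENNReal.ofReal M * volume (tsupport φ ∩ D) := by
      refine add_le_add hle ?_
      rw [ENNReal.ofReal_mul hM0, ofReal_measureReal hfin]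
    _ = _ := by rw [add_assoc, ← add_mul, ENNReal.ofReal_add (by positivity) hM0]

/-- level set -/
def Lev {d : ℕ} (Ω E : Set (Vd d)) (l : ℝ) : Set (Vd d) :=
  ⋃ p ∈ {p : Vd d × ℝ | 0 < p.2 ∧ ball p.1 p.2 ⊆ Ω ∧ l * (p.2 ^ d * om d) < volume.real (E ∩ ball p.1 p.2)}, ball p.1 p.2

theorem Lev_open {d : ℕ} (Ω E : Set (Vd d)) (l : ℝ) : IsOpen (Lev Ω E l) := isOpen_biUnion fun _ _ => isOpen_ball

theorem Lev_ae {d : ℕ} {Ω E : Set (Vd d)} (hΩ : IsOpen Ω) (hE : MeasurableSet E) {l : ℝ} (h1 : l < 1) :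
    ∀ᵐ x, x ∈ E → x ∈ Ω → x ∈ Lev Ω E l := by
  have hom := om_pos d
  filter_upwards [path hE] with x hx hxE hxΩ
  obtain ⟨r, hr, hrΩ⟩ := Metric.isOpen_iff.1 hΩ x hxΩ
  by_cases hc : l * (r ^ d * om d) < volume.real (E ∩ ball x r)
  · exact mem_biUnion (show ((x, r) : Vd d × ℝ) ∈ _ from ⟨hr, hrΩ, hc⟩) (mem_ball_self hr)
  · push Not at hc
    obtain ⟨t, ht, h⟩ := hx hxE x r ((1 + l) / 2) hr (by rw [dist_self]; positivity) (by linarith)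
      (hc.trans (by gcongr; linarith))
    simp only [sub_self, smul_zero, add_zero] at h
    have ht0 := ht.1
    have htr : 0 < t * r := by positivity
    refine mem_biUnion (show ((x, t * r) : Vd d × ℝ) ∈ _ from ⟨htr, ?_, ?_⟩) (mem_ball_self htr)
    · exact (ball_subset_ball (by nlinarith [ht.2])).trans hrΩ
    · simp only
      rw [h]
      have : 0 < (t * r) ^ d * om d := by positivity
      gcongr; linarith

noncomputable def Lam (d : ℕ) (l : ℝ) : ℝ := l ^ (-(1 - 1 / (2 * d : ℝ))) * (1 - l) ^ (-(1 - 1 / (2 * d : ℝ)))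

theorem Ck_pos {d : ℕ} (hd : 1 ≤ d) : 0 < Ck d := by
  have hom := om_pos d
  have hd1 : (1:ℝ) ≤ d := by exact_mod_cast hd
  have hg1 := geoC_pos (q := 1 / 2) (by norm_num)
  have hg2 := geoC_pos (q := 1 / (2 * d)) (by positivity)
  unfold Ck C1 C2 C3; positivity

theorem A1 {d : ℕ} (hd : 1 ≤ d) {Ω E : Set (Vd d)} (hΩ : IsOpen Ω) (hE : MeasurableSet E) (hP : Per Ω E ≠ ⊤) {l : ℝ}
    (h0 : 0 < l) (h1 : l < 1) {φ : Vd d → Vd d} (hφ : IsTest Ω φ) :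
    ENNReal.ofReal (∫ x in Lev Ω E l, divg φ x) ≤ ENNReal.ofReal (1 + 3 * Ck d * Lam d l) * Per Ω E := by
  have hom := om_pos d
  have hd1 : (1:ℝ) ≤ d := by exact_mod_cast hd
  have hl1 : 0 < 1 - l := by linarith
  have hCk := Ck_pos hd
  have hL : 0 < Lam d l := by unfold Lam; positivity
  obtain ⟨M, hM0, hM⟩ := divg_bdd hφ
  obtain ⟨η, hη, hηΩ⟩ := hφ.cs.isCompact.exists_thickening_subset_open hΩ hφ.ts
  have hK : ∀ x ∈ tsupport φ, ball x η ⊆ Ω := fun x hx => (ball_subset_thickening hx η).trans hηΩ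
  set s : ℕ → ℝ := fun n => 1 / ((n:ℝ) + 1) with hs
  have hs0 : ∀ n, 0 < s n := fun n => by simp only [hs]; positivity
  set h : ℕ → ℝ := fun n => min (s n) (η * l / (12 * d)) with hh
  have hh0 : ∀ n, 0 < h n := fun n => lt_min (hs0 n) (by positivity)
  set B : ℕ → Set (Vd d × ℝ) := fun n => Fam Ω E l (s n) (n + 1) with hB
  set U : ℕ → Set (Vd d) := fun n => ⋃ p ∈ B n, ball p.1 p.2 with hU
  have hUo : ∀ n, IsOpen (U n) := fun n => isOpen_biUnion fun _ _ => isOpen_ball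
  have hsanti : ∀ m n, m ≤ n → s n ≤ s m := fun m n hmn => by
    simp only [hs]
    have : (m:ℝ) ≤ n := by exact_mod_cast hmn
    gcongr
  have hUmono : Monotone U := by
    intro m n hmn
    refine biUnion_subset_biUnion_left fun p hp => ?_
    have : (m:ℝ) ≤ n := by exact_mod_cast hmn
    exact ⟨(hsanti m n hmn).trans hp.1, hp.2.1.trans (by linarith), hp.2.2⟩
  have hUU : ⋃ n, (E ∪ U n) = E ∪ Lev Ω E l := by
    rw [← union_iUnion]
    congr 1
    apply Subset.antisymm
    · refine iUnion_subset fun n => ?_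
      exact biUnion_subset_biUnion_left fun p hp => ⟨(hs0 n).trans_le hp.1, hp.2.2⟩
    · intro x hx
      simp only [Lev, mem_iUnion, exists_prop] at hx
      obtain ⟨p, hp, hxp⟩ := hx
      obtain ⟨n1, hn1⟩ := exists_nat_one_div_lt hp.1
      obtain ⟨n2, hn2⟩ := exists_nat_ge p.2
      refine mem_iUnion.2 ⟨max n1 n2, mem_biUnion (show p ∈ B (max n1 n2) from ⟨?_, ?_, hp.2⟩) hxp⟩
      · exact (hsanti _ _ (le_max_left n1 n2)).trans hn1.le
      · have : (n2:ℝ) ≤ (max n1 n2 : ℕ) := by exact_mod_cast le_max_right n1 n2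
        linarith
  have hth : ∀ n, thickening (h n) (U n) \ U n ⊆ Ann (B n) (h n) := by
    rintro n x ⟨hx1, hx2⟩
    refine ⟨?_, hx2⟩
    obtain ⟨y, hy, hxy⟩ := mem_thickening_iff.1 hx1
    simp only [hU, mem_iUnion, exists_prop] at hy
    obtain ⟨p, hp, hyp⟩ := hy
    refine mem_biUnion hp ?_
    rw [mem_ball] at hyp ⊢
    linarith [dist_triangle x y p.1]
  have hstep : ∀ n, ENNReal.ofReal (∫ x in E ∪ U n, divg φ x) ≤
      ENNReal.ofReal (1 + 3 * Ck d * Lam d l + M * Ck d * Lam d l * h n) * Per Ω E := by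
    intro n
    refine (LU' hE (hUo n) (hh0 n) hφ (O := Ω) (diff_subset.trans hφ.ts) hM0 hM).trans ?_
    have hk := key (R := (n:ℝ) + 1) hd hE h0 h1 (hs0 n) hK (hh0 n) (min_le_left _ _) (min_le_right _ _)
    have := hh0 n
    calc _ ≤ Per Ω E + ENNReal.ofReal (3 / h n + M) * (ENNReal.ofReal (Ck d * Lam d l * h n) * Per Ω E) := by
          gcongr
          refine le_trans (measure_mono ?_) hk
          exact inter_subset_inter_right _ (inter_subset_inter_right _ (hth n))
      _ = _ := by
          rw [← mul_assoc, ← ENNReal.ofReal_mul (by positivity)]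
          nth_rewrite 1 [← one_mul (Per Ω E)]
          rw [← add_mul, ← ENNReal.ofReal_one, ← ENNReal.ofReal_add (by norm_num) (by positivity)]
          congr 2
          field_simp; ring
  have hh_t : Tendsto h atTop (nhds 0) := by
    refine squeeze_zero (fun n => (hh0 n).le) (fun n => min_le_left _ _) tendsto_one_div_add_atTop_nhds_zero_nat
  have hdi := divg_integrable hφ.cd hφ.cs
  have t1 := tendsto_setIntegral_of_monotone (μ := volume) (s := fun n => E ∪ U n) (f := divg φ)
    (fun n => hE.union (hUo n).measurableSet) (fun m n hmn => union_subset_union_right _ (hUmono hmn)) hdi.integrableOn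
  rw [hUU] at t1
  have e : ∫ x in E ∪ Lev Ω E l, divg φ x = ∫ x in Lev Ω E l, divg φ x := by
    rw [← ind_mul (hE.union (Lev_open Ω E l).measurableSet), ← ind_mul (Lev_open Ω E l).measurableSet]
    apply integral_congr_ae
    filter_upwards [Lev_ae hΩ hE h1] with x hx
    by_cases hxΩ : x ∈ Ω
    · by_cases hxE : x ∈ E
      · simp [hx hxE hxΩ]
      · by_cases hxL : x ∈ Lev Ω E l <;> simp [hxL, hxE]
    · rw [divg_zero_of (fun h => hxΩ (hφ.ts h)), mul_zero, mul_zero]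
  rw [e] at t1
  have t2 : Tendsto (fun n => ENNReal.ofReal (1 + 3 * Ck d * Lam d l + M * Ck d * Lam d l * h n) * Per Ω E) atTop
      (nhds (ENNReal.ofReal (1 + 3 * Ck d * Lam d l) * Per Ω E)) := by
    refine ENNReal.Tendsto.mul_const ?_ (Or.inr hP)
    refine ENNReal.tendsto_ofReal ?_
    have := (hh_t.const_mul (M * Ck d * Lam d l)).const_add (1 + 3 * Ck d * Lam d l)
    simpa using this
  exact le_of_tendsto_of_tendsto' (ENNReal.tendsto_ofReal t1) t2 hstep

theorem uncMax_le_one {d : ℕ} (Ω E : Set (Vd d)) (x : Vd d) : uncMax Ω E x ≤ 1 := by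
  unfold uncMax
  refine iSup_le fun z => iSup_le fun r => iSup_le fun _ => iSup_le fun _ => ?_
  refine ENNReal.div_le_of_le_mul ?_
  rw [one_mul]; exact measure_mono inter_subset_right

theorem lt_uncMax {d : ℕ} {Ω E : Set (Vd d)} {l : ℝ} (h0 : 0 ≤ l) (x : Vd d) :
    l < (uncMax Ω E x).toReal ↔ x ∈ Lev Ω E l := by
  rw [← ENNReal.ofReal_lt_iff_lt_toReal h0 ((uncMax_le_one Ω E x).trans_lt ENNReal.one_lt_top).ne]
  have hom := om_pos d
  have key : ∀ (z : Vd d) (r : ℝ), 0 < r → (ENNReal.ofReal l < volume (E ∩ ball z r) / volume (ball z r) ↔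
      l * (r ^ d * om d) < volume.real (E ∩ ball z r)) := by
    intro z r hr
    rw [ENNReal.lt_div_iff_mul_lt (Or.inl (measure_ball_pos _ _ hr).ne') (Or.inl measure_ball_lt_top.ne),
      vol_ball z hr, ← ENNReal.ofReal_mul h0, Measure.real,
      ENNReal.ofReal_lt_iff_lt_toReal (by positivity) (ball_inter_ne_top E z r)]
  simp only [uncMax, lt_iSup_iff, Lev, mem_iUnion, exists_prop, Prod.exists, mem_ofPred_eq]
  constructor
  · rintro ⟨z, r, hx, hB, h⟩
    have hr := pos_of_mem_ball hx
    exact ⟨z, r, ⟨hr, hB, (key z r hr).1 h⟩, hx⟩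
  · rintro ⟨z, r, ⟨hr, hB, h⟩, hx⟩
    exact ⟨z, r, hx, hB, (key z r hr).2 h⟩

theorem uncMax_meas {d : ℕ} (Ω E : Set (Vd d)) : Measurable (fun x => (uncMax Ω E x).toReal) := by
  refine measurable_of_Ioi fun l => ?_
  rcases le_or_gt 0 l with h | h
  · have : (fun x => (uncMax Ω E x).toReal) ⁻¹' Ioi l = Lev Ω E l := by
      ext x; exact lt_uncMax h x
    rw [this]; exact (Lev_open Ω E l).measurableSet
  · have : (fun x => (uncMax Ω E x).toReal) ⁻¹' Ioi l = univ := by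
      ext x; simpa using h.trans_le ENNReal.toReal_nonneg
    rw [this]; exact MeasurableSet.univ

theorem ofReal_integral_le {α : Type*} [MeasurableSpace α] {μ : Measure α} {G : α → ℝ} (hG : Integrable G μ) :
    ENNReal.ofReal (∫ x, G x ∂μ) ≤ ∫⁻ x, ENNReal.ofReal (G x) ∂μ := by
  have h1 : ∫ x, G x ∂μ ≤ ∫ x, max (G x) 0 ∂μ := integral_mono hG hG.pos_part (fun x => le_max_left _ _)
  refine (ENNReal.ofReal_le_ofReal h1).trans ?_
  rw [ofReal_integral_eq_lintegral_ofReal hG.pos_part (ae_of_all _ fun x => le_max_right _ _)]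
  refine lintegral_mono fun x => ?_
  simp

noncomputable def CA (d : ℕ) : ℝ≥0∞ := ∫⁻ l in Ioo (0:ℝ) 1, ENNReal.ofReal (1 + 3 * Ck d * Lam d l)

theorem CA_ge {d : ℕ} (hd : 1 ≤ d) : 1 ≤ CA d := by
  have hCk := Ck_pos hd
  calc (1:ℝ≥0∞) = ∫⁻ l in Ioo (0:ℝ) 1, 1 := by simp
    _ ≤ CA d := by
      unfold CA
      refine setLIntegral_mono' measurableSet_Ioo fun l hl => ?_
      rw [← ENNReal.ofReal_one]
      refine ENNReal.ofReal_le_ofReal ?_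
      have h1 := hl.1
      have h2 : 0 < 1 - l := by linarith [hl.2]
      have : 0 ≤ 3 * Ck d * Lam d l := by unfold Lam; positivity
      linarith

theorem CA_ne_top {d : ℕ} (hd : 1 ≤ d) : CA d ≠ ⊤ := by
  have hCk := Ck_pos hd
  have hd1 : (1:ℝ) ≤ d := by exact_mod_cast hd
  set p : ℝ := -(1 - 1 / (2 * d : ℝ)) with hp
  have hp1 : -1 < p := by have : 0 < 1 / (2 * d : ℝ) := by positivity
                          rw [hp]; linarith
  have hp0 : p ≤ 0 := by
    have : 1 / (2 * d : ℝ) ≤ 1 := by rw [div_le_one (by positivity)]; linarith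
    rw [hp]; linarith
  have i1 : IntervalIntegrable (fun x : ℝ => x ^ p) volume 0 1 := intervalIntegral.intervalIntegrable_rpow' hp1
  have i2 : IntervalIntegrable (fun x : ℝ => (1 - x) ^ p) volume 0 1 := by
    have := i1.symm.comp_sub_left 1
    simpa using this
  have i3 : IntegrableOn (fun l : ℝ => 1 + 3 * Ck d * (2 * (l ^ p + (1 - l) ^ p))) (Ioo 0 1) := by
    have := ((i1.add i2).const_mul 2).const_mul (3 * Ck d)
    have h2 := (intervalIntegrable_const (c := (1:ℝ)) (μ := volume) (a := 0) (b := 1)).add this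
    rw [intervalIntegrable_iff_integrableOn_Ioo_of_le zero_le_one] at h2
    exact h2
  have hb : ∀ l ∈ Ioo (0:ℝ) 1, Lam d l ≤ 2 * (l ^ p + (1 - l) ^ p) := by
    intro l hl
    have h1 := hl.1
    have h2 : 0 < 1 - l := by linarith [hl.2]
    have half : ∀ y : ℝ, 1 / 2 ≤ y → y ^ p ≤ 2 := by
      intro y hy
      calc y ^ p ≤ (1 / 2 : ℝ) ^ p := Real.rpow_le_rpow_of_nonpos (by norm_num) hy hp0
        _ ≤ (1 / 2 : ℝ) ^ (-1 : ℝ) := Real.rpow_le_rpow_of_exponent_ge (by norm_num) (by norm_num) hp1.le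
        _ = 2 := by rw [Real.rpow_neg_one]; norm_num
    have q1 : 0 < l ^ p := by positivity
    have q2 : 0 < (1 - l) ^ p := by positivity
    have e : Lam d l = l ^ p * (1 - l) ^ p := rfl
    rw [e]
    rcases le_total (1 / 2) l with h | h
    · have := half l h
      nlinarith
    · have := half (1 - l) (by linarith)
      nlinarith
  have := i3.lintegral_lt_top
  refine ((setLIntegral_mono' measurableSet_Ioo fun l hl => ?_).trans_lt this).ne
  refine ENNReal.ofReal_le_ofReal ?_
  have := hb l hl
  gcongr

theorem thmA {d : ℕ} (hd : 1 ≤ d) {Ω E : Set (Vd d)} (hΩ : IsOpen Ω) (hE : MeasurableSet E) :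
    var Ω (fun x => (uncMax Ω E x).toReal) ≤ CA d * Per Ω E := by
  by_cases hP : Per Ω E = ⊤
  · rw [hP, ENNReal.mul_top (zero_lt_one.trans_le (CA_ge hd)).ne']; exact le_top
  refine var_le fun φ hφ => ?_
  set M : Vd d → ℝ := fun x => (uncMax Ω E x).toReal with hM
  have hMm : Measurable M := uncMax_meas Ω E
  have hM1 : ∀ x, M x ≤ 1 := fun x => by
    have := ENNReal.toReal_mono ENNReal.one_ne_top (uncMax_le_one Ω E x)
    simpa using this
  have hM0 : ∀ x, 0 ≤ M x := fun x => ENNReal.toReal_nonneg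
  have hdi := divg_integrable hφ.cd hφ.cs
  set ν : Measure ℝ := volume.restrict (Ioo (0:ℝ) 1) with hν
  haveI : IsFiniteMeasure ν := ⟨by simp [hν]⟩
  set S : Set (Vd d × ℝ) := {q | q.2 < M q.1} with hS
  have hSm : MeasurableSet S := measurableSet_lt measurable_snd (hMm.comp measurable_fst)
  set f : Vd d → ℝ → ℝ := fun x l => S.indicator (fun q => divg φ q.1) (x, l) with hf
  have hfi : Integrable (Function.uncurry f) (volume.prod ν) := by
    have : Integrable (fun q : Vd d × ℝ => divg φ q.1) (volume.prod ν) := hdi.comp_fst ν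
    exact this.indicator hSm
  have hsw := integral_integral_swap hfi
  have e1 : ∀ x, ∫ l, f x l ∂ν = M x * divg φ x := by
    intro x
    have : ∀ l, f x l = (Iio (M x)).indicator (fun _ => divg φ x) l := by
      intro l
      by_cases h : l < M x <;> simp [hf, hS, indicator, h]
    simp only [this]
    rw [integral_indicator measurableSet_Iio, setIntegral_const, smul_eq_mul, hν, measureReal_restrict_apply measurableSet_Iio]
    congr 1
    have : Iio (M x) ∩ Ioo 0 1 = Ioo 0 (M x) := by
      ext l; simp only [mem_inter_iff, mem_Iio, mem_Ioo]
      constructor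
      · rintro ⟨a, b, c⟩; exact ⟨b, a⟩
      · rintro ⟨a, b⟩; exact ⟨b, a, b.trans_le (hM1 x)⟩
    rw [this]
    simp [hM0 x]
  have e2 : ∀ l ∈ Ioo (0:ℝ) 1, ∫ x, f x l = ∫ x in Lev Ω E l, divg φ x := by
    intro l hl
    rw [← integral_indicator (Lev_open Ω E l).measurableSet]
    congr 1; ext x
    have := lt_uncMax (Ω := Ω) (E := E) hl.1.le x
    by_cases h : l < M x
    · rw [indicator_of_mem (this.1 h)]; simp [hf, hS, indicator, h]
    · rw [indicator_of_notMem (fun h' => h (this.2 h'))]; simp [hf, hS, indicator, h]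
  simp only [e1] at hsw
  rw [hsw]
  have hGi : Integrable (fun l => ∫ x, f x l) ν := hfi.integral_prod_right
  refine (ofReal_integral_le hGi).trans ?_
  unfold CA
  rw [← lintegral_mul_const' _ _ hP]
  refine setLIntegral_mono' measurableSet_Ioo fun l hl => ?_
  rw [e2 l hl]
  exact A1 hd hΩ hE hP hl.1 hl.2 hφ

theorem LU2 {d : ℕ} {E U O Ω : Set (Vd d)} (hE : MeasurableSet E) (hU : IsOpen U) {h : ℝ} (hh : 0 < h)
    {φ : Vd d → Vd d} (hφ : IsTest Ω φ) (hO : tsupport φ \ U ⊆ O) {M : ℝ} (hM0 : 0 ≤ M) (hM : ∀ x, |divg φ x| ≤ M)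
    (hfin : volume (Eᶜ ∩ U) ≠ ⊤) :
    ENNReal.ofReal (∫ x in E, divg φ x) ≤ Per O E +
      ENNReal.ofReal (3 / h + M) * volume (Eᶜ ∩ (thickening h U \ U)) + ENNReal.ofReal M * volume (Eᶜ ∩ U) := by
  have h1 := LU' hE hU hh hφ hO hM0 hM
  have hdi := divg_integrable hφ.cd hφ.cs
  have e : ∫ x in E ∪ U, divg φ x = (∫ x in E, divg φ x) + ∫ x in Eᶜ ∩ U, divg φ x := by
    rw [← setIntegral_union (disjoint_left.2 fun x hx hx' => hx'.1 hx) (hE.compl.inter hU.measurableSet)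
      hdi.integrableOn hdi.integrableOn]
    congr 2
    ext x; by_cases hx : x ∈ E <;> simp [hx]
  have hb : ‖∫ x in Eᶜ ∩ U, divg φ x‖ ≤ M * volume.real (Eᶜ ∩ U) :=
    norm_setIntegral_le_of_norm_le_const hfin.lt_top (fun x _ => hM x)
  have h2 : ∫ x in E, divg φ x ≤ (∫ x in E ∪ U, divg φ x) + M * volume.real (Eᶜ ∩ U) := by
    have := (abs_le.1 hb).1
    linarith
  calc _ ≤ ENNReal.ofReal ((∫ x in E ∪ U, divg φ x) + M * volume.real (Eᶜ ∩ U)) := ENNReal.ofReal_le_ofReal h2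
    _ ≤ ENNReal.ofReal (∫ x in E ∪ U, divg φ x) + ENNReal.ofReal (M * volume.real (Eᶜ ∩ U)) := ENNReal.ofReal_add_le
    _ ≤ _ := by
      refine add_le_add (h1.trans ?_) ?_
      · exact add_le_add le_rfl (mul_le_mul' le_rfl (measure_mono inter_subset_right))
      · rw [ENNReal.ofReal_mul hM0, ofReal_measureReal hfin]

noncomputable def th (d : ℕ) : ℝ := 1 / (24 * (11 ^ d * 2 ^ (d + 3)))

theorem th_pos (d : ℕ) : 0 < th d := by unfold th; positivity

/-- points of small density of `E` at all scales up to `s` -/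
def Gs {d : ℕ} (Ω E : Set (Vd d)) (s : ℝ) : Set (Vd d) :=
  {x | ball x s ⊆ Ω ∧ ∀ r, 0 < r → r ≤ s → volume.real (E ∩ ball x r) ≤ (1/2) * th d ^ d * (r ^ d * om d)}

theorem th_le (d : ℕ) : th d ≤ 1 := by
  unfold th
  rw [div_le_one (by positivity)]
  have : (1:ℝ) ≤ 11 ^ d := one_le_pow₀ (by norm_num)
  have : (1:ℝ) ≤ 2 ^ (d + 3) := one_le_pow₀ (by norm_num)
  nlinarith

theorem Gs_vol {d : ℕ} (hd : 1 ≤ d) {Ω E : Set (Vd d)} (hE : MeasurableSet E) {s r : ℝ} (hr : 0 < r) (hrs : r ≤ s) :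
    volume (E ∩ thickening r (Gs Ω E s)) ≤ ENNReal.ofReal (r / 24) * Per (thickening r (Gs Ω E s)) E := by
  have hom := om_pos d
  have hth := th_pos d
  have hd0 : d ≠ 0 := by omega
  have hk1 : (1/2) * th d ^ d ≤ (1/2:ℝ) := by
    have : th d ^ d ≤ 1 := pow_le_one₀ hth.le (th_le d)
    linarith
  have key := cover_a hd (A := E) (D := thickening r (Gs Ω E s)) (W := thickening r (Gs Ω E s)) hE (τm := th d * r) (by
    filter_upwards [path hE] with e he heA
    obtain ⟨g, hg, hed⟩ := mem_thickening_iff.1 heA.2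
    have hgd := hg.2 r hr hrs
    obtain ⟨t, ht, hte⟩ := he heA.1 g r (1/2) hr (by linarith) (by norm_num) (hgd.trans (by gcongr))
    have ht0 := ht.1
    have hsub := ball_sub_ball_path ht hed.le
    refine ⟨_, t * r, by positivity, ?_, hsub.trans (ball_subset_thickening hg r), ?_, hte⟩
    · have := rvol_mono_ball (A := E ∩ ball (e + t • (g - e)) (t * r)) (B := E) (inter_subset_inter_right E hsub)
      rw [hte] at this
      have h3 := this.trans hgd
      have h4 : (t * r) ^ d ≤ (th d * r) ^ d := by
        rw [mul_pow (th d)]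
        have : (t * r) ^ d * ((1/2) * om d) ≤ (th d ^ d * r ^ d) * ((1/2) * om d) := by linarith
        exact le_of_mul_le_mul_right this (by positivity)
      exact le_of_pow_le_pow_left₀ hd0 (by positivity) h4
    · rw [dist_path ht0.le]
      nlinarith)
  refine key.trans (le_of_eq ?_)
  congr 1
  have : (11 : ℝ≥0∞) ^ d * 2 ^ (d + 3) = ENNReal.ofReal (11 ^ d * 2 ^ (d + 3)) := by
    rw [ENNReal.ofReal_mul (by positivity), ENNReal.ofReal_pow (by norm_num), ENNReal.ofReal_pow (by norm_num)]
    norm_num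
  rw [this, ← ENNReal.ofReal_mul (by positivity)]
  congr 1
  unfold th; field_simp

theorem B1 {d : ℕ} (hd : 1 ≤ d) {Ω E : Set (Vd d)} (hE : MeasurableSet E) (hP : Per Ω E ≠ ⊤) {s : ℝ} (hs : 0 < s)
    {ε : ℝ≥0∞} (hε : ε ≠ 0) : ∃ O, IsOpen O ∧ Gs Ω E s ⊆ O ∧ Per O E ≤ ε := by
  set G := Gs Ω E s with hG
  set a : ℝ → ℝ≥0∞ := fun ρ => Per (thickening ρ G) E with ha
  have hsubΩ : ∀ ρ, ρ ≤ s → thickening ρ G ⊆ Ω := by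
    intro ρ hρ x hx
    obtain ⟨g, hg, hxg⟩ := mem_thickening_iff.1 hx
    exact hg.1 (mem_ball.2 (hxg.trans_le hρ))
  have haP : ∀ ρ, ρ ≤ s → a ρ ≤ Per Ω E := fun ρ hρ => Per_mono hE (hsubΩ ρ hρ)
  by_contra hcon
  push Not at hcon
  have hlow : ∀ ρ, 0 < ρ → ε < a ρ := fun ρ hρ =>
    hcon _ isOpen_thickening (self_subset_thickening hρ G)
  -- main inequality
  have main : ∀ φ, IsTest Ω φ → ∃ ρ0 > 0, ∀ ρ, 0 < ρ → ρ ≤ ρ0 →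
      ENNReal.ofReal (∫ x in Eᶜ, divg φ x) + a (ρ / 2) ≤ Per Ω E + ENNReal.ofReal (1 / 2) * a (2 * ρ) := by
    intro φ hφ
    obtain ⟨M, hM0, hM⟩ := divg_bdd hφ
    refine ⟨min (s / 2) (3 / (2 * M + 1)), lt_min (by positivity) (by positivity), fun ρ hρ hρ0 => ?_⟩
    have hρs : 2 * ρ ≤ s := by have := hρ0.trans (min_le_left _ _); linarith
    have hρM : 2 * M * ρ ≤ 3 := by
      have := hρ0.trans (min_le_right _ _)
      rw [le_div_iff₀ (by positivity)] at this
      nlinarith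
    have hvol := Gs_vol hd (Ω := Ω) hE (r := 2 * ρ) (s := s) (by positivity) hρs
    have hvfin : volume (E ∩ thickening (2 * ρ) G) ≠ ⊤ :=
      (hvol.trans_lt (ENNReal.mul_lt_top ENNReal.ofReal_lt_top ((haP _ hρs).trans_lt hP.lt_top))).ne
    have hsub : thickening ρ G ⊆ thickening (2 * ρ) G := thickening_mono (by linarith) G
    have hsub2 : thickening ρ (thickening ρ G) ⊆ thickening (2 * ρ) G := by
      rw [two_mul]; exact thickening_thickening_subset ρ ρ G
    set O := Ω \ thickening (ρ / 2) G with hO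
    have hOs : tsupport φ \ thickening ρ G ⊆ O := by
      rintro x ⟨hx1, hx2⟩
      exact ⟨hφ.ts hx1, fun h => hx2 (thickening_mono (by linarith) G h)⟩
    have h1 := LU2 hE.compl (isOpen_thickening (δ := ρ) (E := G)) hρ hφ hOs hM0 hM (by
      rw [compl_compl]
      exact ((measure_mono (inter_subset_inter_right E hsub)).trans_lt hvfin.lt_top).ne)
    rw [compl_compl, Per_compl hE] at h1
    have h2 : ENNReal.ofReal (∫ x in Eᶜ, divg φ x) ≤ Per O E + ENNReal.ofReal (1 / 2) * a (2 * ρ) := by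
      refine h1.trans ?_
      rw [add_assoc]
      gcongr
      calc _ ≤ ENNReal.ofReal (3 / ρ + M) * volume (E ∩ thickening (2 * ρ) G) + ENNReal.ofReal M * volume (E ∩ thickening (2 * ρ) G) := by
            gcongr
            exact sdiff_subset.trans hsub2
        _ = ENNReal.ofReal (3 / ρ + M + M) * volume (E ∩ thickening (2 * ρ) G) := by
            rw [← add_mul, ← ENNReal.ofReal_add (by positivity) hM0]
        _ ≤ ENNReal.ofReal (6 / ρ) * (ENNReal.ofReal (2 * ρ / 24) * a (2 * ρ)) := by
            gcongr
            rw [show 3 / ρ + M + M = (3 + 2 * M * ρ) / ρ by field_simp; ring]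
            gcongr; linarith
        _ = _ := by
            rw [← mul_assoc, ← ENNReal.ofReal_mul (by positivity)]
            congr 2; field_simp; norm_num
    have h3 := Per_superadd (U := O) (V := thickening (ρ / 2) G) (Ω := Ω) hE
      (disjoint_left.2 fun x hx hx' => hx.2 hx') sdiff_subset (hsubΩ _ (by linarith))
    calc _ ≤ Per O E + ENNReal.ofReal (1 / 2) * a (2 * ρ) + a (ρ / 2) := by gcongr
      _ = (Per O E + a (ρ / 2)) + ENNReal.ofReal (1 / 2) * a (2 * ρ) := by ring
      _ ≤ _ := by gcongr
  -- infimum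
  set i : ℝ≥0∞ := ⨅ ρ : Ioc (0:ℝ) s, a ρ with hi
  have hi_le : ∀ ρ, 0 < ρ → ρ ≤ s → i ≤ a ρ := fun ρ h h' => iInf_le (fun ρ : Ioc (0:ℝ) s => a ρ) ⟨ρ, h, h'⟩
  have hiε : ε ≤ i := le_iInf fun ρ => (hlow _ ρ.2.1).le
  have hit : i ≠ ⊤ := ((hi_le s hs le_rfl).trans (haP s le_rfl)).trans_lt hP.lt_top |>.ne
  have hi0 : 0 < i.toReal := ENNReal.toReal_pos (fun h => hε (le_antisymm (h ▸ hiε) zero_le)) hit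
  have hPi : i ≤ Per Ω E := (hi_le s hs le_rfl).trans (haP s le_rfl)
  have hlt1 : i < i + i / 8 := ENNReal.lt_add_right hit (by
    rw [Ne, ENNReal.div_eq_zero_iff]; push Not; exact ⟨fun h => by simp [h] at hi0, by norm_num⟩)
  obtain ⟨ρ1, hρ1⟩ := iInf_lt_iff.1 hlt1
  have hlt2 : Per Ω E - i / 8 < Per Ω Eᶜ := by
    rw [Per_compl hE]
    refine ENNReal.sub_lt_self hP (fun h => ?_) (by
      rw [Ne, ENNReal.div_eq_zero_iff]; push Not; exact ⟨fun h => by simp [h] at hi0, by norm_num⟩)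
    rw [h] at hPi; simp [le_antisymm hPi zero_le] at hi0
  obtain ⟨φ, hφ, hφl⟩ := Per_lt_exists hE.compl hlt2
  obtain ⟨ρ0, hρ0, hm⟩ := main φ hφ
  set ρ := min ρ0 (min (ρ1 / 2) (s / 2)) with hρ
  have hρpos : 0 < ρ := lt_min hρ0 (lt_min (by have := ρ1.2.1; positivity) (by positivity))
  have m := hm ρ hρpos (min_le_left _ _)
  have hρs : ρ ≤ s / 2 := (min_le_right _ _).trans (min_le_right _ _)
  have hρr : ρ ≤ ρ1 / 2 := (min_le_right _ _).trans (min_le_left _ _)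
  have k1 : i ≤ a (ρ / 2) := hi_le _ (by positivity) (by linarith)
  have k2 : a (2 * ρ) ≤ i + i / 8 := by
    refine le_trans (Per_mono hE (thickening_mono (by linarith) G)) hρ1.le
  have k3 : Per Ω E ≤ ENNReal.ofReal (∫ x in Eᶜ, divg φ x) + i / 8 := tsub_le_iff_right.1 hφl.le
  have m2 : ENNReal.ofReal (∫ x in Eᶜ, divg φ x) + i ≤
      (ENNReal.ofReal (∫ x in Eᶜ, divg φ x) + i / 8) + ENNReal.ofReal (1 / 2) * (i + i / 8) :=
    ((add_le_add_right k1 _).trans m).trans (add_le_add k3 (mul_le_mul' le_rfl k2))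
  have hi8 : i = ENNReal.ofReal i.toReal := (ENNReal.ofReal_toReal hit).symm
  have hdiv : i / 8 = ENNReal.ofReal (i.toReal / 8) := by
    rw [ENNReal.ofReal_div_of_pos (by norm_num), ← hi8]; norm_num
  rw [add_assoc, ENNReal.add_le_add_iff_left ENNReal.ofReal_ne_top, hdiv, hi8, ENNReal.toReal_ofReal ENNReal.toReal_nonneg, 
    ← ENNReal.ofReal_add (by positivity) (by positivity), ← ENNReal.ofReal_mul (by positivity),
    ← ENNReal.ofReal_add (by positivity) (by positivity), ENNReal.ofReal_le_ofReal_iff (by positivity)] at m2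
  linarith

theorem Gs_lim {d : ℕ} {Ω E : Set (Vd d)} (hΩ : IsOpen Ω) {x : Vd d} (hx : x ∈ Ω)
    (h : ∀ n : ℕ, x ∉ Gs Ω E (1 / ((n:ℝ) + 1))) : x ∈ mClos E := by
  have hom := om_pos d
  have hth := th_pos d
  have hκ : 0 < (1/2) * th d ^ d * om d := by positivity
  obtain ⟨s, hs, hsΩ⟩ := Metric.isOpen_iff.1 hΩ x hx
  refine lt_of_lt_of_le (ENNReal.ofReal_pos.2 hκ) ?_
  refine le_limsup_of_frequently_le' ?_
  rw [Filter.frequently_iff]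
  intro V hV
  obtain ⟨δ, hδ, hδV⟩ := mem_nhdsGT_iff_exists_Ioo_subset.1 hV
  obtain ⟨n, hn⟩ := exists_nat_one_div_lt (lt_min hs hδ)
  have := h n
  simp only [Gs, mem_ofPred_eq, not_and, not_forall, not_le] at this
  obtain ⟨r, hr0, hrs, hr⟩ := this ((ball_subset_ball (hn.le.trans (min_le_left _ _))).trans hsΩ)
  refine ⟨r, hδV ⟨hr0, hrs.trans_lt (hn.trans_le (min_le_right _ _))⟩, ?_⟩
  rw [ENNReal.le_div_iff_mul_le (Or.inl (ENNReal.ofReal_pos.2 (by positivity)).ne') (Or.inl ENNReal.ofReal_ne_top),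
    ← ENNReal.ofReal_mul hκ.le, inter_comm]
  refine ENNReal.ofReal_le_of_le_toReal ?_
  rw [Measure.real] at hr
  refine le_trans (le_of_eq ?_) hr.le
  ring

theorem B2 {d : ℕ} (hd : 1 ≤ d) {Ω E : Set (Vd d)} (hΩ : IsOpen Ω) (hE : MeasurableSet E) (hP : Per Ω E ≠ ⊤)
    {ε : ℝ≥0∞} (hε : ε ≠ 0) : ∃ O, IsOpen O ∧ Per O E ≤ ε ∧ Ω \ mBdry E ⊆ O := by
  obtain ⟨δ, hδ0, hδ⟩ := ENNReal.exists_pos_sum_of_countable' (ENNReal.half_pos hε).ne' ℕ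
  have hs : ∀ n : ℕ, (0:ℝ) < 1 / ((n:ℝ) + 1) := fun n => by positivity
  choose O hO1 hO2 hO3 using fun n : ℕ => B1 hd hE hP (hs n) (hδ0 n).ne'
  have hP' : Per Ω Eᶜ ≠ ⊤ := by rwa [Per_compl hE]
  choose Q hQ1 hQ2 hQ3 using fun n : ℕ => B1 hd hE.compl hP' (hs n) (hδ0 n).ne'
  refine ⟨(⋃ n, O n) ∪ ⋃ n, Q n, (isOpen_iUnion hO1).union (isOpen_iUnion hQ1), ?_, ?_⟩
  · refine (Per_union hE (isOpen_iUnion hO1) (isOpen_iUnion hQ1)).trans ?_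
    have a1 : Per (⋃ n, O n) E ≤ ε / 2 := (Per_iUnion hE hO1).trans ((ENNReal.tsum_le_tsum hO3).trans hδ.le)
    have a2 : Per (⋃ n, Q n) E ≤ ε / 2 := by
      refine (Per_iUnion hE hQ1).trans ((ENNReal.tsum_le_tsum fun n => ?_).trans hδ.le)
      rw [← Per_compl hE]; exact hQ3 n
    exact (add_le_add a1 a2).trans (ENNReal.add_halves ε).le
  · rintro x ⟨hx, hxb⟩
    by_contra hc
    rw [mem_union, not_or, mem_iUnion, mem_iUnion, not_exists, not_exists] at hc
    exact hxb ⟨Gs_lim hΩ hx fun n h => hc.1 n (hO2 n h), Gs_lim hΩ hx fun n h => hc.2 n (hQ2 n h)⟩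

theorem pow_diff {d : ℕ} {r h : ℝ} (hr : 0 < r) (hh : 0 < h) (hhr : h ≤ r) :
    (r + h) ^ d - r ^ d ≤ d * 2 ^ (d - 1) * (h * r ^ (d - 1)) := by
  have := (Commute.all (r + h) r).geom_sum₂_mul d
  have e : (r + h) ^ d - r ^ d = (∑ i ∈ Finset.range d, (r + h) ^ i * r ^ (d - 1 - i)) * h := by
    rw [← this]; ring
  rw [e]
  have hs : ∑ i ∈ Finset.range d, (r + h) ^ i * r ^ (d - 1 - i) ≤ ∑ i ∈ Finset.range d, (2 * r) ^ (d - 1) := by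
    refine Finset.sum_le_sum fun i hi => ?_
    have hi' : i ≤ d - 1 := by have := Finset.mem_range.1 hi; omega
    calc (r + h) ^ i * r ^ (d - 1 - i) ≤ (2 * r) ^ i * (2 * r) ^ (d - 1 - i) := by gcongr <;> linarith
      _ = (2 * r) ^ (d - 1) := by rw [← pow_add]; congr 1; omega
  rw [Finset.sum_const, Finset.card_range, nsmul_eq_mul, mul_pow] at hs
  calc _ ≤ (d * (2 ^ (d - 1) * r ^ (d - 1))) * h := by gcongr
    _ = _ := by ring

noncomputable def CB (d : ℕ) : ℝ := om d * (4 * d * 2 ^ (d - 1) + 1)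

theorem CB_pos (d : ℕ) : 0 < CB d := by have := om_pos d; unfold CB; positivity

/-- finite ball cover estimate -/
theorem B3 {d : ℕ} (hd : 1 ≤ d) {Ω E O : Set (Vd d)} (hE : MeasurableSet E) {φ : Vd d → Vd d} (hφ : IsTest Ω φ)
    {M : ℝ} (hM0 : 0 ≤ M) (hM : ∀ x, |divg φ x| ≤ M) (F : Finset ℕ) (c : ℕ → Vd d) (r : ℕ → ℝ)
    (hr : ∀ n ∈ F, 0 < r n) (hrM : ∀ n ∈ F, M * r n ≤ 1)
    (hO : tsupport φ ⊆ O ∪ ⋃ n ∈ F, ball (c n) (r n)) :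
    ENNReal.ofReal (∫ x in E, divg φ x) ≤ Per O E + ENNReal.ofReal (CB d) * ∑ n ∈ F, ENNReal.ofReal (r n ^ (d - 1)) := by
  have hom := om_pos d
  obtain ⟨h, hh, hhr, hhM⟩ : ∃ h > 0, (∀ n ∈ F, h ≤ r n) ∧ M * h ≤ 1 := by
    have h1 : ∃ h > 0, ∀ n ∈ F, h ≤ r n := by
      rcases F.eq_empty_or_nonempty with rfl | hne
      · exact ⟨1, one_pos, by simp⟩
      · obtain ⟨m, hm, hmin⟩ := F.exists_min_image r hne
        exact ⟨r m, hr m hm, hmin⟩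
    obtain ⟨h1, h10, h1r⟩ := h1
    refine ⟨min h1 (1 / (M + 1)), lt_min h10 (by positivity), fun n hn => (min_le_left _ _).trans (h1r n hn), ?_⟩
    have := min_le_right h1 (1 / (M + 1))
    have h0 : 0 < min h1 (1 / (M + 1)) := lt_min h10 (by positivity)
    rw [le_div_iff₀ (by positivity)] at this
    nlinarith
  set U := ⋃ n ∈ F, ball (c n) (r n) with hU
  have hUo : IsOpen U := isOpen_biUnion fun _ _ => isOpen_ball
  set S : ℝ≥0∞ := ∑ n ∈ F, ENNReal.ofReal (r n ^ (d - 1)) with hS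
  have vU : ENNReal.ofReal M * volume (Eᶜ ∩ U) ≤ ENNReal.ofReal (om d) * S := by
    calc _ ≤ ENNReal.ofReal M * ∑ n ∈ F, volume (ball (c n) (r n)) := by
          gcongr
          exact (measure_mono inter_subset_right).trans (measure_biUnion_finset_le _ _)
      _ = ∑ n ∈ F, ENNReal.ofReal M * volume (ball (c n) (r n)) := Finset.mul_sum _ _ _
      _ ≤ ∑ n ∈ F, ENNReal.ofReal (om d) * ENNReal.ofReal (r n ^ (d - 1)) := by
          refine Finset.sum_le_sum fun n hn => ?_
          have := hr n hn
          rw [vol_ball _ (hr n hn), ← ENNReal.ofReal_mul hM0, ← ENNReal.ofReal_mul hom.le]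
          refine ENNReal.ofReal_le_ofReal ?_
          have e : r n ^ d = r n * r n ^ (d - 1) := by
            rw [← pow_succ']; congr 1; omega
          rw [e]
          have h2 : 0 ≤ r n ^ (d - 1) * om d := by positivity
          calc _ = (M * r n) * (r n ^ (d - 1) * om d) := by ring
            _ ≤ 1 * (r n ^ (d - 1) * om d) := mul_le_mul_of_nonneg_right (hrM n hn) h2
            _ = _ := by ring
      _ = _ := (Finset.mul_sum _ _ _).symm
  have vA : ENNReal.ofReal (3 / h + M) * volume (Eᶜ ∩ (thickening h U \ U)) ≤
      ENNReal.ofReal (om d * (4 * d * 2 ^ (d - 1))) * S := by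
    have hsub : Eᶜ ∩ (thickening h U \ U) ⊆ ⋃ n ∈ F, (ball (c n) (r n + h) \ ball (c n) (r n)) := by
      rintro x ⟨_, hx1, hx2⟩
      obtain ⟨y, hy, hxy⟩ := mem_thickening_iff.1 hx1
      simp only [hU, mem_iUnion, exists_prop] at hy hx2 ⊢
      obtain ⟨n, hn, hyn⟩ := hy
      refine ⟨n, hn, ?_, fun h => hx2 ⟨n, hn, h⟩⟩
      rw [mem_ball] at hyn ⊢
      linarith [dist_triangle x y (c n)]
    calc _ ≤ ENNReal.ofReal (3 / h + M) * ∑ n ∈ F, volume (ball (c n) (r n + h) \ ball (c n) (r n)) := by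
          gcongr
          exact (measure_mono hsub).trans (measure_biUnion_finset_le _ _)
      _ = ∑ n ∈ F, ENNReal.ofReal (3 / h + M) * volume (ball (c n) (r n + h) \ ball (c n) (r n)) := Finset.mul_sum _ _ _
      _ ≤ ∑ n ∈ F, ENNReal.ofReal (om d * (4 * d * 2 ^ (d - 1))) * ENNReal.ofReal (r n ^ (d - 1)) := by
          refine Finset.sum_le_sum fun n hn => ?_
          have hrn := hr n hn
          rw [measure_sdiff (ball_subset_ball (by linarith)) isOpen_ball.measurableSet.nullMeasurableSet measure_ball_lt_top.ne,
            vol_ball _ hrn, vol_ball _ (by positivity), ← ENNReal.ofReal_sub _ (by positivity),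
            ← ENNReal.ofReal_mul (by positivity), ← ENNReal.ofReal_mul (by positivity)]
          refine ENNReal.ofReal_le_ofReal ?_
          rw [← sub_mul]
          have h3 : 3 / h + M ≤ 4 / h := by
            rw [show 3 / h + M = (3 + M * h) / h by field_simp]
            gcongr; linarith
          have hp := pow_diff (d := d) hrn hh (hhr n hn)
          have hp0 : 0 ≤ (r n + h) ^ d - r n ^ d := sub_nonneg.2 (by gcongr; linarith)
          calc _ ≤ (4 / h) * ((d * 2 ^ (d - 1) * (h * r n ^ (d - 1))) * om d) := by gcongr
            _ = _ := by field_simp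
      _ = _ := (Finset.mul_sum _ _ _).symm
  have hfin : volume (Eᶜ ∩ U) ≠ ⊤ := by
    refine ((measure_mono inter_subset_right).trans (measure_biUnion_finset_le _ _)).trans_lt ?_ |>.ne
    exact ENNReal.sum_lt_top.2 fun n _ => measure_ball_lt_top
  refine (LU2 hE hUo hh hφ (fun x hx => (hO hx.1).resolve_right hx.2) hM0 hM hfin).trans ?_
  rw [add_assoc]
  gcongr
  refine (add_le_add vA vU).trans (le_of_eq ?_)
  rw [← add_mul, ← ENNReal.ofReal_add (by positivity) (by positivity)]
  unfold CB; congr 2; ring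

theorem ball_of_diam {d : ℕ} (hd : 1 ≤ d) {t : Set (Vd d)} (hne : t.Nonempty) {δ : ℝ} (hδ : 0 < δ)
    (ht : ediam t ≤ ENNReal.ofReal δ) {e : ℝ≥0∞} (he : 0 < e) :
    ∃ (c : Vd d) (r : ℝ), 0 < r ∧ r ≤ 2 * δ ∧ t ⊆ ball c r ∧
      ENNReal.ofReal (r ^ (d - 1)) ≤ ediam t ^ ((d:ℝ) - 1) + e := by
  obtain ⟨c, hc⟩ := hne
  have hfin : ediam t ≠ ⊤ := (ht.trans_lt ENNReal.ofReal_lt_top).ne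
  set D := (ediam t).toReal with hD
  have hDδ : D ≤ δ := ENNReal.toReal_le_of_le_ofReal hδ.le ht
  have hD0 : 0 ≤ D := ENNReal.toReal_nonneg
  have hcont : Tendsto (fun x : ℝ => ENNReal.ofReal ((D + x) ^ (d - 1))) (nhdsWithin 0 (Ioi 0))
      (nhds (ENNReal.ofReal (D ^ (d - 1)))) := by
    have : Continuous (fun x : ℝ => ENNReal.ofReal ((D + x) ^ (d - 1))) := ENNReal.continuous_ofReal.comp (by fun_prop)
    have h := this.tendsto 0
    rw [add_zero] at h
    exact h.mono_left nhdsWithin_le_nhds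
  have hlt : ENNReal.ofReal (D ^ (d - 1)) < ENNReal.ofReal (D ^ (d - 1)) + e :=
    ENNReal.lt_add_right ENNReal.ofReal_ne_top he.ne'
  have hev := (hcont.eventually (gt_mem_nhds hlt)).and (Ioo_mem_nhdsGT hδ)
  obtain ⟨x, hx1, hx2⟩ := hev.exists
  refine ⟨c, D + x, by linarith [hx2.1], by linarith [hx2.2], ?_, ?_⟩
  · intro y hy
    have h1 : edist y c ≤ ediam t := edist_le_ediam_of_mem hy hc
    have h2 : dist y c ≤ D := by
      rw [dist_edist]; exact ENNReal.toReal_mono hfin h1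
    rw [mem_ball]; linarith [hx2.1]
  · refine hx1.le.trans (le_of_eq ?_)
    congr 1
    rw [show (d:ℝ) - 1 = ((d - 1 : ℕ) : ℝ) by push_cast [hd]; ring, ENNReal.rpow_natCast, ENNReal.ofReal_pow hD0, hD,
      ENNReal.ofReal_toReal hfin]

theorem B4 {d : ℕ} (hd : 1 ≤ d) {Ω E : Set (Vd d)} (hΩ : IsOpen Ω) (hE : MeasurableSet E) (hP : Per Ω E ≠ ⊤) :
    Per Ω E ≤ ENNReal.ofReal (CB d) * μH[(d:ℝ) - 1] (mBdry E ∩ Ω) := by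
  have hCB := CB_pos d
  set A := mBdry E ∩ Ω with hA
  set H := μH[(d:ℝ) - 1] A with hH
  by_cases hHt : H = ⊤
  · rw [hHt, ENNReal.mul_top (ENNReal.ofReal_pos.2 hCB).ne']; exact le_top
  refine Per_le hE fun φ hφ => ?_
  obtain ⟨M, hM0, hM⟩ := divg_bdd hφ
  refine ENNReal.le_of_forall_pos_le_add fun ε hε _ => ?_
  have hε0 : (ε : ℝ≥0∞) / 2 ≠ 0 := (ENNReal.half_pos (by exact_mod_cast hε.ne')).ne'
  obtain ⟨O, hOo, hOP, hOs⟩ := B2 hd hΩ hE hP hε0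
  -- e : small
  set e : ℝ≥0∞ := (ε : ℝ≥0∞) / 2 / ENNReal.ofReal (CB d) / 2 with he
  have he0 : e ≠ 0 := (ENNReal.half_pos (ENNReal.div_pos hε0 ENNReal.ofReal_ne_top).ne').ne'
  set δ : ℝ := 1 / (2 * (M + 1)) with hδd
  have hδ : 0 < δ := by positivity
  have hinf : (⨅ (t : ℕ → Set (Vd d)) (_ : A ⊆ ⋃ n, t n) (_ : ∀ n, ediam (t n) ≤ ENNReal.ofReal δ),
      ∑' n, ⨆ _ : (t n).Nonempty, ediam (t n) ^ ((d:ℝ) - 1)) ≤ H := by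
    rw [hH, Measure.hausdorffMeasure_apply]
    exact le_iSup₂_of_le (ENNReal.ofReal δ) (ENNReal.ofReal_pos.2 hδ) le_rfl
  have hlt := hinf.trans_lt (ENNReal.lt_add_right hHt he0)
  simp only [iInf_lt_iff] at hlt
  obtain ⟨t, htA, htd, hts⟩ := hlt
  obtain ⟨η, hη0, hη⟩ := ENNReal.exists_pos_sum_of_countable' he0 ℕ
  have hex : ∀ n, ∃ (c : Vd d) (r : ℝ), (t n).Nonempty → 0 < r ∧ r ≤ 2 * δ ∧ t n ⊆ ball c r ∧
      ENNReal.ofReal (r ^ (d - 1)) ≤ ediam (t n) ^ ((d:ℝ) - 1) + η n := by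
    intro n
    by_cases h : (t n).Nonempty
    · obtain ⟨c, r, h'⟩ := ball_of_diam hd h hδ (htd n) (hη0 n)
      exact ⟨c, r, fun _ => h'⟩
    · exact ⟨0, 0, fun h' => absurd h' h⟩
  choose c r hcr using hex
  -- finite subcover
  have hK : IsCompact (tsupport φ \ O) := hφ.cs.isCompact.diff hOo
  have hcov : tsupport φ \ O ⊆ ⋃ n ∈ {n | (t n).Nonempty}, ball (c n) (r n) := by
    rintro x ⟨hx1, hx2⟩
    have hxA : x ∈ A := ⟨by by_contra hb; exact hx2 (hOs ⟨hφ.ts hx1, hb⟩), hφ.ts hx1⟩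
    obtain ⟨n, hn⟩ := mem_iUnion.1 (htA hxA)
    exact mem_biUnion (show n ∈ {n | (t n).Nonempty} from ⟨x, hn⟩) ((hcr n ⟨x, hn⟩).2.2.1 hn)
  obtain ⟨F', hF's, hF'f, hF'c⟩ := hK.elim_finite_subcover_image (fun n _ => isOpen_ball) hcov
  set F := hF'f.toFinset with hF
  have hFne : ∀ n ∈ F, (t n).Nonempty := fun n hn => hF's (hF'f.mem_toFinset.1 hn)
  have hb := B3 hd hE hφ hM0 hM F c r (fun n hn => (hcr n (hFne n hn)).1) (fun n hn => by
      have := (hcr n (hFne n hn)).2.1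
      calc M * r n ≤ M * (2 * δ) := by gcongr
        _ = M / (M + 1) := by rw [hδd]; field_simp
        _ ≤ 1 := by rw [div_le_one (by positivity)]; linarith) (O := O) (by
      intro x hx
      by_cases hxO : x ∈ O
      · exact Or.inl hxO
      · right
        have := hF'c ⟨hx, hxO⟩
        simpa [hF] using this)
  refine hb.trans ?_
  have hsum : ∑ n ∈ F, ENNReal.ofReal (r n ^ (d - 1)) ≤ H + e + e := by
    calc _ ≤ ∑ n ∈ F, ((⨆ _ : (t n).Nonempty, ediam (t n) ^ ((d:ℝ) - 1)) + η n) := by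
          refine Finset.sum_le_sum fun n hn => ?_
          have := hFne n hn
          rw [iSup_pos this]
          exact (hcr n this).2.2.2
      _ ≤ ∑' n, ((⨆ _ : (t n).Nonempty, ediam (t n) ^ ((d:ℝ) - 1)) + η n) := ENNReal.sum_le_tsum F
      _ = _ := ENNReal.tsum_add
      _ ≤ _ := add_le_add hts.le hη.le
  have hee : ENNReal.ofReal (CB d) * (e + e) = ε / 2 := by
    rw [he, ENNReal.add_halves, ENNReal.mul_div_cancel (ENNReal.ofReal_pos.2 hCB).ne' ENNReal.ofReal_ne_top]
  calc _ ≤ (ε:ℝ≥0∞) / 2 + ENNReal.ofReal (CB d) * (H + e + e) := by gcongr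
    _ = ENNReal.ofReal (CB d) * H + ((ε:ℝ≥0∞) / 2 + ε / 2) := by
      rw [add_assoc, mul_add, hee]; ring
    _ = _ := by rw [ENNReal.add_halves]

theorem thmB {d : ℕ} (hd : 1 ≤ d) {Ω E : Set (Vd d)} (hΩ : IsOpen Ω) (hE : MeasurableSet E)
    (hL : HasLocFinitePerimeter E) :
    Per Ω E ≤ ENNReal.ofReal (CB d) * μH[(d:ℝ) - 1] (mBdry E ∩ Ω) := by
  refine Per_le hE fun φ hφ => ?_
  obtain ⟨η, hη, hηΩ⟩ := hφ.cs.isCompact.exists_thickening_subset_open hΩ hφ.ts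
  have hφ' : IsTest (thickening η (tsupport φ)) φ := ⟨hφ.cd, hφ.cs, self_subset_thickening hη _, hφ.le⟩
  have hfin : Per (thickening η (tsupport φ)) E ≠ ⊤ :=
    (hL _ isOpen_thickening hφ.cs.isCompact.isBounded.thickening).ne
  refine (le_Per hE hφ').trans ((B4 hd isOpen_thickening hE hfin).trans ?_)
  gcongr

theorem stmt15 (d : ℕ) (hd : 1 ≤ d) :
    ∃ Cd : ℝ≥0∞, Cd ≠ ⊤ ∧
      (∀ (Ω E : Set (EuclideanSpace ℝ (Fin d))), IsOpen Ω → MeasurableSet E →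
        HasLocFinitePerimeter E →
        var Ω (fun x => (uncMax Ω E x).toReal)
          ≤ Cd * μH[(d : ℝ) - 1] (mBdry E ∩ Ω)) ∧
      (∀ E : Set (EuclideanSpace ℝ (Fin d)), MeasurableSet E →
        HasLocFinitePerimeter E →
        var Set.univ (fun x => (uncMax Set.univ E x).toReal)
          ≤ Cd * var Set.univ (E.indicator fun _ => (1 : ℝ))) := by
  refine ⟨max (CA d) (CA d * ENNReal.ofReal (CB d)), ?_, ?_, ?_⟩
  · exact (max_lt (CA_ne_top hd).lt_top (ENNReal.mul_lt_top (CA_ne_top hd).lt_top ENNReal.ofReal_lt_top)).ne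
  · intro Ω E hΩ hE hL
    refine (thmA hd hΩ hE).trans ?_
    calc _ ≤ CA d * (ENNReal.ofReal (CB d) * μH[(d:ℝ) - 1] (mBdry E ∩ Ω)) := mul_le_mul' le_rfl (thmB hd hΩ hE hL)
      _ = (CA d * ENNReal.ofReal (CB d)) * μH[(d:ℝ) - 1] (mBdry E ∩ Ω) := (mul_assoc _ _ _).symm
      _ ≤ _ := mul_le_mul' (le_max_right _ _) le_rfl
  · intro E hE _
    exact (thmA hd isOpen_univ hE).trans (mul_le_mul' (le_max_left _ _) le_rfl)
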